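/- Factorized (spectral) form of the symplectic Cayley–Hamilton identity: Let {R,F} be a compatible pair of R-matrices on V = ℂ^N with F strict skew invertible and R skew invertible of Sp(2k) type, let C(R,F) be the (commutative) subalgebra of M(R,F) generated by g and a_1,…,a_k, and let E_{2k} := ℂ[ν_0,ν_1,…,ν_{2k}]/(ν_{k+i}ν_{k+1−i} − ν_0², i = 1,…,k). Suppose there exists a ℂ-algebra homomorphism π_{Sp(2k)} : C(R,F) → E_{2k} with π_{Sp(2k)}(g) = ν_0² and π_{Sp(2k)}(a_i) = e_i(ν_0, −ν_0, ν_1, …, ν_{2k}) for i = 1,…,k (this holds in particular when g, a_1,…,a_k are algebraically independent). Regard E_{2k} as a C(R,F)-module via π_{Sp(2k)}, and let P(R,F) be viewed as a right C(R,F)-module by entrywise right multiplication. Then in the space of N×N matrices over P(R,F) ⊗_{C(R,F)} E_{2k} one has Σ_{i=0}^{2k} (−q)^i · M^{[2k−i]} ⊗ e_i(ν_1,…,ν_{2k}) = 0; equivalently, the Cayley–Hamilton polynomial factorizes completely as the ⋆-product ∏⋆_{i=1}^{2k} (M − q ν_i I) = 0, the ν_i playing the role of eigenvalues of M. -/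

import Mathlib

open scoped BigOperators
open Matrix

noncomputable section

namespace QMA

/-- The space of operators on `V^{⊗ n}` (matrices indexed by multi-indices),
    with entries in `A`, where `V = ℂ^N`. -/
abbrev MatV (N n : ℕ) (A : Type*) := Matrix (Fin n → Fin N) (Fin n → Fin N) A

variable {N : ℕ} [NeZero N] {A : Type*}

/-- The `j`-th component of a multi-index (junk value if out of range). -/
def idx {n : ℕ} (a : Fin n → Fin N) (j : ℕ) : Fin N :=
  if h : j < n then a ⟨j, h⟩ else ⟨0, Nat.pos_of_ne_zero (NeZero.ne N)⟩

/-- Place a two-factor operator `X` on the (0-indexed) tensor factors `p, p+1`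
    of `V^{⊗ n}`, acting as the identity elsewhere. -/
def lift2 [Semiring A] {n : ℕ} (p : ℕ) (X : MatV N 2 A) : MatV N n A :=
  fun a b =>
    if ∀ m : Fin n, (m : ℕ) = p ∨ (m : ℕ) = p + 1 ∨ a m = b m then
      X ![idx a p, idx a (p + 1)] ![idx b p, idx b (p + 1)]
    else 0

/-- Place a one-factor operator `X` on the (0-indexed) tensor factor `p`
    of `V^{⊗ n}`, acting as the identity elsewhere. -/
def lift1 [Semiring A] {n : ℕ} (p : ℕ) (X : Matrix (Fin N) (Fin N) A) : MatV N n A :=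
  fun a b =>
    if ∀ m : Fin n, (m : ℕ) = p ∨ a m = b m then X (idx a p) (idx b p) else 0

/-- Extend an operator on `V^{⊗ n}` to `V^{⊗ (n+1)}` by the identity on the last factor. -/
def ext1 [Semiring A] {n : ℕ} (X : MatV N n A) : MatV N (n + 1) A :=
  fun a b =>
    if a (Fin.last n) = b (Fin.last n) then X (fun t => a t.castSucc) (fun t => b t.castSucc)
    else 0

/-- The partial trace over the last tensor factor, weighted by the matrix `D`. -/
def ptrace [NonUnitalNonAssocSemiring A] {n : ℕ} (D : Matrix (Fin N) (Fin N) A)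
    (X : MatV N (n + 1) A) : MatV N n A :=
  fun a b => ∑ m : Fin N, ∑ c : Fin N, D m c * X (Fin.snoc a c) (Fin.snoc b m)

/-- The full `D`-weighted trace over all `n` tensor factors. -/
def trAll [NonUnitalNonAssocSemiring A] (D : Matrix (Fin N) (Fin N) A) :
    (n : ℕ) → MatV N n A → A
  | 0, X => X (fun i => i.elim0) (fun i => i.elim0)
  | n + 1, X => trAll D n (ptrace D X)

/-- The `D`-weighted trace over all tensor factors except the first. -/
def trTail [NonUnitalNonAssocSemiring A] (D : Matrix (Fin N) (Fin N) A) :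
    (j : ℕ) → MatV N (j + 1) A → MatV N 1 A
  | 0, X => X
  | j + 1, X => trTail D j (ptrace D X)

/-- Identify operators on `V^{⊗1}` with `N × N` matrices. -/
def toN (X : MatV N 1 A) : Matrix (Fin N) (Fin N) A := fun i j => X (fun _ => i) (fun _ => j)

/-- Entrywise embedding of complex matrices into matrices over a `ℂ`-algebra. -/
def cmap [Ring A] [Algebra ℂ A] {m : Type*} (X : Matrix m m ℂ) : Matrix m m A :=
  X.map (algebraMap ℂ A)

/-- Multiply all entries of a matrix by `c` on the right. -/
def rmulE [Mul A] {m : Type*} (X : Matrix m m A) (c : A) : Matrix m m A := fun a b => X a b * c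

/-- Multiply all entries of a matrix by `c` on the left. -/
def lmulE [Mul A] {m : Type*} (c : A) (X : Matrix m m A) : Matrix m m A := fun a b => c * X a b

/-- The operator `D` associated with a skew inverse `Ψ`: `D_1 = Tr_(2) Ψ₁₂`. -/
def Dof (Ψ : MatV N 2 ℂ) : Matrix (Fin N) (Fin N) ℂ :=
  fun i j => ∑ m : Fin N, Ψ ![i, m] ![j, m]

/-- `Ψ` is a skew inverse of the R-matrix `R`:
    `Tr_(2)(R₁₂ Ψ₂₃) = Tr_(2)(Ψ₁₂ R₂₃) = P₁₃`. -/
def SkewPair (R Ψ : MatV N 2 ℂ) : Prop :=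
  (∀ a1 a3 b1 b3 : Fin N,
      (∑ m : Fin N, ∑ c : Fin N, R ![a1, m] ![b1, c] * Ψ ![c, a3] ![m, b3]) =
        if a1 = b3 ∧ a3 = b1 then 1 else 0) ∧
  (∀ a1 a3 b1 b3 : Fin N,
      (∑ m : Fin N, ∑ c : Fin N, Ψ ![a1, m] ![b1, c] * R ![c, a3] ![m, b3]) =
        if a1 = b3 ∧ a3 = b1 then 1 else 0)

/-- The `q`-number `j_q = (q^j - q^{-j})/(q - q^{-1})`. -/
def nq (q : ℂ) (j : ℕ) : ℂ := (q ^ (j : ℤ) - q ^ (-(j : ℤ))) / (q - q⁻¹)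

/-- The rank-one projector `K = μ⁻¹ (q-q⁻¹)⁻¹ (qI - R)(q⁻¹I + R)` of a BMW-type R-matrix. -/
def bmwK (q μ : ℂ) (R : MatV N 2 ℂ) : MatV N 2 ℂ :=
  (μ⁻¹ * (q - q⁻¹)⁻¹) • ((q • (1 : MatV N 2 ℂ) - R) * (q⁻¹ • (1 : MatV N 2 ℂ) + R))

/-- The braid relation `R₁ R₂ R₁ = R₂ R₁ R₂`. -/
def IsBraid (R : MatV N 2 ℂ) : Prop :=
  lift2 (n := 3) 0 R * lift2 1 R * lift2 0 R = lift2 1 R * lift2 0 R * lift2 1 R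

/-- `R` is an R-matrix of BMW type with eigenvalues `q, -q⁻¹, μ`. -/
def IsBMW (q μ : ℂ) (R : MatV N 2 ℂ) : Prop :=
  (q • (1 : MatV N 2 ℂ) - R) * (q⁻¹ • (1 : MatV N 2 ℂ) + R) * (μ • (1 : MatV N 2 ℂ) - R) = 0 ∧
  lift2 (n := 3) 1 (bmwK q μ R) * lift2 0 (bmwK q μ R) =
      lift2 1 (bmwK q μ R) * lift2 0 R * lift2 1 R ∧
  lift2 (n := 3) 1 (bmwK q μ R) * lift2 0 (bmwK q μ R) =
      lift2 1 (bmwK q μ R) * lift2 0 R⁻¹ * lift2 1 R⁻¹ ∧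
  lift2 (n := 3) 0 (bmwK q μ R) * lift2 1 (bmwK q μ R) * lift2 0 (bmwK q μ R) =
      lift2 0 (bmwK q μ R)

/-- `{R, F}` is a compatible pair of R-matrices (twist relations). -/
def Compatible (R F : MatV N 2 ℂ) : Prop :=
  lift2 (n := 3) 0 R * lift2 1 F * lift2 0 F = lift2 1 F * lift2 0 F * lift2 1 R ∧
  lift2 (n := 3) 1 R * lift2 0 F * lift2 1 F = lift2 0 F * lift2 1 F * lift2 0 R

/-- The antisymmetrizers `A^{(i)} ∈ End(V^{⊗i})` of a BMW-type R-matrix. -/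
def asym (q μ : ℂ) (R : MatV N 2 ℂ) : (i : ℕ) → MatV N i ℂ
  | 0 => 1
  | 1 => 1
  | i + 2 =>
      (q ^ (i + 1) / nq q (i + 2)) •
        (ext1 (asym q μ R (i + 1)) *
          ((1 : MatV N (i + 2) ℂ) +
              ((q ^ (-(2 * ((i : ℤ) + 1))) - 1) / (q - q⁻¹)) • lift2 i R +
              (μ * (q ^ (-(2 * ((i : ℤ) + 1))) - 1) / (μ + q ^ (1 - 2 * ((i : ℤ) + 1)))) •
                lift2 i (bmwK q μ R)) *
          ext1 (asym q μ R (i + 1)))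

/-- The height-`k` cutting condition
    `A^{(k)} σ⁻_k(q^{-2k}) A^{(k)} = 0` in `End(V^{⊗(k+1)})`. -/
def HeightCut (q μ : ℂ) (R : MatV N 2 ℂ) (k : ℕ) : Prop :=
  ext1 (asym q μ R k) *
      ((1 : MatV N (k + 1) ℂ) +
          ((q ^ (-(2 * (k : ℤ))) - 1) / (q - q⁻¹)) • lift2 (k - 1) R +
          (μ * (q ^ (-(2 * (k : ℤ))) - 1) / (μ + q ^ (1 - 2 * (k : ℤ)))) •
            lift2 (k - 1) (bmwK q μ R)) *
      ext1 (asym q μ R k) = 0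

/-- `R` is an R-matrix of height `k`. -/
def HasHeight (q μ : ℂ) (R : MatV N 2 ℂ) (k : ℕ) : Prop :=
  2 ≤ k ∧ (∀ i, 2 ≤ i → i ≤ k → asym q μ R i ≠ 0) ∧ HeightCut q μ R k

section AlgebraSide

variable [Ring A] [Algebra ℂ A]

/-- The copies `M_{(i+1)}` of the quantum matrix inside `V^{⊗n}`:
    `M_{(1)} = M₁`, `M_{(i+1)} = F_i M_{(i)} F_i⁻¹`. -/
def Mcopy {n : ℕ} (F : MatV N 2 ℂ) (M : Matrix (Fin N) (Fin N) A) : ℕ → MatV N n A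
  | 0 => lift1 0 M
  | j + 1 => cmap (lift2 j F) * Mcopy F M j * cmap (lift2 j F⁻¹)

/-- The product `M_{(1)} M_{(2)} ⋯ M_{(j)}`. -/
def Mprod {n : ℕ} (F : MatV N 2 ℂ) (M : Matrix (Fin N) (Fin N) A) : ℕ → MatV N n A
  | 0 => 1
  | j + 1 => Mprod F M j * Mcopy F M j

/-- The product `M_{(2)} M_{(3)} ⋯ M_{(j+1)}`. -/
def MprodFrom2 {n : ℕ} (F : MatV N 2 ℂ) (M : Matrix (Fin N) (Fin N) A) : ℕ → MatV N n A
  | 0 => 1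
  | j + 1 => MprodFrom2 F M j * Mcopy F M (j + 1)

/-- The defining relation `R₁ M_{(1)} M_{(2)} = M_{(1)} M_{(2)} R₁` of the
    quantum matrix algebra `M(R,F)`. -/
def QMArel (R F : MatV N 2 ℂ) (M : Matrix (Fin N) (Fin N) A) : Prop :=
  cmap (lift2 (n := 2) 0 R) * Mcopy F M 0 * Mcopy F M 1 =
    Mcopy F M 0 * Mcopy F M 1 * cmap (lift2 (n := 2) 0 R)

/-- The 2-contraction `g` of the quantum matrix `M`. -/
def gElt (q μ : ℂ) (R F ΨR : MatV N 2 ℂ) (M : Matrix (Fin N) (Fin N) A) : A :=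
  (μ * (q - q⁻¹) / ((q - μ) * (q⁻¹ + μ))) •
    trAll (cmap (Dof ΨR)) 2 (Mprod F M 2 * cmap (lift2 0 (bmwK q μ R)))

/-- The elementary symmetric functions `a_i` of the quantum matrix `M`. -/
def aElt (q μ : ℂ) (R F ΨR : MatV N 2 ℂ) (M : Matrix (Fin N) (Fin N) A) : ℕ → A
  | 0 => 1
  | i + 1 => trAll (cmap (Dof ΨR)) (i + 1) (Mprod F M (i + 1) * cmap (asym q μ R (i + 1)))

/-- The map `φ(X)₁ = Tr_{R(2)}(F₁ X₁ F₁⁻¹ R₁)`. -/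
def phi (R F ΨR : MatV N 2 ℂ) (X : Matrix (Fin N) (Fin N) A) : Matrix (Fin N) (Fin N) A :=
  toN (ptrace (cmap (Dof ΨR))
    (cmap (lift2 (n := 2) 0 F) * lift1 0 X * cmap (lift2 (n := 2) 0 F⁻¹) *
      cmap (lift2 (n := 2) 0 R)))

/-- The map `ξ(X)₁ = Tr_{R(2)}(F₁ X₁ F₁⁻¹ K₁)`. -/
def xi (q μ : ℂ) (R F ΨR : MatV N 2 ℂ) (X : Matrix (Fin N) (Fin N) A) :
    Matrix (Fin N) (Fin N) A :=
  toN (ptrace (cmap (Dof ΨR))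
    (cmap (lift2 (n := 2) 0 F) * lift1 0 X * cmap (lift2 (n := 2) 0 F⁻¹) *
      cmap (lift2 (n := 2) 0 (bmwK q μ R))))

/-- The map `φ⁻¹(X)₁ = μ⁻² Tr_{R_f(2)}(F₁⁻¹ X₁ R₁⁻¹ F₁)`,
    where the `R_f`-trace has weight `D_{F⁻¹} (D_{R⁻¹})⁻¹ D_F`. -/
def phiInv (μ : ℂ) (R F ΨF ΨFinv ΨRinv : MatV N 2 ℂ) (X : Matrix (Fin N) (Fin N) A) :
    Matrix (Fin N) (Fin N) A :=
  (μ⁻¹) ^ 2 •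
    toN (ptrace (cmap (Dof ΨFinv * (Dof ΨRinv)⁻¹ * Dof ΨF))
      (cmap (lift2 (n := 2) 0 F⁻¹) * lift1 0 X * cmap (lift2 (n := 2) 0 R⁻¹) *
        cmap (lift2 (n := 2) 0 F)))

/-- Star-multiplication by `M`: `L(X) = M ⋆ X = M · φ(X)`. -/
def Lmap (R F ΨR : MatV N 2 ℂ) (M X : Matrix (Fin N) (Fin N) A) : Matrix (Fin N) (Fin N) A :=
  M * phi R F ΨR X

/-- The star-powers `M^{[n]}` of the quantum matrix. -/
def starPow (R F ΨR : MatV N 2 ℂ) (M : Matrix (Fin N) (Fin N) A) : ℕ → Matrix (Fin N) (Fin N) A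
  | 0 => 1
  | n + 1 => M * phi R F ΨR (starPow R F ΨR M n)

/-- The wedge powers `M^{a^{(i)}} = Tr_{R(2,…,i)}(M_{(1)} ⋯ M_{(i)} A^{(i)})`. -/
def Mwedge (q μ : ℂ) (R F ΨR : MatV N 2 ℂ) (M : Matrix (Fin N) (Fin N) A) :
    ℕ → Matrix (Fin N) (Fin N) A
  | 0 => 1
  | i + 1 => toN (trTail (cmap (Dof ΨR)) i (Mprod F M (i + 1) * cmap (asym q μ R (i + 1))))

/-- The descendants `A^{(m,i)} = i_q · M^{[m]} ⋆ M^{a^{(i)}}` (here `m ≥ 0`). -/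
def Ad (q μ : ℂ) (R F ΨR : MatV N 2 ℂ) (M : Matrix (Fin N) (Fin N) A) (m i : ℕ) :
    Matrix (Fin N) (Fin N) A :=
  nq q i • (Lmap R F ΨR M)^[m] (Mwedge q μ R F ΨR M i)

/-- The descendants `B^{(m,i)}`, including the boundary value
    `B^{(0,i)} = i_q φ⁻¹(ξ(M^{a^{(i)}}))`. -/
def Bd (q μ : ℂ) (R F ΨR ΨF ΨFinv ΨRinv : MatV N 2 ℂ) (M : Matrix (Fin N) (Fin N) A) :
    ℕ → ℕ → Matrix (Fin N) (Fin N) A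
  | 0, i => nq q i • phiInv μ R F ΨF ΨFinv ΨRinv (xi q μ R F ΨR (Mwedge q μ R F ΨR M i))
  | m + 1, i => nq q i • (Lmap R F ΨR M)^[m] (M * xi q μ R F ΨR (Mwedge q μ R F ΨR M i))

/-- The boundary descendant
    `A^{(-1,i)} = i_q φ⁻¹(Tr_{R(2,…,i)}(M_{(2)} ⋯ M_{(i)} A^{(i)}))`. -/
def Aneg1 (q μ : ℂ) (R F ΨR ΨF ΨFinv ΨRinv : MatV N 2 ℂ) (M : Matrix (Fin N) (Fin N) A) :
    ℕ → Matrix (Fin N) (Fin N) A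
  | 0 => 0
  | i + 1 =>
      nq q (i + 1) •
        phiInv μ R F ΨF ΨFinv ΨRinv
          (toN (trTail (cmap (Dof ΨR)) i (MprodFrom2 F M i * cmap (asym q μ R (i + 1)))))

/-- The shifted family `AdS m i = A^{(m-1,i)}` (so that `AdS 0 i = A^{(-1,i)}`). -/
def AdS (q μ : ℂ) (R F ΨR ΨF ΨFinv ΨRinv : MatV N 2 ℂ) (M : Matrix (Fin N) (Fin N) A) :
    ℕ → ℕ → Matrix (Fin N) (Fin N) A
  | 0, i => Aneg1 q μ R F ΨR ΨF ΨFinv ΨRinv M i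
  | m + 1, i => Ad q μ R F ΨR M m i

/-- The coefficients `ε_i` of the symplectic Cayley-Hamilton identity. -/
def eps (q μ : ℂ) (R F ΨR : MatV N 2 ℂ) (M : Matrix (Fin N) (Fin N) A) (k i : ℕ) : A :=
  if i ≤ k then
    ∑ j ∈ Finset.range (i / 2 + 1), aElt q μ R F ΨR M (i - 2 * j) * gElt q μ R F ΨR M ^ j
  else
    (∑ j ∈ Finset.range ((2 * k - i) / 2 + 1),
        aElt q μ R F ΨR M (2 * k - i - 2 * j) * gElt q μ R F ΨR M ^ j) *
      gElt q μ R F ΨR M ^ (i - k)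

/-- The map `π(X)₁ = Tr_{R(2)}(R₁ X₁ K₁)`. -/
def piMap (q μ : ℂ) (R ΨR : MatV N 2 ℂ) (X : Matrix (Fin N) (Fin N) A) :
    Matrix (Fin N) (Fin N) A :=
  toN (ptrace (cmap (Dof ΨR))
    (cmap (lift2 (n := 2) 0 R) * lift1 0 X * cmap (lift2 (n := 2) 0 (bmwK q μ R))))

end AlgebraSide

/-- The matrix `G₁ = Tr_(2,3)(K₂ F₁⁻¹ F₂⁻¹)`. -/
def Gmat (q μ : ℂ) (R F : MatV N 2 ℂ) : Matrix (Fin N) (Fin N) ℂ :=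
  toN (trTail (1 : Matrix (Fin N) (Fin N) ℂ) 2
    (lift2 (n := 3) 1 (bmwK q μ R) * lift2 0 F⁻¹ * lift2 1 F⁻¹))

end QMA

end

noncomputable section

open scoped TensorProduct

namespace QMA

/-- The elementary symmetric function `e_i` of a list of arguments, defined as the
coefficient of `t^i` in `∏_j (1 + a_j t)`. -/
def esymmList {R : Type*} [CommRing R] (l : List R) (i : ℕ) : R :=
  ((l.map fun a => Polynomial.C a * Polynomial.X + 1).prod).coeff i

/-- The spectral variables `ν_1, …, ν_{2k}` as elements of the polynomial ring
`ℂ[ν_0, ν_1, …, ν_{2k}]`. -/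
def nuVars (k : ℕ) : List (MvPolynomial (Fin (2 * k + 1)) ℂ) :=
  (List.finRange (2 * k)).map fun j => MvPolynomial.X j.succ

/-- The ideal of the symplectic spectral relations `ν_{k+i} ν_{k+1-i} = ν_0²`, `i = 1, …, k`. -/
def Erel (k : ℕ) : Ideal (MvPolynomial (Fin (2 * k + 1)) ℂ) :=
  Ideal.span {p | ∃ i : Fin k,
    p = MvPolynomial.X (⟨k + (i : ℕ) + 1, by have := i.isLt; omega⟩ : Fin (2 * k + 1)) *
          MvPolynomial.X (⟨k - (i : ℕ), by omega⟩ : Fin (2 * k + 1)) -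
        MvPolynomial.X (⟨0, by omega⟩ : Fin (2 * k + 1)) ^ 2}

/-- The algebra `E_{2k} = ℂ[ν_0, ν_1, …, ν_{2k}] / (ν_{k+i} ν_{k+1-i} - ν_0²)` of
spectral variables. -/
abbrev Espec (k : ℕ) := MvPolynomial (Fin (2 * k + 1)) ℂ ⧸ Erel k

/-- The right `C`-module structure on `A` induced by a ring homomorphism `ι : C → A`
from a commutative ring (`c • a := a * ι c`). -/
def rModule {C A : Type*} [CommRing C] [Ring A] (ι : C →+* A) : Module C A where
  smul c a := a * ι c
  one_smul a := show a * ι 1 = a by rw [_root_.map_one, mul_one]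
  mul_smul c d a := show a * ι (c * d) = (a * ι d) * ι c by
    rw [mul_comm c d, _root_.map_mul, ← mul_assoc]
  smul_zero c := zero_mul _
  smul_add c a b := add_mul a b _
  add_smul c d a := show a * ι (c + d) = a * ι c + a * ι d by rw [_root_.map_add, mul_add]
  zero_smul a := show a * ι 0 = 0 by rw [_root_.map_zero, mul_zero]

section SymplecticCayleyHamilton

set_option linter.unusedSectionVars false

section Place

variable {N : ℕ} [NeZero N]

/-- Place an operator on `V^{⊗ m}` on the tensor factors `p, …, p+m-1` of `V^{⊗ n}`. -/
def place {A : Type*} [Semiring A] {m n : ℕ} (p : ℕ) (X : MatV N m A) : MatV N n A :=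
  fun a b =>
    if ∀ j : Fin n, (j : ℕ) < p ∨ p + m ≤ j → a j = b j then
      X (fun i => idx a (p + i)) (fun i => idx b (p + i))
    else 0

theorem idx_of_lt {n : ℕ} (a : Fin n → Fin N) {j : ℕ} (h : j < n) : idx a j = a ⟨j, h⟩ := by
  simp [idx, h]

/-- Replace the entries of `a` in the slots `p, …, p+m-1` by those of `c`. -/
def splice {m n : ℕ} (p : ℕ) (a : Fin n → Fin N) (c : Fin m → Fin N) : Fin n → Fin N :=
  fun j => if p ≤ j ∧ (j : ℕ) < p + m then idx c (j - p) else a j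

theorem idx_splice {m n p : ℕ} (h : p + m ≤ n) (a : Fin n → Fin N) (c : Fin m → Fin N) :
    (fun i : Fin m => idx (splice p a c) (p + i)) = c := by
  funext i
  have hi := i.isLt
  rw [idx_of_lt _ (by omega : p + (i : ℕ) < n)]
  simp [splice, idx]

theorem splice_of_outside {m n p : ℕ} (a : Fin n → Fin N) (c : Fin m → Fin N) {j : Fin n}
    (hj : (j : ℕ) < p ∨ p + m ≤ j) : splice p a c j = a j := by
  unfold splice; rw [if_neg]; omega

theorem splice_idx {m n p : ℕ} (a b : Fin n → Fin N)
    (hab : ∀ j : Fin n, (j : ℕ) < p ∨ p + m ≤ j → a j = b j) :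
    splice p a (fun i : Fin m => idx b (p + i)) = b := by
  funext j
  unfold splice
  split_ifs with hj
  · have h1 : (j : ℕ) - p < m := by omega
    rw [idx_of_lt _ h1]
    have h2 : p + ((j : ℕ) - p) = j := by omega
    simp only [h2]
    rw [idx_of_lt _ j.isLt]
  · exact hab j (by omega)

variable {A : Type*} [Ring A]

theorem place_mul {m n p : ℕ} (h : p + m ≤ n) (X Y : MatV N m A) :
    (place p (X * Y) : MatV N n A) = place p X * place p Y := by
  ext a b
  rw [Matrix.mul_apply]
  by_cases hab : ∀ j : Fin n, (j : ℕ) < p ∨ p + m ≤ j → a j = b j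
  · rw [place, if_pos hab, Matrix.mul_apply]
    refine Finset.sum_of_injOn (fun c => splice p a c) ?_ ?_ ?_ ?_
    · intro c _ d _ hcd
      have := congrArg (fun x => fun i : Fin m => idx x (p + i)) hcd
      simpa only [idx_splice h] using this
    · intro c _; simp
    · intro c _ hc
      rw [place, if_neg, zero_mul]
      intro hac
      exact hc ⟨_, by simp, splice_idx a c hac⟩
    · intro c _
      rw [place, place, if_pos, if_pos, idx_splice h]
      · intro j hj; rw [splice_of_outside _ _ hj, hab j hj]
      · intro j hj; rw [splice_of_outside _ _ hj]
  · rw [place, if_neg hab]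
    symm
    refine Finset.sum_eq_zero fun c _ => ?_
    by_cases hac : ∀ j : Fin n, (j : ℕ) < p ∨ p + m ≤ j → a j = c j
    · rw [place, place, if_neg (c := ∀ j : Fin n, (j : ℕ) < p ∨ p + m ≤ j → c j = b j), mul_zero]
      exact fun hcb => hab fun j hj => (hac j hj).trans (hcb j hj)
    · rw [place, if_neg hac, zero_mul]

theorem place_one {m n p : ℕ} (_h : p + m ≤ n) : (place p (1 : MatV N m A) : MatV N n A) = 1 := by
  ext a b
  unfold place
  by_cases hab : a = b
  · subst hab; simp
  · rw [Matrix.one_apply_ne hab]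
    split_ifs with h1
    · rw [Matrix.one_apply_ne]
      intro h2
      apply hab
      rw [← splice_idx (m := m) (p := p) a b h1, ← h2]
      exact (splice_idx a a fun _ _ => rfl).symm
    · rfl

theorem place_add {m n p : ℕ} (X Y : MatV N m A) :
    (place p (X + Y) : MatV N n A) = place p X + place p Y := by
  ext a b; simp only [place, Matrix.add_apply]; split_ifs <;> simp

theorem place_sub {m n p : ℕ} (X Y : MatV N m A) :
    (place p (X - Y) : MatV N n A) = place p X - place p Y := by
  ext a b; simp only [place, Matrix.sub_apply]; split_ifs <;> simp

theorem place_smul [Algebra ℂ A] {m n p : ℕ} (c : ℂ) (X : MatV N m A) :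
    (place p (c • X) : MatV N n A) = c • place p X := by
  ext a b; simp only [place, Matrix.smul_apply]; split_ifs <;> simp

theorem place_place {l m n p p' : ℕ} (h : p + m ≤ n) (h' : p' + l ≤ m) (X : MatV N l A) :
    (place p (place p' X : MatV N m A) : MatV N n A) = place (p + p') X := by
  ext a b
  have key : ∀ x : Fin n → Fin N, (fun i : Fin l => idx (fun t : Fin m => idx x (p + t)) (p' + i))
      = fun i : Fin l => idx x (p + p' + i) := by
    intro x; funext i
    have hi := i.isLt
    rw [idx_of_lt _ (by omega : p' + (i : ℕ) < m)]
    simp [add_assoc]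
  simp only [place, key]
  by_cases h1 : ∀ j : Fin n, (j : ℕ) < p + p' ∨ p + p' + l ≤ j → a j = b j
  · rw [if_pos h1, if_pos, if_pos]
    · intro j hj
      have hj' := j.isLt
      rw [idx_of_lt _ (by omega : p + (j : ℕ) < n), idx_of_lt _ (by omega : p + (j : ℕ) < n)]
      apply h1; simp only; omega
    · intro j hj; apply h1; omega
  · rw [if_neg h1]
    split_ifs with h2 h3
    · exfalso
      apply h1
      intro j hj
      by_cases hjp : (j : ℕ) < p ∨ p + m ≤ j
      · exact h2 j hjp
      · have := h3 ⟨j - p, by omega⟩ (by simp only; omega)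
        have e : p + ((j : ℕ) - p) = j := by omega
        simp only [e] at this
        rwa [idx_of_lt _ j.isLt, idx_of_lt _ j.isLt] at this
    · rfl
    · rfl

theorem place_cmap [Algebra ℂ A] {m n p : ℕ} (X : MatV N m ℂ) :
    (place p (cmap X) : MatV N n A) = cmap (place p X) := by
  ext a b; simp only [place, cmap, Matrix.map_apply]; split_ifs <;> simp

theorem place_mul_place_apply {l m n p p' : ℕ} (h : p + m ≤ n) (h' : p' + l ≤ n)
    (hd : p + m ≤ p' ∨ p' + l ≤ p) (X : MatV N m A) (Y : MatV N l A) (a b : Fin n → Fin N) :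
    ((place p X : MatV N n A) * (place p' Y : MatV N n A)) a b =
      if ∀ j : Fin n, (j < p ∨ p + m ≤ j) ∧ ((j : ℕ) < p' ∨ p' + l ≤ j) → a j = b j then
        X (fun i => idx a (p + i)) (fun i => idx b (p + i)) *
          Y (fun i => idx a (p' + i)) (fun i => idx b (p' + i))
      else 0 := by
  rw [Matrix.mul_apply, Finset.sum_eq_single (splice p a (fun i : Fin m => idx b (p + i)))]
  · have e1 : (fun i : Fin l => idx (splice p a (fun i : Fin m => idx b (p + i))) (p' + i))
        = fun i : Fin l => idx a (p' + i) := by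
      funext i
      have hi := i.isLt
      rw [idx_of_lt _ (by omega), idx_of_lt _ (by omega), splice_of_outside]
      simp only; omega
    simp only [place, idx_splice h, e1]
    rw [if_pos (fun j hj => (splice_of_outside _ _ hj).symm)]
    by_cases h1 : ∀ j : Fin n, (j < p ∨ p + m ≤ j) ∧ ((j : ℕ) < p' ∨ p' + l ≤ j) → a j = b j
    · rw [if_pos h1, if_pos]
      intro j hj
      unfold splice
      split_ifs with h2
      · rw [idx_of_lt _ (by omega : (j : ℕ) - p < m)]
        have e : p + ((j : ℕ) - p) = j := by omega
        simp only [e]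
        rw [idx_of_lt _ j.isLt]
      · exact h1 j ⟨by omega, hj⟩
    · rw [if_neg h1, if_neg, mul_zero]
      intro h2
      apply h1
      intro j hj
      rw [← h2 j hj.2, splice_of_outside _ _ hj.1]
  · intro c _ hc
    by_cases hac : ∀ j : Fin n, (j : ℕ) < p ∨ p + m ≤ j → a j = c j
    · rw [place, place, if_neg (c := ∀ j : Fin n, (j : ℕ) < p' ∨ p' + l ≤ j → c j = b j), mul_zero]
      intro hcb
      apply hc
      rw [← splice_idx (m := m) (p := p) a c hac]
      congr 1
      funext i
      have hi := i.isLt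
      rw [idx_of_lt _ (by omega), idx_of_lt _ (by omega)]
      apply hcb; simp only; omega
    · rw [place, if_neg hac, zero_mul]
  · simp

theorem place_commute {l m n p p' : ℕ} (h : p + m ≤ n) (h' : p' + l ≤ n)
    (hd : p + m ≤ p' ∨ p' + l ≤ p) (X : MatV N m A) (Y : MatV N l A)
    (hc : ∀ i j i' j', X i j * Y i' j' = Y i' j' * X i j) :
    (place p X : MatV N n A) * place p' Y = place p' Y * place p X := by
  ext a b
  rw [place_mul_place_apply h h' hd, place_mul_place_apply h' h hd.symm]
  simp only [hc, and_comm]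

theorem lift2_eq_place {n p : ℕ} (X : MatV N 2 A) : (lift2 p X : MatV N n A) = place p X := by
  ext a b
  have key : ∀ x : Fin n → Fin N,
      (fun i : Fin 2 => idx x (p + i)) = ![idx x p, idx x (p + 1)] := by
    intro x; funext i; fin_cases i <;> rfl
  simp only [lift2, place, key]
  congr 1
  apply propext
  refine forall_congr' fun j => ?_
  constructor
  · intro h hj
    rcases h with h | h | h
    · omega
    · omega
    · exact h
  · intro h
    by_cases h1 : (j : ℕ) < p ∨ p + 2 ≤ j
    · exact Or.inr (Or.inr (h h1))
    · omega

theorem ext1_eq_place {n : ℕ} (X : MatV N n A) : ext1 X = place 0 X := by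
  ext a b
  have key : ∀ x : Fin (n + 1) → Fin N,
      (fun i : Fin n => idx x (0 + i)) = fun i : Fin n => x i.castSucc := by
    intro x; funext i
    rw [idx_of_lt _ (by have := i.isLt; omega)]; simp; rfl
  simp only [ext1, place, key]
  congr 1
  apply propext
  constructor
  · intro h j hj
    have : j = Fin.last n := by ext; simp; omega
    rw [this, h]
  · intro h
    apply h; simp

/-- An `N × N` matrix as an operator on `V^{⊗ 1}`. -/
def ofN (X : Matrix (Fin N) (Fin N) A) : MatV N 1 A := fun a b => X (a 0) (b 0)

theorem lift1_zero_eq_place {n : ℕ} (X : Matrix (Fin N) (Fin N) A) :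
    (lift1 0 X : MatV N n A) = place 0 (ofN X) := by
  ext a b
  simp only [lift1, place, ofN]
  congr 1
  apply propext
  refine forall_congr' fun j => ?_
  constructor
  · rintro (h | h) hj
    · omega
    · exact h
  · intro h
    by_cases h1 : (j : ℕ) = 0
    · exact Or.inl h1
    · exact Or.inr (h (by omega))

theorem ext1_mul {n : ℕ} (X Y : MatV N n A) : ext1 (X * Y) = ext1 X * ext1 Y := by
  simp only [ext1_eq_place]; exact place_mul (by omega) _ _

theorem ext1_one {n : ℕ} : ext1 (1 : MatV N n A) = 1 := by
  simp only [ext1_eq_place]; exact place_one (by omega)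

theorem ext1_lift2 {n p : ℕ} (h : p + 1 < n) (X : MatV N 2 A) :
    ext1 (lift2 p X : MatV N n A) = lift2 p X := by
  rw [ext1_eq_place, lift2_eq_place, place_place (by omega) (by omega), zero_add, lift2_eq_place]

theorem ext1_lift1 {n : ℕ} (h : 0 < n) (X : Matrix (Fin N) (Fin N) A) :
    ext1 (lift1 0 X : MatV N n A) = lift1 0 X := by
  rw [ext1_eq_place, lift1_zero_eq_place, place_place (by omega) (by omega), zero_add,
    lift1_zero_eq_place]

section Algebra

variable [Algebra ℂ A]

theorem cmap_mul {m : Type*} [Fintype m] (X Y : Matrix m m ℂ) :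
    (cmap (X * Y) : Matrix m m A) = cmap X * cmap Y := Matrix.map_mul

theorem cmap_one {m : Type*} [DecidableEq m] : (cmap (1 : Matrix m m ℂ) : Matrix m m A) = 1 :=
  Matrix.map_one _ (map_zero _) (map_one _)

theorem cmap_add {m : Type*} (X Y : Matrix m m ℂ) :
    (cmap (X + Y) : Matrix m m A) = cmap X + cmap Y := by ext; simp [cmap]

theorem cmap_sub {m : Type*} (X Y : Matrix m m ℂ) :
    (cmap (X - Y) : Matrix m m A) = cmap X - cmap Y := by ext; simp [cmap]

theorem cmap_smul {m : Type*} (c : ℂ) (X : Matrix m m ℂ) :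
    (cmap (c • X) : Matrix m m A) = c • cmap X := by
  ext; simp [cmap, Algebra.smul_def]

theorem cmap_zero {m : Type*} : (cmap (0 : Matrix m m ℂ) : Matrix m m A) = 0 := by
  ext; simp [cmap]

theorem cmap_ext1 {n : ℕ} (X : MatV N n ℂ) :
    (cmap (ext1 X) : MatV N (n + 1) A) = ext1 (cmap X) := by
  simp only [ext1_eq_place, place_cmap]

theorem cmap_comm_entry {m : Type*} (X : Matrix m m ℂ) (i j : m) (a : A) :
    (cmap X : Matrix m m A) i j * a = a * (cmap X : Matrix m m A) i j :=
  Algebra.commutes _ _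

/-- The operator `X ∈ End(V ⊗ V)` on the tensor factors `p, p+1` of `V^{⊗ n}`, with entries
viewed in `A`. -/
def gen (A : Type*) [Ring A] [Algebra ℂ A] (n : ℕ) (X : MatV N 2 ℂ) (p : ℕ) : MatV N n A :=
  cmap (lift2 p X)

theorem gen_eq_place {n p : ℕ} (X : MatV N 2 ℂ) : gen A n X p = place p (cmap X) := by
  rw [gen, lift2_eq_place, place_cmap]

theorem gen_mul {n p : ℕ} (h : p + 1 < n) (X Y : MatV N 2 ℂ) :
    gen A n (X * Y) p = gen A n X p * gen A n Y p := by
  simp only [gen_eq_place, cmap_mul]; exact place_mul (by omega) _ _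

theorem gen_one {n p : ℕ} (h : p + 1 < n) : gen A n (1 : MatV N 2 ℂ) p = 1 := by
  simp only [gen_eq_place, cmap_one]; exact place_one (by omega)

theorem gen_add {n p : ℕ} (X Y : MatV N 2 ℂ) : gen A n (X + Y) p = gen A n X p + gen A n Y p := by
  simp only [gen_eq_place, cmap_add, place_add]

theorem gen_sub {n p : ℕ} (X Y : MatV N 2 ℂ) : gen A n (X - Y) p = gen A n X p - gen A n Y p := by
  simp only [gen_eq_place, cmap_sub, place_sub]

theorem gen_smul {n p : ℕ} (c : ℂ) (X : MatV N 2 ℂ) : gen A n (c • X) p = c • gen A n X p := by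
  simp only [gen_eq_place, cmap_smul, place_smul]

theorem gen_far {n p p' : ℕ} (h : p + 1 < n) (h' : p' + 1 < n) (hd : p + 1 < p' ∨ p' + 1 < p)
    (X Y : MatV N 2 ℂ) : gen A n X p * gen A n Y p' = gen A n Y p' * gen A n X p := by
  simp only [gen_eq_place]
  exact place_commute (by omega) (by omega) (by omega) _ _ fun _ _ _ _ => cmap_comm_entry _ _ _ _

theorem ext1_gen {n p : ℕ} (h : p + 1 < n) (X : MatV N 2 ℂ) :
    ext1 (gen A n X p) = gen A (n + 1) X p := by
  rw [gen, ← cmap_ext1, ext1_lift2 h, gen]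

theorem place_gen {n n' p p' : ℕ} (h : p + 1 < n) (h' : p' + n ≤ n') (X : MatV N 2 ℂ) :
    (place p' (gen A n X p) : MatV N n' A) = gen A n' X (p' + p) := by
  rw [gen_eq_place, gen_eq_place, place_place h' (by omega)]

/-- Transfer of a three-strand relation to the strands `p, p+1, p+2`. -/
theorem gen_transfer {n p : ℕ} (h : p + 2 < n) (X Y Z X' Y' Z' : MatV N 2 ℂ) (i j k i' j' k' : ℕ)
    (hi : i < 2) (hj : j < 2) (hk : k < 2) (hi' : i' < 2) (hj' : j' < 2) (hk' : k' < 2)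
    (H : lift2 (n := 3) i X * lift2 j Y * lift2 k Z = lift2 i' X' * lift2 j' Y' * lift2 k' Z') :
    gen A n X (p + i) * gen A n Y (p + j) * gen A n Z (p + k) =
      gen A n X' (p + i') * gen A n Y' (p + j') * gen A n Z' (p + k') := by
  have h3 : p + 3 ≤ n := by omega
  have := congrArg (fun W => (place p (cmap W : MatV N 3 A) : MatV N n A)) H
  simp only [cmap_mul, place_mul h3] at this
  simpa only [← gen.eq_1, place_gen (show i + 1 < 3 by omega) h3,
    place_gen (show j + 1 < 3 by omega) h3,
    place_gen (show k + 1 < 3 by omega) h3, place_gen (show i' + 1 < 3 by omega) h3,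
    place_gen (show j' + 1 < 3 by omega) h3, place_gen (show k' + 1 < 3 by omega) h3] using this

theorem gen_inv {n p : ℕ} (h : p + 1 < n) {X : MatV N 2 ℂ} (hX : IsUnit X.det) :
    gen A n X p * gen A n X⁻¹ p = 1 ∧ gen A n X⁻¹ p * gen A n X p = 1 := by
  rw [← gen_mul h, ← gen_mul h, Matrix.mul_nonsing_inv _ hX, Matrix.nonsing_inv_mul _ hX,
    gen_one h]
  exact ⟨rfl, rfl⟩

theorem Mcopy_succ {n j : ℕ} (F : MatV N 2 ℂ) (M : Matrix (Fin N) (Fin N) A) :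
    (Mcopy F M (j + 1) : MatV N n A) = gen A n F j * Mcopy F M j * gen A n F⁻¹ j := rfl

theorem ext1_Mcopy {n : ℕ} (F : MatV N 2 ℂ) (M : Matrix (Fin N) (Fin N) A) :
    ∀ {j : ℕ}, j < n → ext1 (Mcopy F M j : MatV N n A) = Mcopy F M j
  | 0, h => ext1_lift1 h M
  | j + 1, h => by
    rw [Mcopy_succ, Mcopy_succ, ext1_mul, ext1_mul, ext1_gen h, ext1_gen h,
      ext1_Mcopy F M (by omega)]

theorem ext1_Mprod {n : ℕ} (F : MatV N 2 ℂ) (M : Matrix (Fin N) (Fin N) A) :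
    ∀ {j : ℕ}, j ≤ n → ext1 (Mprod F M j : MatV N n A) = Mprod F M j
  | 0, _ => ext1_one
  | j + 1, h => by
    rw [Mprod, Mprod, ext1_mul, ext1_Mprod F M (by omega), ext1_Mcopy F M (by omega)]

theorem gen_Mcopy_low {n p : ℕ} (X F : MatV N 2 ℂ) (M : Matrix (Fin N) (Fin N) A) (h : p + 1 < n) :
    ∀ {j : ℕ}, j < p →
      gen A n X p * (Mcopy F M j : MatV N n A) = Mcopy F M j * gen A n X p
  | 0, hj => by
    rw [Mcopy, lift1_zero_eq_place, gen_eq_place]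
    exact place_commute (by omega) (by omega) (by omega) _ _ fun _ _ _ _ => cmap_comm_entry _ _ _ _
  | j + 1, hj => by
    have e1 := gen_far (A := A) h (show j + 1 < n by omega) (by omega) X F
    have e2 := gen_far (A := A) h (show j + 1 < n by omega) (by omega) X F⁻¹
    have e3 := gen_Mcopy_low X F M h (show j < p by omega)
    rw [Mcopy_succ, ← mul_assoc, ← mul_assoc, e1, mul_assoc (gen A n F j), e3]
    simp only [mul_assoc, e2]

end Algebra

end Place

section Traces

variable {N : ℕ} [NeZero N] {A : Type*} [Ring A]

theorem place_mul_apply {m n p : ℕ} (h : p + m ≤ n) (X : MatV N m A) (Y : MatV N n A)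
    (a b : Fin n → Fin N) :
    ((place p X : MatV N n A) * Y) a b =
      ∑ c : Fin m → Fin N, X (fun i => idx a (p + i)) c * Y (splice p a c) b := by
  rw [Matrix.mul_apply]
  symm
  refine Finset.sum_of_injOn (fun c => splice p a c) ?_ ?_ ?_ ?_
  · intro c _ d _ hcd
    have := congrArg (fun x => fun i : Fin m => idx x (p + i)) hcd
    simpa only [idx_splice h] using this
  · intro c _; simp
  · intro c _ hc
    rw [place, if_neg, zero_mul]
    intro hac
    exact hc ⟨_, by simp, splice_idx a c hac⟩
  · intro c _
    rw [place, if_pos, idx_splice h]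
    intro j hj; rw [splice_of_outside _ _ hj]

theorem mul_place_apply {m n p : ℕ} (h : p + m ≤ n) (X : MatV N m A) (Y : MatV N n A)
    (a b : Fin n → Fin N) :
    (Y * (place p X : MatV N n A)) a b =
      ∑ c : Fin m → Fin N, Y a (splice p b c) * X c (fun i => idx b (p + i)) := by
  rw [Matrix.mul_apply]
  symm
  refine Finset.sum_of_injOn (fun c => splice p b c) ?_ ?_ ?_ ?_
  · intro c _ d _ hcd
    have := congrArg (fun x => fun i : Fin m => idx x (p + i)) hcd
    simpa only [idx_splice h] using this
  · intro c _; simp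
  · intro c _ hc
    rw [place, if_neg, mul_zero]
    intro hac
    exact hc ⟨_, by simp, splice_idx b c fun j hj => (hac j hj).symm⟩
  · intro c _
    rw [place, if_pos, idx_splice h]
    intro j hj; rw [splice_of_outside _ _ hj]

theorem splice_zero_snoc {n : ℕ} (a a' : Fin n → Fin N) (c : Fin N) :
    splice 0 (Fin.snoc a c : Fin (n + 1) → Fin N) a' = Fin.snoc a' c := by
  funext j
  refine Fin.lastCases ?_ (fun j => ?_) j
  · rw [splice_of_outside _ _ (by simp)]; simp
  · simp [splice, idx]

theorem idx_zero_snoc {n : ℕ} (a : Fin n → Fin N) (c : Fin N) :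
    (fun i : Fin n => idx (Fin.snoc a c : Fin (n + 1) → Fin N) (0 + i)) = a := by
  funext i
  have hi := i.isLt
  rw [idx_of_lt _ (by omega)]
  have : (⟨0 + (i : ℕ), by omega⟩ : Fin (n + 1)) = i.castSucc := by ext; simp
  rw [this]; simp

theorem ext1_mul_apply {n : ℕ} (Y : MatV N n A) (X : MatV N (n + 1) A) (a : Fin n → Fin N)
    (c : Fin N) (b : Fin (n + 1) → Fin N) :
    (ext1 Y * X) (Fin.snoc a c) b = ∑ a', Y a a' * X (Fin.snoc a' c) b := by
  rw [ext1_eq_place, place_mul_apply (by omega)]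
  simp only [idx_zero_snoc, splice_zero_snoc]

theorem mul_ext1_apply {n : ℕ} (Y : MatV N n A) (X : MatV N (n + 1) A) (b : Fin n → Fin N)
    (c : Fin N) (a : Fin (n + 1) → Fin N) :
    (X * ext1 Y) a (Fin.snoc b c) = ∑ b', X a (Fin.snoc b' c) * Y b' b := by
  rw [ext1_eq_place, mul_place_apply (by omega)]
  simp only [idx_zero_snoc, splice_zero_snoc]

theorem splice_snoc_snoc {n : ℕ} (a : Fin n → Fin N) (x y : Fin N) (c : Fin 2 → Fin N) :
    splice n (Fin.snoc (Fin.snoc a x : Fin (n + 1) → Fin N) y : Fin (n + 2) → Fin N) c =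
      Fin.snoc (Fin.snoc a (c 0) : Fin (n + 1) → Fin N) (c 1) := by
  funext j
  refine Fin.lastCases ?_ (fun j => ?_) j
  · simp [splice, idx]
  · refine Fin.lastCases ?_ (fun j => ?_) j
    · simp [splice, idx]
    · rw [splice_of_outside _ _ (by simp)]; simp

theorem idx_snoc_snoc {n : ℕ} (a : Fin n → Fin N) (x y : Fin N) :
    (fun i : Fin 2 =>
      idx (Fin.snoc (Fin.snoc a x : Fin (n + 1) → Fin N) y : Fin (n + 2) → Fin N) (n + i)) =
      ![x, y] := by
  funext i
  have h1 : (⟨n + 1, by omega⟩ : Fin (n + 2)) = Fin.last _ := rfl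
  have h0 : (⟨n, by omega⟩ : Fin (n + 2)) = (Fin.last n).castSucc := rfl
  fin_cases i
  · simp only [Fin.mk_zero, Fin.isValue, add_zero]
    rw [idx_of_lt _ (by omega), h0]; simp
  · simp only [Fin.mk_one, Fin.isValue]
    rw [idx_of_lt _ (by omega), h1]; simp

theorem sum_fin_two (f : (Fin 2 → Fin N) → A) : ∑ c, f c = ∑ x, ∑ y, f ![x, y] := by
  rw [← Finset.sum_product', ← (finTwoArrowEquiv (Fin N)).symm.sum_comp]
  rfl

variable [Algebra ℂ A]

theorem gen_mul_apply {n : ℕ} (X : MatV N 2 ℂ) (Y : MatV N (n + 2) A) (a : Fin n → Fin N)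
    (x y : Fin N) (b : Fin (n + 2) → Fin N) :
    (gen A (n + 2) X n * Y) (Fin.snoc (Fin.snoc a x : Fin (n + 1) → Fin N) y) b =
      ∑ u, ∑ v, algebraMap ℂ A (X ![x, y] ![u, v]) *
        Y (Fin.snoc (Fin.snoc a u : Fin (n + 1) → Fin N) v) b := by
  rw [gen_eq_place, place_mul_apply (by omega)]
  simp only [idx_snoc_snoc, splice_snoc_snoc]
  rw [sum_fin_two]
  simp [cmap]

theorem mul_gen_apply {n : ℕ} (X : MatV N 2 ℂ) (Y : MatV N (n + 2) A) (b : Fin n → Fin N)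
    (x y : Fin N) (a : Fin (n + 2) → Fin N) :
    (Y * gen A (n + 2) X n) a (Fin.snoc (Fin.snoc b x : Fin (n + 1) → Fin N) y) =
      ∑ u, ∑ v, Y a (Fin.snoc (Fin.snoc b u : Fin (n + 1) → Fin N) v) *
        algebraMap ℂ A (X ![u, v] ![x, y]) := by
  rw [gen_eq_place, mul_place_apply (by omega)]
  simp only [idx_snoc_snoc, splice_snoc_snoc]
  rw [sum_fin_two]
  simp [cmap]

theorem ext1_apply_snoc {n : ℕ} (Z : MatV N n A) (a b : Fin n → Fin N) (x y : Fin N) :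
    ext1 Z (Fin.snoc a x) (Fin.snoc b y) = if x = y then Z a b else 0 := by
  simp [ext1]

/-- The `D`-weighted partial trace for a complex weight matrix. -/
abbrev ptr {n : ℕ} (D : Matrix (Fin N) (Fin N) ℂ) (X : MatV N (n + 1) A) : MatV N n A :=
  ptrace (cmap D) X

theorem ptr_add {n : ℕ} (D : Matrix (Fin N) (Fin N) ℂ) (X Y : MatV N (n + 1) A) :
    ptr D (X + Y) = ptr D X + ptr D Y := by
  ext a b; simp [ptr, ptrace, mul_add, Finset.sum_add_distrib]

theorem ptr_smul {n : ℕ} (D : Matrix (Fin N) (Fin N) ℂ) (c : ℂ) (X : MatV N (n + 1) A) :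
    ptr D (c • X) = c • ptr D X := by
  ext a b; simp [ptr, ptrace, Finset.smul_sum]

theorem ptr_ext1_mul {n : ℕ} (D : Matrix (Fin N) (Fin N) ℂ) (Y : MatV N n A)
    (X : MatV N (n + 1) A) : ptr D (ext1 Y * X) = Y * ptr D X := by
  ext a b
  simp only [ptr, ptrace, ext1_mul_apply]
  simp only [Matrix.mul_apply, ptrace, Finset.mul_sum]
  refine (Finset.sum_congr rfl fun m _ => Finset.sum_comm).trans (Finset.sum_comm.trans ?_)
  refine Finset.sum_congr rfl fun a' _ => Finset.sum_congr rfl fun m _ =>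
    Finset.sum_congr rfl fun c _ => ?_
  rw [← mul_assoc, cmap_comm_entry, mul_assoc]

theorem ptr_mul_ext1 {n : ℕ} (D : Matrix (Fin N) (Fin N) ℂ) (Y : MatV N n A)
    (X : MatV N (n + 1) A) : ptr D (X * ext1 Y) = ptr D X * Y := by
  ext a b
  simp only [ptr, ptrace, mul_ext1_apply]
  simp only [Matrix.mul_apply, ptrace, Finset.mul_sum, Finset.sum_mul]
  refine (Finset.sum_congr rfl fun m _ => Finset.sum_comm).trans (Finset.sum_comm.trans ?_)
  refine Finset.sum_congr rfl fun a' _ => Finset.sum_congr rfl fun m _ =>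
    Finset.sum_congr rfl fun c _ => ?_
  rw [mul_assoc]

/-- The contraction `∑ F_{ab}^{cd} F'_{ed}^{fg} D_g^b`. -/
def contr (D : Matrix (Fin N) (Fin N) ℂ) (F F' : MatV N 2 ℂ) (a c e f : Fin N) : ℂ :=
  ∑ b, ∑ d, ∑ g, F ![a, b] ![c, d] * F' ![e, d] ![f, g] * D g b

theorem sum_reorder {ι : Type*} [Fintype ι] (f : ι → ι → ι → ι → ι → A) :
    ∑ m, ∑ c, ∑ u, ∑ u', ∑ v, f m c u u' v = ∑ u', ∑ u, ∑ c, ∑ v, ∑ m, f m c u u' v := by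
  calc _ = ∑ m, ∑ c, ∑ u', ∑ u, ∑ v, f m c u u' v :=
        Finset.sum_congr rfl fun m _ => Finset.sum_congr rfl fun c _ => Finset.sum_comm
    _ = ∑ m, ∑ u', ∑ c, ∑ u, ∑ v, f m c u u' v := Finset.sum_congr rfl fun m _ => Finset.sum_comm
    _ = ∑ u', ∑ m, ∑ c, ∑ u, ∑ v, f m c u u' v := Finset.sum_comm
    _ = ∑ u', ∑ m, ∑ u, ∑ c, ∑ v, f m c u u' v :=
        Finset.sum_congr rfl fun m _ => Finset.sum_congr rfl fun c _ => Finset.sum_comm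
    _ = ∑ u', ∑ u, ∑ m, ∑ c, ∑ v, f m c u u' v :=
        Finset.sum_congr rfl fun m _ => Finset.sum_comm
    _ = ∑ u', ∑ u, ∑ c, ∑ m, ∑ v, f m c u u' v :=
        Finset.sum_congr rfl fun m _ => Finset.sum_congr rfl fun c _ => Finset.sum_comm
    _ = _ :=
        Finset.sum_congr rfl fun m _ => Finset.sum_congr rfl fun c _ =>
          Finset.sum_congr rfl fun u _ => Finset.sum_comm

theorem ptr_conj_apply {n : ℕ} (D : Matrix (Fin N) (Fin N) ℂ) (F F' : MatV N 2 ℂ)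
    (Z : MatV N (n + 1) A) (a0 b0 : Fin n → Fin N) (a f : Fin N) :
    ptr D (gen A (n + 2) F n * ext1 Z * gen A (n + 2) F' n) (Fin.snoc a0 a) (Fin.snoc b0 f) =
      ∑ c, ∑ e, algebraMap ℂ A (contr D F F' a c e f) * Z (Fin.snoc a0 c) (Fin.snoc b0 e) := by
  simp only [ptr, ptrace, mul_gen_apply, gen_mul_apply, ext1_apply_snoc]
  have lhs : ∀ m c : Fin N, (cmap D : Matrix _ _ A) m c * ∑ u, ∑ v, (∑ u', ∑ v',
      algebraMap ℂ A (F ![a, c] ![u', v']) *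
        (if v' = v then Z (Fin.snoc a0 u') (Fin.snoc b0 u) else 0)) *
        algebraMap ℂ A (F' ![u, v] ![f, m]) =
      ∑ u, ∑ u', ∑ v, algebraMap ℂ A (F ![a, c] ![u', v] * F' ![u, v] ![f, m] * D m c) *
        Z (Fin.snoc a0 u') (Fin.snoc b0 u) := by
    intro m c
    simp only [mul_ite, mul_zero, Finset.sum_ite_eq', Finset.mem_univ, if_true, Finset.mul_sum,
      Finset.sum_mul]
    refine Finset.sum_congr rfl fun u _ => ?_
    rw [Finset.sum_comm]
    refine Finset.sum_congr rfl fun u' _ => Finset.sum_congr rfl fun v _ => ?_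
    rw [← (Algebra.commutes (F' ![u, v] ![f, m]) _)]
    simp only [cmap, Matrix.map_apply, ← mul_assoc, ← map_mul]
    congr 2; ring
  simp only [lhs]
  simp only [contr, map_sum, Finset.sum_mul]
  rw [sum_reorder]

theorem ptr_last_gen {R Ψ : MatV N 2 ℂ} (h : SkewPair R Ψ) (n : ℕ) :
    ptr (Dof Ψ) (gen A (n + 2) R n) = 1 := by
  have key : ∀ x y : Fin N, ∑ m, ∑ c, Dof Ψ m c * R ![x, c] ![y, m] = if x = y then 1 else 0 := by
    intro x y
    have := Finset.sum_congr rfl fun (t : Fin N) (_ : t ∈ Finset.univ) => h.1 x t y t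
    have e : ∀ t : Fin N, (x = t ∧ t = y) ↔ (x = t ∧ x = y) := fun t =>
      ⟨fun h => ⟨h.1, h.1.trans h.2⟩, fun h => ⟨h.1, h.1.symm.trans h.2⟩⟩
    simp only [e, ite_and, Finset.sum_ite_eq, Finset.mem_univ, if_true] at this
    rw [← this]
    simp only [Dof, Finset.sum_mul]
    refine Finset.sum_comm.trans ((Finset.sum_congr rfl fun c _ => Finset.sum_comm).trans
      (Finset.sum_comm.trans ?_))
    refine Finset.sum_congr rfl fun t _ => Finset.sum_congr rfl fun c _ =>
      Finset.sum_congr rfl fun m _ => ?_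
    ring
  ext a b
  obtain ⟨a0, x, rfl⟩ : ∃ a0 x, a = Fin.snoc a0 x := ⟨_, _, (Fin.snoc_init_self a).symm⟩
  obtain ⟨b0, y, rfl⟩ : ∃ b0 y, b = Fin.snoc b0 y := ⟨_, _, (Fin.snoc_init_self b).symm⟩
  have e1 : ∀ c m : Fin N, gen A (n + 2) R n (Fin.snoc (Fin.snoc a0 x : Fin (n + 1) → Fin N) c)
      (Fin.snoc (Fin.snoc b0 y : Fin (n + 1) → Fin N) m) =
      if a0 = b0 then algebraMap ℂ A (R ![x, c] ![y, m]) else 0 := by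
    intro c m
    rw [gen_eq_place, place]
    simp only [idx_snoc_snoc, cmap, Matrix.map_apply]
    congr 1
    apply propext
    constructor
    · intro h
      funext j
      have := h j.castSucc.castSucc (by simp)
      simpa using this
    · rintro rfl j hj
      have h1 : (j : ℕ) < n := by have := j.isLt; omega
      have : j = (⟨j, h1⟩ : Fin n).castSucc.castSucc := by ext; simp
      rw [this]; simp only [Fin.snoc_castSucc]
  simp only [ptr, ptrace, e1]
  by_cases hab : a0 = b0
  · subst hab
    simp only [if_true, cmap, Matrix.map_apply, ← map_mul, ← map_sum, key]
    by_cases hxy : x = y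
    · subst hxy; simp
    · rw [Matrix.one_apply_ne]
      · simp [hxy]
      · intro h; exact hxy (by simpa using congrFun h (Fin.last n))
  · rw [Matrix.one_apply_ne]
    · simp [hab]
    · intro h
      apply hab
      funext j
      simpa using congrFun h j.castSucc

/-- `X` satisfies the second twist relation with `F`, in conjugated form. -/
theorem contr_eq {R Ψ F F' : MatV N 2 ℂ} (h : SkewPair R Ψ) (hF' : F' * F = 1)
    (hFF : F * F' = 1)
    (hc : lift2 (n := 3) 1 R * lift2 0 F * lift2 1 F = lift2 0 F * lift2 1 F * lift2 0 R)
    (a c e f : Fin N) : contr (Dof Ψ) F F' a c e f = if a = f then Dof Ψ e c else 0 := by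
  have hconj : gen ℂ 3 F 1 * ext1 (gen ℂ 2 R 0) * gen ℂ 3 F' 1 =
      ext1 (gen ℂ 2 F' 0) * gen ℂ 3 R 1 * ext1 (gen ℂ 2 F 0) := by
    rw [ext1_gen (by omega), ext1_gen (by omega), ext1_gen (by omega)]
    have H := gen_transfer (A := ℂ) (n := 3) (p := 0) (by omega) R F F F F R 1 0 1 0 1 0
      (by omega) (by omega) (by omega) (by omega) (by omega) (by omega) hc
    simp only [zero_add] at H
    have e0 : gen ℂ 3 F' 0 * gen ℂ 3 F 0 = 1 := by
      rw [← gen_mul (by omega), hF', gen_one (by omega)]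
    have e1 : gen ℂ 3 F 1 * gen ℂ 3 F' 1 = 1 := by
      rw [← gen_mul (by omega), hFF, gen_one (by omega)]
    calc _ = (gen ℂ 3 F' 0 * gen ℂ 3 F 0) * gen ℂ 3 F 1 * gen ℂ 3 R 0 * gen ℂ 3 F' 1 := by
          rw [e0, one_mul]
      _ = gen ℂ 3 F' 0 * (gen ℂ 3 F 0 * gen ℂ 3 F 1 * gen ℂ 3 R 0) * gen ℂ 3 F' 1 := by
          simp only [mul_assoc]
      _ = gen ℂ 3 F' 0 * gen ℂ 3 R 1 * gen ℂ 3 F 0 * (gen ℂ 3 F 1 * gen ℂ 3 F' 1) := by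
          rw [← H]; simp only [mul_assoc]
      _ = _ := by rw [e1, mul_one]
  have htr := congrArg (ptr (Dof Ψ)) hconj
  rw [ptr_mul_ext1, ptr_ext1_mul, ptr_last_gen h 1, mul_one, ← gen_mul (by omega), hF',
    gen_one (by omega)] at htr
  have hent : ∀ x1 y1 : Fin N, (∑ u, ∑ w, contr (Dof Ψ) F F' a u w f * R ![x1, u] ![y1, w]) =
      if x1 = y1 then (if a = f then 1 else 0) else 0 := by
    intro x1 y1
    have := congrFun (congrFun htr (Fin.snoc (Fin.snoc (fun i => i.elim0) x1) a))
      (Fin.snoc (Fin.snoc (fun i => i.elim0) y1) f)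
    rw [ptr_conj_apply] at this
    have e2 : ∀ x y x' y' : Fin N, (gen ℂ 2 R 0)
        (Fin.snoc (Fin.snoc (fun i : Fin 0 => i.elim0) x : Fin 1 → Fin N) y)
        (Fin.snoc (Fin.snoc (fun i : Fin 0 => i.elim0) x' : Fin 1 → Fin N) y') =
        R ![x, y] ![x', y'] := by
      intro x y x' y'
      have e3 := idx_snoc_snoc (fun i : Fin 0 => (i.elim0 : Fin N))
      simp only [gen_eq_place, place, e3]
      rw [if_pos]
      · rfl
      · intro j hj; have := j.isLt; omega
    simp only [e2, Algebra.algebraMap_self, RingHom.id_apply] at this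
    rw [this, Matrix.one_apply, ← ite_and]
    congr 1
    apply propext
    constructor
    · intro h
      exact ⟨by
        have := congrFun h (Fin.castSucc (Fin.last 0))
        rwa [Fin.snoc_castSucc, Fin.snoc_castSucc, Fin.snoc_last, Fin.snoc_last] at this,
        by have := congrFun h (Fin.last 1); rwa [Fin.snoc_last, Fin.snoc_last] at this⟩
    · rintro ⟨rfl, rfl⟩; rfl
  calc contr (Dof Ψ) F F' a c e f
      = ∑ u, ∑ w, contr (Dof Ψ) F F' a u w f * (if e = w ∧ u = c then 1 else 0) := by
        rw [Finset.sum_eq_single c, Finset.sum_eq_single e]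
        · simp
        · intro w _ hw; simp [Ne.symm hw]
        · simp
        · intro u _ hu; simp [hu]
        · simp
    _ = ∑ u, ∑ w, contr (Dof Ψ) F F' a u w f *
          ∑ y1, ∑ x1, Ψ ![e, y1] ![c, x1] * R ![x1, u] ![y1, w] := by
        simp only [h.2]
    _ = ∑ y1, ∑ x1, Ψ ![e, y1] ![c, x1] *
          ∑ u, ∑ w, contr (Dof Ψ) F F' a u w f * R ![x1, u] ![y1, w] := by
        simp only [Finset.mul_sum]
        refine (Finset.sum_congr rfl fun u _ => Finset.sum_comm).trans (Finset.sum_comm.trans ?_)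
        refine Finset.sum_congr rfl fun y1 _ => ?_
        refine (Finset.sum_congr rfl fun u _ => Finset.sum_comm).trans (Finset.sum_comm.trans ?_)
        refine Finset.sum_congr rfl fun x1 _ => Finset.sum_congr rfl fun u _ =>
          Finset.sum_congr rfl fun w _ => ?_
        ring
    _ = _ := by
        simp only [hent, Dof]
        split_ifs with haf <;> simp

theorem ptr_conj {R Ψ F F' : MatV N 2 ℂ} (h : SkewPair R Ψ) (hF' : F' * F = 1)
    (hFF : F * F' = 1)
    (hc : lift2 (n := 3) 1 R * lift2 0 F * lift2 1 F = lift2 0 F * lift2 1 F * lift2 0 R)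
    {n : ℕ} (Z : MatV N (n + 1) A) :
    ptr (Dof Ψ) (gen A (n + 2) F n * ext1 Z * gen A (n + 2) F' n) = ext1 (ptr (Dof Ψ) Z) := by
  ext a b
  obtain ⟨a0, x, rfl⟩ : ∃ a0 x, a = Fin.snoc a0 x := ⟨_, _, (Fin.snoc_init_self a).symm⟩
  obtain ⟨b0, y, rfl⟩ : ∃ b0 y, b = Fin.snoc b0 y := ⟨_, _, (Fin.snoc_init_self b).symm⟩
  rw [ptr_conj_apply, ext1_apply_snoc]
  simp only [contr_eq h hF' hFF hc]
  split_ifs with hxy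
  · rw [Finset.sum_comm]; rfl
  · simp

/-- The operator `D ⊗ D`. -/
def dd (D : Matrix (Fin N) (Fin N) ℂ) : MatV N 2 ℂ := fun a b => D (a 0) (b 0) * D (a 1) (b 1)

theorem dd_commute {R Ψ : MatV N 2 ℂ} (h : SkewPair R Ψ) (hb : IsBraid R) {S : MatV N 2 ℂ}
    (hRS : R * S = 1) (hSR : S * R = 1) : Commute (dd (Dof Ψ)) S := by
  have hS : lift2 (n := 3) 1 R * lift2 0 S * lift2 1 S = lift2 0 S * lift2 1 S * lift2 0 R := by
    have i0 : lift2 (n := 3) 0 R * lift2 0 S = 1 := by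
      simp only [lift2_eq_place]; rw [← place_mul (by omega), hRS, place_one (by omega)]
    have i0' : lift2 (n := 3) 0 S * lift2 0 R = 1 := by
      simp only [lift2_eq_place]; rw [← place_mul (by omega), hSR, place_one (by omega)]
    have i1 : lift2 (n := 3) 1 R * lift2 1 S = 1 := by
      simp only [lift2_eq_place]; rw [← place_mul (by omega), hRS, place_one (by omega)]
    have i1' : lift2 (n := 3) 1 S * lift2 1 R = 1 := by
      simp only [lift2_eq_place]; rw [← place_mul (by omega), hSR, place_one (by omega)]
    have hb' := hb
    unfold IsBraid at hb'
    calc _ = lift2 (n := 3) 0 S * lift2 1 S * (lift2 1 R * lift2 0 R * lift2 1 R) *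
          lift2 0 S * lift2 1 S := by
          simp only [mul_assoc]
          rw [← mul_assoc (lift2 1 S) (lift2 1 R), i1', one_mul,
            ← mul_assoc (lift2 0 S) (lift2 0 R),
            i0', one_mul]
      _ = _ := by
          rw [← hb']
          simp only [mul_assoc]
          rw [← mul_assoc (lift2 0 R) (lift2 0 S), i0, one_mul, i1, mul_one]
  have g1 := contr_eq h hSR hRS hb.symm
  have g2 := contr_eq h hRS hSR hS
  simp only [contr] at g1 g2
  have III : ∀ e x f k : Fin N, ∑ g, S ![e, x] ![f, g] * Dof Ψ g k =
      ∑ c, Dof Ψ e c * Ψ ![x, c] ![k, f] := by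
    intro e x f k
    calc _ = ∑ b, ∑ d, ∑ g, (if x = d ∧ b = k then (1 : ℂ) else 0) *
          (S ![e, d] ![f, g] * Dof Ψ g b) := by
          symm
          refine (Finset.sum_eq_single k ?_ (by simp)).trans
            ((Finset.sum_eq_single x ?_ (by simp)).trans ?_)
          · intro u _ hu; simp [hu]
          · intro w _ hw; simp [Ne.symm hw]
          · simp
      _ = ∑ b, ∑ d, ∑ g, (∑ c, ∑ a, Ψ ![x, c] ![k, a] * R ![a, b] ![c, d]) *
            (S ![e, d] ![f, g] * Dof Ψ g b) := by simp only [h.2]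
      _ = ∑ c, ∑ a, Ψ ![x, c] ![k, a] *
            ∑ b, ∑ d, ∑ g, R ![a, b] ![c, d] * S ![e, d] ![f, g] * Dof Ψ g b := by
          simp only [Finset.mul_sum, Finset.sum_mul]
          refine (Finset.sum_congr rfl fun b _ => Finset.sum_congr rfl fun d _ =>
            Finset.sum_comm).trans ((Finset.sum_congr rfl fun b _ => Finset.sum_comm).trans
              (Finset.sum_comm.trans ?_))
          refine Finset.sum_congr rfl fun c _ => ?_
          refine (Finset.sum_congr rfl fun b _ => Finset.sum_congr rfl fun d _ =>
            Finset.sum_comm).trans ((Finset.sum_congr rfl fun b _ => Finset.sum_comm).trans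
              (Finset.sum_comm.trans ?_))
          refine Finset.sum_congr rfl fun a _ => Finset.sum_congr rfl fun b _ =>
            Finset.sum_congr rfl fun d _ => Finset.sum_congr rfl fun g _ => ?_
          ring
      _ = _ := by
          simp only [g1]
          refine Finset.sum_congr rfl fun c _ => ?_
          simp [mul_comm]
  have IV : ∀ x a c k : Fin N, ∑ b, Dof Ψ x b * S ![a, b] ![c, k] =
      ∑ e, Ψ ![x, a] ![k, e] * Dof Ψ e c := by
    intro x a c k
    calc _ = ∑ b, ∑ d, ∑ g, (if x = g ∧ d = k then 1 else 0) * (S ![a, b] ![c, d] * Dof Ψ g b) := by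
          refine Finset.sum_congr rfl fun b _ => ?_
          rw [Finset.sum_eq_single k, Finset.sum_eq_single x]
          · simp [mul_comm]
          · intro w _ hw; simp [Ne.symm hw]
          · simp
          · intro u _ hu; simp [hu]
          · simp
      _ = ∑ b, ∑ d, ∑ g, (∑ f, ∑ e, Ψ ![x, f] ![k, e] * R ![e, d] ![f, g]) *
            (S ![a, b] ![c, d] * Dof Ψ g b) := by simp only [h.2]
      _ = ∑ f, ∑ e, Ψ ![x, f] ![k, e] *
            ∑ b, ∑ d, ∑ g, S ![a, b] ![c, d] * R ![e, d] ![f, g] * Dof Ψ g b := by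
          simp only [Finset.mul_sum, Finset.sum_mul]
          refine (Finset.sum_congr rfl fun b _ => Finset.sum_congr rfl fun d _ =>
            Finset.sum_comm).trans ((Finset.sum_congr rfl fun b _ => Finset.sum_comm).trans
              (Finset.sum_comm.trans ?_))
          refine Finset.sum_congr rfl fun f _ => ?_
          refine (Finset.sum_congr rfl fun b _ => Finset.sum_congr rfl fun d _ =>
            Finset.sum_comm).trans ((Finset.sum_congr rfl fun b _ => Finset.sum_comm).trans
              (Finset.sum_comm.trans ?_))
          refine Finset.sum_congr rfl fun a _ => Finset.sum_congr rfl fun b _ =>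
            Finset.sum_congr rfl fun d _ => Finset.sum_congr rfl fun g _ => ?_
          ring
      _ = _ := by
          simp only [g2]
          rw [Finset.sum_eq_single a]
          · simp
          · intro w _ hw; simp [Ne.symm hw]
          · simp
  change dd (Dof Ψ) * S = S * dd (Dof Ψ)
  ext u v
  obtain ⟨x, y, rfl⟩ : ∃ x y, u = ![x, y] := ⟨u 0, u 1, by ext i; fin_cases i <;> rfl⟩
  obtain ⟨z, w, rfl⟩ : ∃ x y, v = ![x, y] := ⟨v 0, v 1, by ext i; fin_cases i <;> rfl⟩
  rw [Matrix.mul_apply, Matrix.mul_apply, sum_fin_two, sum_fin_two]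
  simp only [dd, Matrix.cons_val_zero, Matrix.cons_val_one]
  calc ∑ a, ∑ b, Dof Ψ x a * Dof Ψ y b * S ![a, b] ![z, w]
      = ∑ a, Dof Ψ x a * ∑ b, Dof Ψ y b * S ![a, b] ![z, w] := by
        simp only [Finset.mul_sum, mul_assoc]
    _ = ∑ e, (∑ a, Dof Ψ x a * Ψ ![y, a] ![w, e]) * Dof Ψ e z := by
        simp only [IV, Finset.mul_sum, Finset.sum_mul, mul_assoc]
        rw [Finset.sum_comm]
    _ = _ := by
        simp only [← III, Finset.sum_mul]
        refine Finset.sum_congr rfl fun e _ => Finset.sum_congr rfl fun g _ => ?_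
        ring

theorem ptr_ptr_apply {n : ℕ} (D : Matrix (Fin N) (Fin N) ℂ) (X : MatV N (n + 2) A)
    (a b : Fin n → Fin N) :
    ptr D (ptr D X) a b = ∑ u : Fin 2 → Fin N, ∑ v : Fin 2 → Fin N, algebraMap ℂ A (dd D u v) *
      X (splice n (Fin.snoc (Fin.snoc a 0 : Fin (n + 1) → Fin N) 0) v)
        (splice n (Fin.snoc (Fin.snoc b 0 : Fin (n + 1) → Fin N) 0) u) := by
  simp only [sum_fin_two, splice_snoc_snoc, ptr, ptrace, dd, cmap, Matrix.map_apply,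
    Finset.mul_sum, Matrix.cons_val_zero, Matrix.cons_val_one, map_mul, mul_assoc]
  refine Finset.sum_congr rfl fun m _ => ?_
  rw [Finset.sum_comm]

theorem splice_splice {m n p : ℕ} (a : Fin n → Fin N) (c c' : Fin m → Fin N) :
    splice p (splice p a c) c' = splice p a c' := by
  funext j; unfold splice; split_ifs <;> rfl

theorem ptr_ptr_cyclic {n : ℕ} {D : Matrix (Fin N) (Fin N) ℂ} {T : MatV N 2 ℂ}
    (hT : Commute (dd D) T) (X : MatV N (n + 2) A) :
    ptr D (ptr D (gen A (n + 2) T n * X)) = ptr D (ptr D (X * gen A (n + 2) T n)) := by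
  ext a b
  rw [ptr_ptr_apply, ptr_ptr_apply]
  simp only [gen_eq_place, place_mul_apply (show n + 2 ≤ n + 2 by omega),
    mul_place_apply (show n + 2 ≤ n + 2 by omega), idx_splice (show n + 2 ≤ n + 2 by omega),
    splice_splice]
  set al := (Fin.snoc (Fin.snoc a 0 : Fin (n + 1) → Fin N) 0 : Fin (n + 2) → Fin N)
  set be := (Fin.snoc (Fin.snoc b 0 : Fin (n + 1) → Fin N) 0 : Fin (n + 2) → Fin N)
  simp only [cmap, Matrix.map_apply, Finset.mul_sum, ← mul_assoc, ← map_mul]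
  calc _ = ∑ u, ∑ v, algebraMap ℂ A ((dd D * T) u v) * X (splice n al v) (splice n be u) := by
        refine Finset.sum_congr rfl fun u _ => ?_
        rw [Finset.sum_comm]
        simp only [Matrix.mul_apply, map_sum, Finset.sum_mul]
    _ = ∑ u, ∑ v, algebraMap ℂ A ((T * dd D) u v) * X (splice n al v) (splice n be u) := by
        rw [hT.eq]
    _ = _ := by
        simp only [Matrix.mul_apply, map_sum, Finset.sum_mul]
        refine (Finset.sum_congr rfl fun u _ => Finset.sum_comm).trans (Finset.sum_comm.trans ?_)
        refine Finset.sum_congr rfl fun u _ => ?_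
        rw [Finset.sum_comm]
        refine Finset.sum_congr rfl fun v _ => Finset.sum_congr rfl fun w _ => ?_
        rw [mul_comm (T _ _), map_mul, mul_assoc, mul_assoc, Algebra.commutes (T _ _)]

theorem trTail_cyclic {D : Matrix (Fin N) (Fin N) ℂ} {T : MatV N 2 ℂ} (hT : Commute (dd D) T) :
    ∀ {j p : ℕ}, 1 ≤ p → p < j → ∀ X : MatV N (j + 1) A,
      trTail (cmap D) j (gen A (j + 1) T p * X) = trTail (cmap D) j (X * gen A (j + 1) T p)
  | 0, p, _, h, _ => by omega
  | j + 1, p, h1, h, X => by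
    by_cases hp : p < j
    · rw [trTail, trTail, ← ext1_gen (by omega)]
      have e1 := ptr_ext1_mul D (gen A (j + 1) T p) X
      have e2 := ptr_mul_ext1 D (gen A (j + 1) T p) X
      unfold ptr at e1 e2
      rw [e1, e2, trTail_cyclic hT h1 hp]
    · obtain ⟨j', rfl⟩ : ∃ j', j = j' + 1 := ⟨j - 1, by omega⟩
      obtain rfl : p = j' + 1 := by omega
      simp only [trTail]
      have := ptr_ptr_cyclic hT X
      unfold ptr at this
      rw [this]

end Traces

section BMW

variable {B : Type*} [Ring B] [Algebra ℂ B]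

/-- The relations of the Birman–Murakami–Wenzl algebra on `n` strands, for the generators
`r p`, their inverses `s p` and the contractors `κ p`, where `p + 1 < n`. -/
structure BMWRel (q μ : ℂ) (n : ℕ) (r s κ : ℕ → B) : Prop where
  rs : ∀ p, p + 1 < n → r p * s p = 1
  sr : ∀ p, p + 1 < n → s p * r p = 1
  rk : ∀ p, p + 1 < n → r p * κ p = μ • κ p
  kr : ∀ p, p + 1 < n → κ p * r p = μ • κ p
  skein : ∀ p, p + 1 < n → s p = r p - (q - q⁻¹) • 1 + (q - q⁻¹) • κ p
  kk : ∀ p, p + 1 < n → κ p * κ p = ((q - μ) * (q⁻¹ + μ) / ((q - q⁻¹) * μ)) • κ p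
  braid : ∀ p, p + 2 < n → r p * r (p + 1) * r p = r (p + 1) * r p * r (p + 1)
  kkk : ∀ p, p + 2 < n → κ p * κ (p + 1) * κ p = κ p
  kkk' : ∀ p, p + 2 < n → κ (p + 1) * κ p * κ (p + 1) = κ (p + 1)
  rrk : ∀ p, p + 2 < n → r p * r (p + 1) * κ p = κ (p + 1) * κ p
  krr : ∀ p, p + 2 < n → κ (p + 1) * r p * r (p + 1) = κ (p + 1) * κ p
  rrk' : ∀ p, p + 2 < n → r (p + 1) * r p * κ (p + 1) = κ p * κ (p + 1)
  krr' : ∀ p, p + 2 < n → κ p * r (p + 1) * r p = κ p * κ (p + 1)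
  far : ∀ p p', p + 1 < p' → p' + 1 < n → r p * r p' = r p' * r p
  far_rk : ∀ p p', p + 1 < p' → p' + 1 < n → r p * κ p' = κ p' * r p
  far_kr : ∀ p p', p + 1 < p' → p' + 1 < n → κ p * r p' = r p' * κ p
  far_kk : ∀ p p', p + 1 < p' → p' + 1 < n → κ p * κ p' = κ p' * κ p

/-- The relations of the Birman–Murakami–Wenzl algebra on three strands. -/
structure BMW3 (q μ : ℂ) (r₁ r₂ s₁ s₂ k₁ k₂ : B) : Prop where
  rs₁ : r₁ * s₁ = 1
  sr₁ : s₁ * r₁ = 1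
  rs₂ : r₂ * s₂ = 1
  sr₂ : s₂ * r₂ = 1
  rk₁ : r₁ * k₁ = μ • k₁
  kr₁ : k₁ * r₁ = μ • k₁
  rk₂ : r₂ * k₂ = μ • k₂
  kr₂ : k₂ * r₂ = μ • k₂
  skein₁ : s₁ = r₁ - (q - q⁻¹) • 1 + (q - q⁻¹) • k₁
  skein₂ : s₂ = r₂ - (q - q⁻¹) • 1 + (q - q⁻¹) • k₂
  kk₁ : k₁ * k₁ = ((q - μ) * (q⁻¹ + μ) / ((q - q⁻¹) * μ)) • k₁
  kk₂ : k₂ * k₂ = ((q - μ) * (q⁻¹ + μ) / ((q - q⁻¹) * μ)) • k₂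
  braid : r₁ * r₂ * r₁ = r₂ * r₁ * r₂
  kkk₁ : k₁ * k₂ * k₁ = k₁
  kkk₂ : k₂ * k₁ * k₂ = k₂
  rrk₁ : r₁ * r₂ * k₁ = k₂ * k₁
  krr₂ : k₂ * r₁ * r₂ = k₂ * k₁
  rrk₂ : r₂ * r₁ * k₂ = k₁ * k₂
  krr₁ : k₁ * r₂ * r₁ = k₁ * k₂

theorem BMWRel.three {q μ : ℂ} {n : ℕ} {r s κ : ℕ → B} (h : BMWRel q μ n r s κ) {p : ℕ}
    (hp : p + 2 < n) : BMW3 q μ (r p) (r (p + 1)) (s p) (s (p + 1)) (κ p) (κ (p + 1)) :=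
  ⟨h.rs p (by omega), h.sr p (by omega), h.rs _ hp, h.sr _ hp, h.rk p (by omega),
    h.kr p (by omega), h.rk _ hp, h.kr _ hp, h.skein p (by omega), h.skein _ hp,
    h.kk p (by omega), h.kk _ hp, h.braid p hp, h.kkk p hp, h.kkk' p hp, h.rrk p hp, h.krr p hp,
    h.rrk' p hp, h.krr' p hp⟩

namespace BMW3

variable {q μ : ℂ} {r₁ r₂ s₁ s₂ k₁ k₂ : B}

theorem symm (h : BMW3 q μ r₁ r₂ s₁ s₂ k₁ k₂) : BMW3 q μ r₂ r₁ s₂ s₁ k₂ k₁ :=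
  ⟨h.rs₂, h.sr₂, h.rs₁, h.sr₁, h.rk₂, h.kr₂, h.rk₁, h.kr₁, h.skein₂, h.skein₁, h.kk₂, h.kk₁,
    h.braid.symm, h.kkk₂, h.kkk₁, h.rrk₂, h.krr₁, h.rrk₁, h.krr₂⟩

/-- The relations are invariant under reversal of products. -/
theorem op (h : BMW3 q μ r₁ r₂ s₁ s₂ k₁ k₂) :
    BMW3 (B := Bᵐᵒᵖ) q μ (.op r₁) (.op r₂) (.op s₁) (.op s₂) (.op k₁) (.op k₂) := by
  obtain ⟨h1, h2, h3, h4, h5, h6, h7, h8, h9, h10, h11, h12, h13, h14, h15, h16, h17, h18, h19⟩ := h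
  constructor <;> apply MulOpposite.unop_injective <;>
    simp only [MulOpposite.unop_mul, MulOpposite.unop_op, MulOpposite.unop_one,
      MulOpposite.unop_smul, MulOpposite.unop_add, MulOpposite.unop_sub, ← mul_assoc] <;> assumption

theorem sk₁ (hμ : μ ≠ 0) (h : BMW3 q μ r₁ r₂ s₁ s₂ k₁ k₂) : s₁ * k₁ = μ⁻¹ • k₁ := by
  calc s₁ * k₁ = μ⁻¹ • (s₁ * (μ • k₁)) := by
        rw [mul_smul_comm, smul_smul, inv_mul_cancel₀ hμ, one_smul]
    _ = _ := by rw [← h.rk₁, ← mul_assoc, h.sr₁, one_mul]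

theorem rkk (h : BMW3 q μ r₁ r₂ s₁ s₂ k₁ k₂) : r₁ * k₂ * k₁ = s₂ * k₁ := by
  calc r₁ * k₂ * k₁ = s₂ * (r₂ * r₁ * k₂) * k₁ := by
        rw [← mul_assoc s₂, ← mul_assoc s₂, h.sr₂, one_mul]
    _ = s₂ * (k₁ * k₂ * k₁) := by rw [h.rrk₂]; simp only [mul_assoc]
    _ = _ := by rw [h.kkk₁]

theorem kkr (h : BMW3 q μ r₁ r₂ s₁ s₂ k₁ k₂) : k₁ * k₂ * r₁ = k₁ * s₂ := by
  have := congrArg MulOpposite.unop h.op.rkk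
  simpa only [MulOpposite.unop_mul, MulOpposite.unop_op, ← mul_assoc] using this

theorem rk_eq (h : BMW3 q μ r₁ r₂ s₁ s₂ k₁ k₂) : r₁ * k₂ = s₂ * k₁ * k₂ := by
  rw [mul_assoc, ← h.rrk₂, ← mul_assoc, ← mul_assoc, h.sr₂, one_mul]

theorem kr_eq (h : BMW3 q μ r₁ r₂ s₁ s₂ k₁ k₂) : k₁ * r₂ = k₁ * k₂ * s₁ := by
  rw [← h.krr₁, mul_assoc, h.rs₁, mul_one]

theorem krk (hμ : μ ≠ 0) (h : BMW3 q μ r₁ r₂ s₁ s₂ k₁ k₂) : k₁ * r₂ * k₁ = μ⁻¹ • k₁ := by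
  rw [h.kr_eq, mul_assoc, h.sk₁ hμ, mul_smul_comm, h.kkk₁]

theorem rks (h : BMW3 q μ r₁ r₂ s₁ s₂ k₁ k₂) : r₁ * k₂ * s₁ = s₂ * k₁ * r₂ := by
  rw [h.rk_eq, mul_assoc s₂, mul_assoc s₂, ← h.kr_eq, mul_assoc]

/-- The spectral-parameter-dependent element `1 + (x-1)/λ r + μ(x-1)/(μ+qx) κ`. -/
def _root_.QMA.baxter (q μ : ℂ) (r k : B) (x : ℂ) : B :=
  1 + ((x - 1) / (q - q⁻¹)) • r + (μ * (x - 1) / (μ + q * x)) • k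

theorem rr₁ (h : BMW3 q μ r₁ r₂ s₁ s₂ k₁ k₂) :
    r₁ * r₁ = 1 + (q - q⁻¹) • r₁ - ((q - q⁻¹) * μ) • k₁ := by
  have := h.rs₁
  rw [h.skein₁, mul_add, mul_sub, mul_smul_comm, mul_smul_comm, h.rk₁, mul_one] at this
  rw [← this]; module

theorem yang_baxter (hq : q ≠ 0) (hq2 : q - q⁻¹ ≠ 0) (hμ : μ ≠ 0)
    (h : BMW3 q μ r₁ r₂ s₁ s₂ k₁ k₂) {x y : ℂ}
    (hx : μ + q * x ≠ 0) (hy : μ + q * y ≠ 0) (hxy : μ + q * (x * y) ≠ 0) :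
    baxter q μ r₁ k₁ x * baxter q μ r₂ k₂ (x * y) * baxter q μ r₁ k₁ y =
      baxter q μ r₂ k₂ y * baxter q μ r₁ k₁ (x * y) * baxter q μ r₂ k₂ x := by
  have e1 : r₁ * r₁ = 1 + (q - q⁻¹) • r₁ - ((q - q⁻¹) * μ) • k₁ := h.rr₁
  have e2 : r₂ * r₂ = 1 + (q - q⁻¹) • r₂ - ((q - q⁻¹) * μ) • k₂ := h.symm.rr₁
  have e3 : r₁ * k₂ * k₁ = r₂ * k₁ - (q - q⁻¹) • k₁ + (q - q⁻¹) • (k₂ * k₁) := by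
    rw [h.rkk, h.skein₂, add_mul, sub_mul, smul_mul_assoc, smul_mul_assoc, one_mul]
  have e4 : k₁ * k₂ * r₁ = k₁ * r₂ - (q - q⁻¹) • k₁ + (q - q⁻¹) • (k₁ * k₂) := by
    rw [h.kkr, h.skein₂, mul_add, mul_sub, mul_smul_comm, mul_smul_comm, mul_one]
  have e5 : r₂ * k₁ * k₂ = r₁ * k₂ - (q - q⁻¹) • k₂ + (q - q⁻¹) • (k₁ * k₂) := by
    rw [h.symm.rkk, h.skein₁, add_mul, sub_mul, smul_mul_assoc, smul_mul_assoc, one_mul]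
  have e6 : k₂ * k₁ * r₂ = k₂ * r₁ - (q - q⁻¹) • k₂ + (q - q⁻¹) • (k₂ * k₁) := by
    rw [h.symm.kkr, h.skein₁, mul_add, mul_sub, mul_smul_comm, mul_smul_comm, mul_one]
  have e7 : r₁ * k₂ * r₁ = r₂ * k₁ * r₂ + (q - q⁻¹) • (r₁ * k₂ + k₂ * r₁ - r₂ * k₁ - k₁ * r₂)
      + ((q - q⁻¹) ^ 2) • (k₁ - k₂) := by
    have a1 := h.rks
    rw [h.skein₁, h.skein₂] at a1
    simp only [mul_add, mul_sub, add_mul, sub_mul, mul_smul_comm, smul_mul_assoc, mul_one,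
      one_mul, e3, e6] at a1
    have a2 : r₁ * k₂ * r₁ = r₂ * k₁ * r₂ - (q - q⁻¹) • (k₁ * r₂) +
        (q - q⁻¹) • (k₂ * r₁ - (q - q⁻¹) • k₂ + (q - q⁻¹) • (k₂ * k₁)) +
        (q - q⁻¹) • (r₁ * k₂) - (q - q⁻¹) • (r₂ * k₁ - (q - q⁻¹) • k₁ + (q - q⁻¹) • (k₂ * k₁)) := by
      rw [← a1]; abel
    rw [a2]; module
  have e8 := h.krk hμ
  have e9 := h.symm.krk hμ
  have hq2' : q ^ 2 - 1 ≠ 0 := by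
    intro h0; apply hq2; field_simp; simpa using h0
  unfold baxter
  obtain ⟨X, hX, hX0, rfl⟩ : ∃ X, X = μ + q * x ∧ X ≠ 0 ∧ x = (X - μ) / q :=
    ⟨_, rfl, hx, by field_simp; ring⟩
  obtain ⟨Y, hY, hY0, rfl⟩ : ∃ Y, Y = μ + q * y ∧ Y ≠ 0 ∧ y = (Y - μ) / q :=
    ⟨_, rfl, hy, by field_simp; ring⟩
  rw [← hX, ← hY]
  have hxy' : q * μ + (X - μ) * (Y - μ) ≠ 0 := by
    intro h0; apply hxy; field_simp; linear_combination h0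
  obtain ⟨Z, hZ⟩ : ∃ Z, Z = μ + q * ((X - μ) / q * ((Y - μ) / q)) := ⟨_, rfl⟩
  rw [← hZ] at hxy ⊢
  have hZ' : Z * q = q * μ + (X - μ) * (Y - μ) := by rw [hZ]; field_simp
  simp only [mul_add, add_mul, mul_one, one_mul, mul_smul_comm, smul_mul_assoc, e1, e2, e3, e4, e5,
    e6, e7, e8, e9, h.rk₁, h.kr₁, h.rk₂, h.kr₂, h.kk₁, h.kk₂, ← h.braid, h.kkk₁, h.kkk₂, h.rrk₁,
    h.rrk₂, h.krr₁, h.krr₂]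
  have hZ'' : Z = (q * μ + (X - μ) * (Y - μ)) / q := by field_simp; linear_combination hZ'
  match_scalars <;> field_simp <;> (try rw [hZ'']) <;> (try field_simp) <;> (try ring)

end BMW3

theorem baxter_fusion {q μ : ℂ} {r s k : B} (hq : q ≠ 0) (hq2 : q - q⁻¹ ≠ 0) (hμ : μ ≠ 0)
    (hμ' : μ + q⁻¹ ≠ 0)
    (rs : r * s = 1) (skein : s = r - (q - q⁻¹) • 1 + (q - q⁻¹) • k) (rk : r * k = μ • k)
    (kr : k * r = μ • k)
    (kk : k * k = ((q - μ) * (q⁻¹ + μ) / ((q - q⁻¹) * μ)) • k) (x : ℂ) :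
    baxter q μ r k x * baxter q μ r k (q ^ (-2 : ℤ)) =
      (1 - q⁻¹ * ((x - 1) / (q - q⁻¹))) • baxter q μ r k (q ^ (-2 : ℤ)) ∧
    baxter q μ r k (q ^ (-2 : ℤ)) * baxter q μ r k x =
      (1 - q⁻¹ * ((x - 1) / (q - q⁻¹))) • baxter q μ r k (q ^ (-2 : ℤ)) := by
  have hrr : r * r = 1 + (q - q⁻¹) • r - ((q - q⁻¹) * μ) • k := by
    rw [skein, mul_add, mul_sub, mul_smul_comm, mul_smul_comm, rk, mul_one] at rs
    rw [← rs]; module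
  have hq2' : q ^ 2 - 1 ≠ 0 := by
    intro h0; apply hq2; field_simp; simpa using h0
  have hμ1 : μ * q + 1 ≠ 0 := by
    intro h0; apply hμ'; field_simp; simpa using h0
  have hμ2 : q * μ + 1 ≠ 0 := by rwa [mul_comm]
  have hc1 : (q ^ (-2 : ℤ) - 1) / (q - q⁻¹) = - q⁻¹ := by
    rw [_root_.zpow_neg, zpow_ofNat]; field_simp; ring
  have hc2 : μ * (q ^ (-2 : ℤ) - 1) / (μ + q * q ^ (-2 : ℤ)) = - μ * (q - q⁻¹) / (μ * q + 1) := by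
    have : μ + q * q ^ (-2 : ℤ) = (μ * q + 1) / q := by
      rw [_root_.zpow_neg, zpow_ofNat]; field_simp
    rw [this, _root_.zpow_neg, zpow_ofNat]; field_simp; ring
  have h1 : r * baxter q μ r k (q ^ (-2 : ℤ)) = (-q⁻¹) • baxter q μ r k (q ^ (-2 : ℤ)) := by
    unfold baxter
    rw [hc1, hc2]
    simp only [mul_add, mul_one, mul_smul_comm, hrr, rk]
    match_scalars <;> field_simp <;> ring
  have h2 : k * baxter q μ r k (q ^ (-2 : ℤ)) = 0 := by
    unfold baxter
    rw [hc1, hc2]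
    simp only [mul_add, mul_one, mul_smul_comm, kr, kk]
    match_scalars; field_simp; ring
  have h3 : baxter q μ r k (q ^ (-2 : ℤ)) * r = (-q⁻¹) • baxter q μ r k (q ^ (-2 : ℤ)) := by
    rw [← h1]; unfold baxter; simp only [mul_add, add_mul, mul_one, one_mul, mul_smul_comm,
      smul_mul_assoc, rk, kr]
  have h4 : baxter q μ r k (q ^ (-2 : ℤ)) * k = 0 := by
    rw [← h2]; unfold baxter; simp only [mul_add, add_mul, mul_one, one_mul, mul_smul_comm,
      smul_mul_assoc, rk, kr]
  generalize baxter q μ r k (q ^ (-2 : ℤ)) = z at *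
  constructor
  · unfold baxter
    rw [add_mul, add_mul, smul_mul_assoc, smul_mul_assoc, h1, h2, one_mul]; module
  · unfold baxter
    rw [mul_add, mul_add, mul_smul_comm, mul_smul_comm, h3, h4, mul_one]; module

end BMW

section Antisymmetrizers

variable {B : Type*} [Ring B] [Algebra ℂ B]

/-- A family `σ j m` of solutions of the Yang–Baxter equation with discrete spectral parameter
`1 ≤ m ≤ K` on `n` strands, such that `σ j 1` absorbs `σ j m` up to the scalar `e m`. -/
structure BaxterFamily (n K : ℕ) (e : ℕ → ℂ) (σ : ℕ → ℕ → B) : Prop where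
  ybe : ∀ j a b, j + 2 < n → 1 ≤ a → 1 ≤ b → a + b ≤ K →
    σ j a * σ (j + 1) (a + b) * σ j b = σ (j + 1) b * σ j (a + b) * σ (j + 1) a
  far : ∀ j j' a b, j + 1 < j' → j' + 1 < n → Commute (σ j a) (σ j' b)
  fusion : ∀ j m, j + 1 < n → 1 ≤ m → m ≤ K → σ j m * σ j 1 = e m • σ j 1

/-- The antisymmetrizer on strands `o, …, o + i - 1` built from the family `σ`. -/
def antisymm (c : ℕ → ℂ) (σ : ℕ → ℕ → B) (o : ℕ) : ℕ → B
  | 0 => 1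
  | 1 => 1
  | i + 2 => c (i + 1) • (antisymm c σ o (i + 1) * σ (o + i) (i + 1) * antisymm c σ o (i + 1))

/-- The product `σ (o+i-1) (m+i-1) ⋯ σ (o+1) (m+1) * σ o m`. -/
def ladder (σ : ℕ → ℕ → B) (o : ℕ) : ℕ → ℕ → B
  | 0, _ => 1
  | i + 1, m => σ (o + i) (m + i) * ladder σ o i m

/-- The product `σ (o+i-1) m ⋯ σ (o+1) (m+i-2) * σ o (m+i-1)`. -/
def coladder (σ : ℕ → ℕ → B) (o : ℕ) : ℕ → ℕ → B
  | 0, _ => 1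
  | i + 1, m => σ (o + i) m * coladder σ o i (m + 1)

theorem coladder_succ (σ : ℕ → ℕ → B) (o i m : ℕ) :
    coladder σ o (i + 1) m = coladder σ (o + 1) i m * σ o (m + i) := by
  induction i generalizing m with
  | zero => simp [coladder]
  | succ i ih =>
    rw [coladder, ih, coladder, ← mul_assoc, show o + 1 + i = o + (i + 1) by ring,
      show m + 1 + i = m + (i + 1) by ring]

/-- The constants `c 1 ⋯ c (i-1)`. -/
def cprod (c : ℕ → ℂ) : ℕ → ℂ
  | 0 => 1
  | 1 => 1
  | i + 2 => c (i + 1) * cprod c (i + 1)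

namespace BaxterFamily

variable {n K : ℕ} {e c : ℕ → ℂ} {σ : ℕ → ℕ → B}

theorem commute_antisymm {o i : ℕ} {x : B}
    (hx : ∀ j m, o ≤ j → j + 1 < o + i → Commute x (σ j m)) : Commute x (antisymm c σ o i) := by
  induction i using Nat.strong_induction_on with
  | _ i ih =>
    match i with
    | 0 => exact Commute.one_right x
    | 1 => exact Commute.one_right x
    | i + 2 =>
      have h1 := ih (i + 1) (by omega) fun j m hj hj' => hx j m hj (by omega)
      exact ((h1.mul_right (hx _ _ (by omega) (by omega))).mul_right h1).smul_right _

theorem commute_high (h : BaxterFamily n K e σ) {o i j m : ℕ} (hj : o + i ≤ j) (hn : j + 1 < n) :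
    Commute (antisymm c σ o i) (σ j m) :=
  (commute_antisymm fun j' m' _ hj' => (h.far j' j m' m (by omega) hn).symm).symm

theorem commute_low (h : BaxterFamily n K e σ) {o i j m : ℕ} (hj : j + 1 < o) (hn : o + i ≤ n) :
    Commute (antisymm c σ o i) (σ j m) :=
  (commute_antisymm fun j' m' _ hj' => h.far j j' m m' (by omega) (by omega)).symm

theorem commute_coladder (h : BaxterFamily n K e σ) {o i j m m' : ℕ} (hj : o + i < j)
    (hn : j + 1 < n) : Commute (σ j m) (coladder σ o i m') := by
  induction i generalizing m' with
  | zero => exact Commute.one_right _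
  | succ i ih =>
    exact (h.far (o + i) j m' m (by omega) hn).symm.mul_right (ih (by omega))

theorem ladder_step {A' A'' B' B'' p r s T₁ U₀ u v w T₀ U₁ : B} (h1 : A' * r = r * A')
    (h2 : A' * T₁ = s * U₀ * B') (ybe : p * r * s = u * v * w) (h3 : A' * u = u * A')
    (h4 : w * U₀ = U₀ * w) (h5 : B'' * B' = B') (h6 : B'' * w = w * B'') (h7 : A'' * T₀ = U₀ * B'')
    (h8 : A'' * v = v * A'') (h9 : A' * A'' = A') (h10 : A' * (v * T₀) = U₁ * B') :
    A' * p * A' * (r * T₁) = u * U₁ * (B' * w * B') :=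
  calc A' * p * A' * (r * T₁) = A' * p * (A' * r) * T₁ := by noncomm_ring
    _ = A' * p * r * (A' * T₁) := by rw [h1]; noncomm_ring
    _ = A' * (p * r * s) * U₀ * B' := by rw [h2]; noncomm_ring
    _ = (A' * u) * v * (w * U₀) * B' := by rw [ybe]; noncomm_ring
    _ = u * A' * v * U₀ * w * (B'' * B') := by rw [h3, h4, h5]; noncomm_ring
    _ = u * A' * v * U₀ * (w * B'') * B' := by noncomm_ring
    _ = u * A' * v * (U₀ * B'') * w * B' := by rw [← h6]; noncomm_ring
    _ = u * A' * (v * A'') * T₀ * w * B' := by rw [← h7]; noncomm_ring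
    _ = u * (A' * A'') * v * T₀ * w * B' := by rw [← h8]; noncomm_ring
    _ = u * (A' * (v * T₀)) * w * B' := by rw [h9]; noncomm_ring
    _ = _ := by rw [h10]; noncomm_ring

/-- Absorption properties of the antisymmetrizers. -/
structure Absorbs (c : ℕ → ℂ) (σ : ℕ → ℕ → B) (n i : ℕ) : Prop where
  left : ∀ o l, o + i ≤ n → l ≤ i → antisymm c σ o l * antisymm c σ o i = antisymm c σ o i
  right : ∀ o l, o + i ≤ n → l ≤ i → antisymm c σ o i * antisymm c σ o l = antisymm c σ o i
  shift : ∀ o d l, o + i ≤ n → d + l = i →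
    antisymm c σ (o + d) l * antisymm c σ o i = antisymm c σ o i

theorem antisymm_ladder (h : BaxterFamily n K e σ) {i : ℕ} (ha : ∀ l < i, Absorbs c σ n l)
    (o m : ℕ) (hn : o + i < n) (hm : 1 ≤ m) (hK : m + i ≤ K + 1) :
    antisymm c σ o i * ladder σ o i m = coladder σ o i m * antisymm c σ (o + 1) i := by
  induction i using Nat.strong_induction_on generalizing m with
  | _ i ih =>
    match i with
    | 0 => rfl
    | 1 => simp [antisymm, ladder, coladder]
    | i + 2 =>
      have ih' : ∀ l, l < i + 2 → ∀ m', 1 ≤ m' → m' + l ≤ K + 1 → _ := fun l hl m' h1 h2 =>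
        ih l hl (fun l' hl' => ha l' (by omega)) m' (by omega) h1 h2
      have ha' := ha (i + 1) (by omega)
      rw [antisymm, antisymm, smul_mul_assoc, mul_smul_comm]
      congr 1
      have hy := h.ybe (o + i) (i + 1) m (by omega) (by omega) hm (by omega)
      refine ladder_step (A'' := antisymm c σ o i) (B'' := antisymm c σ (o + 1) i)
        (s := σ (o + i) m) (U₀ := coladder σ o i (m + 1)) (v := σ (o + i) (i + 1 + m))
        (T₀ := ladder σ o i (m + 1)) ?_ ?_ ?_ ?_ ?_ ?_ ?_ ?_ ?_ ?_ ?_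
      · exact h.commute_high (by omega) (by omega)
      · exact ih' _ (by omega) m hm (by omega)
      · rw [show o + (i + 1) = o + i + 1 by ring, show m + (i + 1) = i + 1 + m by ring, hy,
          show o + 1 + i = o + i + 1 by ring]
      · exact h.commute_high (by omega) (by omega)
      · exact h.commute_coladder (by omega) (by omega)
      · exact ha'.left _ _ (by omega) (by omega)
      · exact h.commute_high (by omega) (by omega)
      · exact ih' _ (by omega) _ (by omega) (by omega)
      · exact h.commute_high (by omega) (by omega)
      · exact ha'.right _ _ (by omega) (by omega)
      · have := ih' (i + 1) (by omega) (m + 1) (by omega) (by omega)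
        rwa [ladder, show m + 1 + i = i + 1 + m by ring] at this

theorem mul_antisymm_eq (h : BaxterFamily n K e σ) (o i : ℕ) (hn : o + i + 1 ≤ n) (X : B)
    (hX : ∀ l ≤ i, X * antisymm c σ o l = X) :
    X * antisymm c σ o (i + 1) = cprod c (i + 1) • (X * ladder σ o i 1) := by
  induction i generalizing X with
  | zero => simp [antisymm, ladder, cprod]
  | succ i ih =>
    rw [antisymm, mul_smul_comm, ← mul_assoc, ← mul_assoc, hX _ le_rfl, ih (by omega), cprod,
      ladder,
      smul_smul, mul_assoc X, add_comm 1 i]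
    intro l hl
    rw [mul_assoc, ← (h.commute_high (c := c) (o := o) (i := l) (by omega) (by omega)).eq,
      ← mul_assoc, hX _ (by omega)]

theorem antisymm_mul_eq (h : BaxterFamily n K e σ) (o i : ℕ) (hn : o + i + 1 ≤ n) (X : B)
    (hX : ∀ d l, d + l = i → antisymm c σ (o + d + 1) l * X = X)
    (halt : ∀ l < i, ∀ o', o' + l + 2 ≤ n → antisymm c σ o' (l + 2) =
      c (l + 1) • (antisymm c σ (o' + 1) (l + 1) * σ o' (l + 1) * antisymm c σ (o' + 1) (l + 1))) :
    antisymm c σ o (i + 1) * X = cprod c (i + 1) • (coladder σ o i 1 * X) := by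
  induction i generalizing o X with
  | zero => simp [antisymm, coladder, cprod]
  | succ i ih =>
    have h1 := hX 0 (i + 1) (by omega)
    rw [add_zero] at h1
    rw [halt i (by omega) o (by omega), smul_mul_assoc, mul_assoc, h1, mul_assoc,
      ih (o + 1) (by omega), cprod, coladder_succ, smul_smul, mul_assoc, add_comm 1 i]
    · intro d l hdl
      rw [← mul_assoc, (h.commute_low (by omega) (by omega)).eq, mul_assoc,
        show o + 1 + d + 1 = o + (d + 1) + 1 by ring, hX _ _ (by omega)]
    · exact fun l hl => halt l (by omega)

/-- The antisymmetrizers are projections, and can be built up from either side. -/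
theorem absorbs_and_symm (h : BaxterFamily n K e σ) (hc : ∀ m, 1 ≤ m → m < K → c m * e m = 1)
    {i : ℕ} (hi : i ≤ K) : Absorbs c σ n i ∧ (∀ o, 1 ≤ i → o + i + 1 ≤ n →
      antisymm c σ o i * σ (o + i - 1) i * antisymm c σ o i =
        antisymm c σ (o + 1) i * σ o i * antisymm c σ (o + 1) i) := by
  induction i using Nat.strong_induction_on with
  | _ i ih =>
    have habs : Absorbs c σ n i := by
      match i with
      | 0 =>
        refine ⟨fun o l _ hl => ?_, fun o l _ hl => ?_, fun o d l _ hl => ?_⟩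
        · obtain rfl : l = 0 := by omega
          exact one_mul _
        · obtain rfl : l = 0 := by omega
          exact one_mul _
        · obtain rfl : l = 0 := by omega
          exact one_mul _
      | 1 =>
        have h1 : ∀ o l, l ≤ 1 → antisymm c σ o l = 1 := by
          intro o l hl
          match l with
          | 0 => rfl
          | 1 => rfl
        refine ⟨fun o l _ hl => ?_, fun o l _ hl => ?_, fun o d l _ hl => ?_⟩
        · rw [h1 o l hl, one_mul]
        · rw [h1 o l hl, mul_one]
        · rw [h1 _ l (by omega), one_mul]
      | i + 2 =>
        obtain ⟨ha, hs⟩ := ih (i + 1) (by omega) (by omega)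
        have hid : ∀ o, o + (i + 2) ≤ n →
            antisymm c σ o (i + 2) * antisymm c σ o (i + 2) = antisymm c σ o (i + 2) := by
          intro o ho
          have e1 : antisymm c σ o (i + 1) * antisymm c σ o (i + 2) = antisymm c σ o (i + 2) := by
            rw [antisymm, mul_smul_comm, ← mul_assoc, ← mul_assoc,
              ha.left _ _ (by omega) le_rfl]
          have e2 : antisymm c σ o (i + 2) =
              cprod c (i + 2) • (coladder σ o (i + 1) 1 * antisymm c σ (o + 1) (i + 1)) := by
            rw [← h.antisymm_ladder (fun l hl => (ih l (by omega) (by omega)).1) o 1 (by omega)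
              le_rfl (by omega), ← e1]
            exact h.mul_antisymm_eq o (i + 1) (by omega) _
              fun l hl => ha.right _ _ (by omega) hl
          have e3 : σ (o + i) (i + 1) * antisymm c σ o (i + 2) =
              e (i + 1) • antisymm c σ o (i + 2) := by
            rw [e2, coladder, mul_smul_comm, ← mul_assoc, ← mul_assoc,
              h.fusion _ _ (by omega) (by omega) (by omega), smul_mul_assoc, smul_mul_assoc,
              smul_comm]
          nth_rewrite 1 [antisymm]
          rw [smul_mul_assoc, mul_assoc, e1, mul_assoc, e3, mul_smul_comm, e1, smul_smul,
            hc _ (by omega) (by omega), one_smul]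
        refine ⟨fun o l ho hl => ?_, fun o l ho hl => ?_, fun o d l ho hl => ?_⟩
        · rcases Nat.lt_or_ge l (i + 2) with hl' | hl'
          · rw [antisymm, mul_smul_comm, ← mul_assoc, ← mul_assoc,
              ha.left _ _ (by omega) (by omega)]
          · obtain rfl : l = i + 2 := by omega
            exact hid o ho
        · rcases Nat.lt_or_ge l (i + 2) with hl' | hl'
          · rw [antisymm, smul_mul_assoc, mul_assoc, ha.right _ _ (by omega) (by omega)]
          · obtain rfl : l = i + 2 := by omega
            exact hid o ho
        · match d with
          | 0 =>
            obtain rfl : l = i + 2 := by omega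
            exact hid o ho
          | d + 1 =>
            have := hs o (by omega) (by omega)
            rw [show o + (i + 1) - 1 = o + i by omega] at this
            rw [antisymm, this, mul_smul_comm, ← mul_assoc, ← mul_assoc,
              show o + (d + 1) = o + 1 + d by ring, ha.shift _ _ _ (by omega) (by omega)]
    refine ⟨habs, fun o h1 ho => ?_⟩
    obtain ⟨i, rfl⟩ : ∃ i', i = i' + 1 := ⟨i - 1, by omega⟩
    rw [show o + (i + 1) - 1 = o + i by omega]
    have e1 : antisymm c σ o (i + 1) * σ (o + i) (i + 1) * antisymm c σ o (i + 1) =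
        cprod c (i + 1) • (antisymm c σ o (i + 1) * ladder σ o (i + 1) 1) := by
      rw [h.mul_antisymm_eq o i (by omega), ladder, mul_assoc, add_comm 1 i]
      intro l hl
      rw [mul_assoc, ← (h.commute_high (c := c) (o := o) (i := l) (by omega) (by omega)).eq,
        ← mul_assoc, habs.right _ _ (by omega) (by omega)]
    have e2 : antisymm c σ (o + 1) (i + 1) * σ o (i + 1) * antisymm c σ (o + 1) (i + 1) =
        cprod c (i + 1) • (coladder σ o (i + 1) 1 * antisymm c σ (o + 1) (i + 1)) := by
      rw [mul_assoc, h.antisymm_mul_eq (o + 1) i (by omega), coladder_succ, mul_assoc, add_comm 1 i]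
      · intro d l hdl
        rw [← mul_assoc, (h.commute_low (by omega) (by omega)).eq, mul_assoc,
          show o + 1 + d + 1 = o + 1 + (d + 1) by ring, habs.shift _ _ _ (by omega) (by omega)]
      · intro l hl o' ho'
        have := (ih (l + 1) (by omega) (by omega)).2 o' (by omega) (by omega)
        rw [show o' + (l + 1) - 1 = o' + l by omega] at this
        rw [antisymm, this]
    rw [e1, e2, h.antisymm_ladder (fun l hl => (ih l (by omega) (by omega)).1) o 1 (by omega)
      le_rfl (by omega)]

end BaxterFamily

end Antisymmetrizers

section Generators

variable {N : ℕ} [NeZero N] {A : Type*} [Ring A] [Algebra ℂ A]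

theorem bmwK_mul_self {q μ : ℂ} {R : MatV N 2 ℂ} (hq : q ≠ 0) (hl : q - q⁻¹ ≠ 0) (hμ : μ ≠ 0)
    (hc : (q • (1 : MatV N 2 ℂ) - R) * (q⁻¹ • (1 : MatV N 2 ℂ) + R) *
      (μ • (1 : MatV N 2 ℂ) - R) = 0) :
    R * bmwK q μ R = μ • bmwK q μ R ∧ bmwK q μ R * R = μ • bmwK q μ R ∧
      R⁻¹ = R - (q - q⁻¹) • 1 + (q - q⁻¹) • bmwK q μ R ∧
      bmwK q μ R * bmwK q μ R = ((q - μ) * (q⁻¹ + μ) / ((q - q⁻¹) * μ)) • bmwK q μ R := by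
  have hcomm : (q • (1 : MatV N 2 ℂ) - R) * (q⁻¹ • (1 : MatV N 2 ℂ) + R) =
      1 + (q - q⁻¹) • R - R * R := by
    simp only [sub_mul, mul_add, smul_mul_assoc, mul_smul_comm, one_mul, mul_one]
    match_scalars <;> field_simp
    ring
  have hK : bmwK q μ R = (μ⁻¹ * (q - q⁻¹)⁻¹) • (1 + (q - q⁻¹) • R - R * R) := by
    rw [bmwK, hcomm]
  have hcomm' : R * bmwK q μ R = bmwK q μ R * R := by
    rw [hK]
    simp only [mul_smul_comm, smul_mul_assoc, mul_sub, sub_mul, mul_add, add_mul, one_mul, mul_one,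
      mul_assoc]
  have hKR : bmwK q μ R * R = μ • bmwK q μ R := by
    rw [mul_sub, mul_smul_comm, mul_one, sub_eq_zero] at hc
    rw [bmwK, smul_mul_assoc, ← hc, smul_comm]
  have hK' : (q - q⁻¹) • μ • bmwK q μ R = 1 + (q - q⁻¹) • R - R * R := by
    rw [hK, smul_smul, smul_smul, mul_assoc, mul_inv_cancel_left₀ hμ, mul_inv_cancel₀ hl, one_smul]
  refine ⟨hcomm'.trans hKR, hKR, ?_, ?_⟩
  · have h1 : (R - (q - q⁻¹) • 1 + (q - q⁻¹) • bmwK q μ R) * R = 1 := by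
      rw [add_mul, sub_mul, smul_mul_assoc, smul_mul_assoc, hKR, hK', one_mul]; abel
    exact Matrix.inv_eq_left_inv h1
  · nth_rewrite 2 [hK]
    rw [mul_smul_comm, mul_sub, mul_add, mul_one, mul_smul_comm, ← mul_assoc, hKR, smul_mul_assoc,
      hKR]
    match_scalars
    field_simp
    ring

/-- The relations of the contractors that follow from the braid relation and the defining
relations of a BMW-type R-matrix. -/
theorem contractor_relations {B : Type*} [Ring B] [Algebra ℂ B] {q q' c : ℂ}
    {r₀ r₁ s₀ s₁ k₀ k₁ : B} (sr₁ : s₁ * r₁ = 1)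
    (sr₀ : s₀ * r₀ = 1)
    (hk₀ : k₀ = c • ((q • 1 - r₀) * (q' • 1 + r₀))) (hk₁ : k₁ = c • ((q • 1 - r₁) * (q' • 1 + r₁)))
    (hb : r₀ * r₁ * r₀ = r₁ * r₀ * r₁) (h1 : k₁ * k₀ = k₁ * r₀ * r₁) (h2 : k₁ * k₀ = k₁ * s₀ * s₁)
    (h3 : k₀ * k₁ * k₀ = k₀) :
    k₁ * k₀ * k₁ = k₁ ∧ r₀ * r₁ * k₀ = k₁ * k₀ ∧ r₁ * r₀ * k₁ = k₀ * k₁ ∧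
      k₀ * r₁ * r₀ = k₀ * k₁ := by
  have poly : ∀ {u x y : B}, SemiconjBy u x y →
      SemiconjBy u (c • ((q • 1 - x) * (q' • 1 + x))) (c • ((q • 1 - y) * (q' • 1 + y))) := by
    intro u x y h
    have h0 : ∀ z : ℂ, SemiconjBy u (z • 1) (z • 1) := fun z => by
      rw [SemiconjBy, mul_smul_comm, smul_mul_assoc, mul_one, one_mul]
    have := ((h0 q).sub_right h).mul_right ((h0 q').add_right h)
    rw [SemiconjBy] at this ⊢
    rw [mul_smul_comm, smul_mul_assoc, this]
  have c1 : SemiconjBy (r₀ * r₁) k₀ k₁ := by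
    rw [hk₀, hk₁]; apply poly; rw [SemiconjBy, hb, mul_assoc]
  have c2 : SemiconjBy (r₁ * r₀) k₁ k₀ := by
    rw [hk₀, hk₁]; apply poly; rw [SemiconjBy, ← hb, mul_assoc]
  have a1 : k₁ * k₀ * (r₁ * r₀) = k₁ := by
    rw [h2, mul_assoc (k₁ * s₀), ← mul_assoc s₁, sr₁, one_mul, mul_assoc, sr₀, mul_one]
  have a2 : k₀ * r₁ * r₀ = k₀ * k₁ := by
    calc k₀ * r₁ * r₀ = (k₀ * k₁ * k₀) * r₁ * r₀ := by rw [h3]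
      _ = k₀ * (k₁ * k₀ * (r₁ * r₀)) := by noncomm_ring
      _ = _ := by rw [a1]
  refine ⟨?_, ?_, ?_, a2⟩
  · rw [mul_assoc, ← a2, mul_assoc k₀, ← mul_assoc, a1]
  · rw [c1.eq, h1, mul_assoc]
  · rw [c2.eq, ← a2, mul_assoc]

theorem gen_bmwK {q μ : ℂ} {R : MatV N 2 ℂ} {n p : ℕ} (hp : p + 1 < n) :
    gen A n (bmwK q μ R) p =
      (μ⁻¹ * (q - q⁻¹)⁻¹) • ((q • 1 - gen A n R p) * (q⁻¹ • 1 + gen A n R p)) := by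
  rw [bmwK, gen_smul, gen_mul hp, gen_sub, gen_add, gen_smul, gen_smul, gen_one hp]

theorem gen_bmwRel {q μ : ℂ} {R : MatV N 2 ℂ} (hq : q ≠ 0) (hl : q - q⁻¹ ≠ 0) (hμ : μ ≠ 0)
    (hb : IsBraid R) (hdet : IsUnit R.det) (h : IsBMW q μ R) (n : ℕ) :
    BMWRel q μ n (gen A n R) (gen A n R⁻¹) (gen A n (bmwK q μ R)) := by
  obtain ⟨hc, h1, h2, h3⟩ := h
  obtain ⟨rk, kr, sk, kk⟩ := bmwK_mul_self hq hl hμ hc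
  have rs : ∀ p, p + 1 < n → gen A n R p * gen A n R⁻¹ p = 1 := fun p hp => (gen_inv hp hdet).1
  have sr : ∀ p, p + 1 < n → gen A n R⁻¹ p * gen A n R p = 1 := fun p hp => (gen_inv hp hdet).2
  have braid : ∀ p, p + 2 < n → gen A n R p * gen A n R (p + 1) * gen A n R p =
      gen A n R (p + 1) * gen A n R p * gen A n R (p + 1) := fun p hp =>
    gen_transfer hp R R R R R R 0 1 0 1 0 1 (by simp) (by simp) (by simp) (by simp) (by simp)
      (by simp) hb
  have two : ∀ {X Y X' Y' Z' : MatV N 2 ℂ}, lift2 (n := 3) 1 X * lift2 0 Y =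
      lift2 1 X' * lift2 0 Y' * lift2 1 Z' → ∀ p, p + 2 < n →
      gen A n X (p + 1) * gen A n Y p = gen A n X' (p + 1) * gen A n Y' p * gen A n Z' (p + 1) := by
    intro X Y X' Y' Z' H p hp
    have := gen_transfer (A := A) hp X Y 1 X' Y' Z' 1 0 0 1 0 1 (by simp) (by simp) (by simp)
      (by simp) (by simp) (by simp)
      (by rw [H]; simp only [lift2_eq_place]; rw [place_one (by omega), mul_one])
    rwa [gen_one (by omega), mul_one] at this
  have kkk : ∀ p, p + 2 < n → gen A n (bmwK q μ R) p * gen A n (bmwK q μ R) (p + 1) *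
      gen A n (bmwK q μ R) p = gen A n (bmwK q μ R) p := by
    intro p hp
    have := gen_transfer (A := A) hp (bmwK q μ R) (bmwK q μ R) (bmwK q μ R) (bmwK q μ R) 1 1
      0 1 0 0 0 0 (by simp) (by simp) (by simp) (by simp) (by simp) (by simp)
      (by rw [h3]; simp only [lift2_eq_place]; rw [place_one (by omega), mul_one, mul_one])
    simp only [add_zero] at this
    rwa [gen_one (by omega), mul_one, mul_one] at this
  have key := fun p (hp : p + 2 < n) => contractor_relations (sr (p + 1) hp)
    (sr p (by omega)) (gen_bmwK (by omega)) (gen_bmwK hp) (braid p hp) (two h1 p hp) (two h2 p hp)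
    (kkk p hp)
  have far : ∀ X Y : MatV N 2 ℂ, ∀ p p', p + 1 < p' → p' + 1 < n →
      gen A n X p * gen A n Y p' = gen A n Y p' * gen A n X p := fun X Y p p' h h' =>
    gen_far (by omega) h' (Or.inl h) X Y
  exact
    { rs, sr, braid, kkk
      rk := fun p hp => by rw [← gen_mul hp, rk, gen_smul]
      kr := fun p hp => by rw [← gen_mul hp, kr, gen_smul]
      skein := fun p hp => by rw [sk, gen_add, gen_sub, gen_smul, gen_smul, gen_one hp]
      kk := fun p hp => by rw [← gen_mul hp, kk, gen_smul]
      kkk' := fun p hp => (key p hp).1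
      rrk := fun p hp => (key p hp).2.1
      krr := fun p hp => (two h1 p hp).symm
      rrk' := fun p hp => (key p hp).2.2.1
      krr' := fun p hp => (key p hp).2.2.2
      far := far _ _, far_rk := far _ _, far_kr := far _ _, far_kk := far _ _ }

theorem commute_conj {B : Type*} [Monoid B] {u u' a b m : B} (h' : u' * u = 1) (h : u * u' = 1)
    (hs : SemiconjBy u a b) (hc : Commute a m) : Commute b (u * m * u') := by
  have e : a * u' = u' * b := by
    calc a * u' = u' * (u * a) * u' := by rw [← mul_assoc, h', one_mul]
      _ = u' * b * (u * u') := by rw [hs.eq]; simp only [mul_assoc]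
      _ = _ := by rw [h, mul_one]
  calc b * (u * m * u') = (b * u) * m * u' := by simp only [mul_assoc]
    _ = u * (a * m) * u' := by rw [← hs.eq]; simp only [mul_assoc]
    _ = u * m * (a * u') := by rw [hc.eq]; simp only [mul_assoc]
    _ = _ := by rw [e]; simp only [mul_assoc]

theorem gen_Mcopy_high {X F : MatV N 2 ℂ} (hF : IsUnit F.det)
    (hc : lift2 (n := 3) 0 X * lift2 1 F * lift2 0 F = lift2 1 F * lift2 0 F * lift2 1 X)
    (M : Matrix (Fin N) (Fin N) A) {n p : ℕ} :
    ∀ {j : ℕ}, p + 2 ≤ j → j < n → Commute (gen A n X p) (Mcopy F M j)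
  | 0, h, _ => by omega
  | j + 1, h, hn => by
    rcases Nat.lt_or_ge j (p + 2) with hj | hj
    · obtain rfl : j = p + 1 := by omega
      have e1 := gen_transfer (A := A) hn X F F F F X 0 1 0 1 0 1 (by simp) (by simp) (by simp)
        (by simp) (by simp) (by simp) hc
      obtain ⟨i1, i2⟩ := gen_inv (A := A) (show p + 1 < n by omega) hF
      obtain ⟨i3, i4⟩ := gen_inv (A := A) (show p + 1 + 1 < n by omega) hF
      have hs : SemiconjBy (gen A n F (p + 1) * gen A n F p) (gen A n X (p + 1)) (gen A n X p) := by
        rw [SemiconjBy, ← mul_assoc]; exact e1.symm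
      have := commute_conj (u' := gen A n F⁻¹ p * gen A n F⁻¹ (p + 1))
        (by rw [mul_assoc, ← mul_assoc _ (gen A n F (p + 1)), i4, one_mul, i2])
        (by rw [mul_assoc, ← mul_assoc _ (gen A n F⁻¹ p), i1, one_mul, i3]) hs
        (gen_Mcopy_low X F M (show p + 1 + 1 < n by omega) (show p < p + 1 by omega))
      rw [Mcopy_succ, Mcopy_succ]
      simpa only [mul_assoc] using this
    · rw [Mcopy_succ]
      have c1 : Commute (gen A n X p) (gen A n F j) :=
        gen_far (by omega) (by omega) (by omega) X F
      have c2 : Commute (gen A n X p) (gen A n F⁻¹ j) :=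
        gen_far (by omega) (by omega) (by omega) X F⁻¹
      exact (c1.mul_right (gen_Mcopy_high hF hc M hj (by omega))).mul_right c2

theorem Mcopy_two_succ {F : MatV N 2 ℂ} (hF : IsUnit F.det) (hb : IsBraid F)
    (M : Matrix (Fin N) (Fin N) A) {n p : ℕ} (h : p + 2 < n) :
    (Mcopy F M (p + 1) * Mcopy F M (p + 2) : MatV N n A) = gen A n F p * gen A n F (p + 1) *
      (Mcopy F M p * Mcopy F M (p + 1)) * (gen A n F⁻¹ (p + 1) * gen A n F⁻¹ p) := by
  obtain ⟨i1, i2⟩ := gen_inv (A := A) (show p + 1 < n by omega) hF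
  obtain ⟨i3, i4⟩ := gen_inv (A := A) (show p + 1 + 1 < n by omega) hF
  have hb1 := gen_transfer (A := A) h F F F F F F 0 1 0 1 0 1 (by simp) (by simp) (by simp)
    (by simp) (by simp) (by simp) hb
  simp only [add_zero] at hb1
  have hb2 : gen A n F⁻¹ p * gen A n F⁻¹ (p + 1) * gen A n F⁻¹ p =
      gen A n F⁻¹ (p + 1) * gen A n F⁻¹ p * gen A n F⁻¹ (p + 1) := by
    refine left_inv_eq_right_inv (a := gen A n F p * gen A n F (p + 1) * gen A n F p) ?_ ?_
    · simp only [mul_assoc]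
      rw [← mul_assoc _ (gen A n F p), i2, one_mul, ← mul_assoc _ (gen A n F (p + 1)), i4,
        one_mul, i2]
    · rw [hb1]
      simp only [mul_assoc]
      rw [← mul_assoc _ (gen A n F⁻¹ (p + 1)), i3, one_mul, ← mul_assoc _ (gen A n F⁻¹ p), i1,
        one_mul, i3]
  have low := gen_Mcopy_low F F M (show p + 1 + 1 < n by omega) (show p < p + 1 by omega)
  have e1 : gen A n F p * gen A n F (p + 1) * Mcopy F M p * (gen A n F⁻¹ (p + 1) * gen A n F⁻¹ p) =
      Mcopy F M (p + 1) := by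
    rw [mul_assoc (gen A n F p), low, mul_assoc, mul_assoc, ← mul_assoc _ _ (gen A n F⁻¹ p), i3,
      one_mul, ← mul_assoc, Mcopy_succ]
  have e2 : gen A n F p * gen A n F (p + 1) * Mcopy F M (p + 1) *
      (gen A n F⁻¹ (p + 1) * gen A n F⁻¹ p) = Mcopy F M (p + 2) := by
    calc _ = gen A n F p * gen A n F (p + 1) * gen A n F p * Mcopy F M p *
          (gen A n F⁻¹ p * gen A n F⁻¹ (p + 1) * gen A n F⁻¹ p) := by
            rw [Mcopy_succ]; simp only [mul_assoc]
      _ = gen A n F (p + 1) * gen A n F p * (gen A n F (p + 1) * Mcopy F M p) *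
          gen A n F⁻¹ (p + 1) * gen A n F⁻¹ p * gen A n F⁻¹ (p + 1) := by
            rw [hb1, hb2]; simp only [mul_assoc]
      _ = gen A n F (p + 1) * gen A n F p * Mcopy F M p * (gen A n F (p + 1) *
          gen A n F⁻¹ (p + 1)) * gen A n F⁻¹ p * gen A n F⁻¹ (p + 1) := by
            rw [low]; simp only [mul_assoc]
      _ = _ := by rw [i3, mul_one, Mcopy_succ, Mcopy_succ]; simp only [mul_assoc]
  have hu : gen A n F⁻¹ (p + 1) * gen A n F⁻¹ p * (gen A n F p * gen A n F (p + 1)) = 1 := by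
    rw [mul_assoc, ← mul_assoc _ (gen A n F p), i2, one_mul, i4]
  calc (Mcopy F M (p + 1) * Mcopy F M (p + 2) : MatV N n A)
    _ = (gen A n F p * gen A n F (p + 1) * Mcopy F M p * (gen A n F⁻¹ (p + 1) * gen A n F⁻¹ p)) *
        (gen A n F p * gen A n F (p + 1) * Mcopy F M (p + 1) *
          (gen A n F⁻¹ (p + 1) * gen A n F⁻¹ p)) := by rw [e1, e2]
    _ = gen A n F p * gen A n F (p + 1) * Mcopy F M p *
        ((gen A n F⁻¹ (p + 1) * gen A n F⁻¹ p) * (gen A n F p * gen A n F (p + 1))) *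
        (Mcopy F M (p + 1) * (gen A n F⁻¹ (p + 1) * gen A n F⁻¹ p)) := by simp only [mul_assoc]
    _ = _ := by rw [hu, mul_one]; simp only [mul_assoc]

theorem gen_Mcopy_mid {R F : MatV N 2 ℂ} (hF : IsUnit F.det) (hb : IsBraid F)
    (hc : Compatible R F) {M : Matrix (Fin N) (Fin N) A} (hM : QMArel R F M) {n : ℕ} :
    ∀ {p : ℕ}, p + 1 < n → Commute (gen A n R p) (Mcopy F M p * Mcopy F M (p + 1))
  | 0, h => by
    have := congrArg (fun W => (place 0 W : MatV N n A)) hM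
    have hn : 0 + 2 ≤ n := by omega
    have e0 : (place 0 (Mcopy F M 0 : MatV N 2 A) : MatV N n A) = Mcopy F M 0 := by
      rw [Mcopy, Mcopy, lift1_zero_eq_place, lift1_zero_eq_place, place_place hn (by omega)]
    have e1 : (place 0 (Mcopy F M 1 : MatV N 2 A) : MatV N n A) = Mcopy F M 1 := by
      rw [Mcopy_succ, Mcopy_succ, place_mul hn, place_mul hn, place_gen (by omega) hn,
        place_gen (by omega) hn, e0]
    simp only [place_mul hn, e0, e1, ← gen.eq_1, place_gen (show 0 + 1 < 2 by omega) hn] at this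
    rw [mul_assoc] at this
    exact this
  | p + 1, h => by
    obtain ⟨i1, i2⟩ := gen_inv (A := A) (show p + 1 < n by omega) hF
    obtain ⟨i3, i4⟩ := gen_inv (A := A) (show p + 1 + 1 < n by omega) hF
    rw [Mcopy_two_succ hF hb M h]
    have hs := gen_transfer (A := A) h R F F F F R 1 0 1 0 1 0 (by simp) (by simp) (by simp)
      (by simp) (by simp) (by simp) hc.2
    simp only [add_zero] at hs
    refine commute_conj ?_ ?_ (a := gen A n R p) ?_ (gen_Mcopy_mid hF hb hc hM (by omega))
    · rw [mul_assoc, ← mul_assoc _ (gen A n F p), i2, one_mul, i4]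
    · rw [mul_assoc, ← mul_assoc _ (gen A n F⁻¹ (p + 1)), i3, one_mul, i1]
    · rw [SemiconjBy, ← mul_assoc, hs]

theorem gen_Mprod {R F : MatV N 2 ℂ} (hF : IsUnit F.det) (hb : IsBraid F)
    (hc : Compatible R F) {M : Matrix (Fin N) (Fin N) A} (hM : QMArel R F M) {n p : ℕ} :
    ∀ {j : ℕ}, p + 2 ≤ j → j ≤ n → Commute (gen A n R p) (Mprod F M j)
  | 0, h, _ => by omega
  | j + 1, h, hn => by
    rcases Nat.lt_or_ge j (p + 2) with hj | hj
    · obtain rfl : j = p + 1 := by omega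
      have low : ∀ i, i ≤ p → Commute (gen A n R p) (Mprod F M i) := by
        intro i
        induction i with
        | zero => exact fun _ => Commute.one_right _
        | succ i ih =>
          intro hi
          exact (ih (by omega)).mul_right (gen_Mcopy_low R F M (by omega) (by omega))
      rw [Mprod, Mprod, mul_assoc]
      exact (low p le_rfl).mul_right (gen_Mcopy_mid hF hb hc hM (by omega))
    · exact (gen_Mprod hF hb hc hM hj (by omega)).mul_right
        (gen_Mcopy_high hF hc.1 M hj (by omega))

end Generators

section Shift

variable {N : ℕ} [NeZero N] {A : Type*} [Ring A] [Algebra ℂ A]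

/-- The scalar operator `c · 1` on `V^{⊗ n}`. -/
def scal (N n : ℕ) (c : A) : MatV N n A := Matrix.diagonal fun _ => c

theorem ext1_scal {n : ℕ} (c : A) : ext1 (scal N n c) = scal N (n + 1) c := by
  ext a b
  have : a = b ↔ a (Fin.last n) = b (Fin.last n) ∧
      (fun t : Fin n => a t.castSucc) = fun t => b t.castSucc := by
    refine ⟨fun h => h ▸ ⟨rfl, rfl⟩, fun h => funext fun t => ?_⟩
    exact Fin.lastCases h.1 (fun t => congrFun h.2 t) t
  simp only [ext1, scal, Matrix.diagonal_apply, this, ← ite_and]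

theorem cmap_commute_scal {n : ℕ} (X : MatV N n ℂ) (c : A) :
    Commute (cmap X : MatV N n A) (scal N n c) := by
  ext a b
  rw [scal, Matrix.mul_diagonal, Matrix.diagonal_mul, cmap_comm_entry]

theorem gen_commute_scal {n p : ℕ} (X : MatV N 2 ℂ) (c : A) :
    Commute (gen A n X p) (scal N n c) := cmap_commute_scal _ c

/-- The product of the generators at positions `0, …, j - 1`. -/
def chain (A : Type*) [Ring A] [Algebra ℂ A] (n : ℕ) (F : MatV N 2 ℂ) : ℕ → MatV N n A
  | 0 => 1
  | j + 1 => chain A n F j * gen A n F j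

/-- The product of the generators at positions `j - 1, …, 0`. -/
def chainRev (A : Type*) [Ring A] [Algebra ℂ A] (n : ℕ) (F : MatV N 2 ℂ) : ℕ → MatV N n A
  | 0 => 1
  | j + 1 => gen A n F j * chainRev A n F j

theorem chain_mul_chainRev {F : MatV N 2 ℂ} (hF : IsUnit F.det) {n : ℕ} :
    ∀ {j : ℕ}, j < n → chain A n F j * chainRev A n F⁻¹ j = 1 ∧
      chainRev A n F⁻¹ j * chain A n F j = 1
  | 0, _ => ⟨mul_one _, mul_one _⟩
  | j + 1, h => by
    obtain ⟨h1, h2⟩ := chain_mul_chainRev hF (show j < n by omega)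
    obtain ⟨h3, h4⟩ := gen_inv (A := A) h hF
    rw [chain, chainRev]
    constructor
    · rw [mul_assoc, ← mul_assoc (gen A n F j), h3, one_mul, h1]
    · rw [mul_assoc, ← mul_assoc (chainRev A n F⁻¹ j), h2, one_mul, h4]

theorem ext1_chain (F : MatV N 2 ℂ) {n : ℕ} : ∀ {j : ℕ}, j < n →
    ext1 (chain A n F j) = chain A (n + 1) F j
  | 0, _ => ext1_one
  | j + 1, h => by rw [chain, chain, ext1_mul, ext1_chain F (by omega), ext1_gen h]

theorem ext1_chainRev (F : MatV N 2 ℂ) {n : ℕ} : ∀ {j : ℕ}, j < n →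
    ext1 (chainRev A n F j) = chainRev A (n + 1) F j
  | 0, _ => ext1_one
  | j + 1, h => by rw [chainRev, chainRev, ext1_mul, ext1_chainRev F (by omega), ext1_gen h]

/-- The endomorphism-shifting map `Z ↦ F₁ ⋯ F_n Z F_n⁻¹ ⋯ F₁⁻¹`. -/
def shift (F : MatV N 2 ℂ) (n : ℕ) (Z : MatV N n A) : MatV N (n + 1) A :=
  chain A (n + 1) F n * ext1 Z * chainRev A (n + 1) F⁻¹ n

theorem shift_zero_strands (F : MatV N 2 ℂ) (Z : MatV N 0 A) : shift F 0 Z = ext1 Z := by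
  rw [shift, chain, chainRev, one_mul, mul_one]

theorem shift_mul {F : MatV N 2 ℂ} (hF : IsUnit F.det) {n : ℕ} (X Y : MatV N n A) :
    shift F n (X * Y) = shift F n X * shift F n Y := by
  obtain ⟨_, h⟩ := chain_mul_chainRev (A := A) hF (show n < n + 1 by omega)
  simp only [shift, ext1_mul]
  rw [← mul_assoc (_ * _ * _), ← mul_assoc (_ * _ * _), mul_assoc (_ * ext1 X), h, mul_one]
  simp only [mul_assoc]

theorem shift_one {F : MatV N 2 ℂ} (hF : IsUnit F.det) {n : ℕ} :
    shift F n (1 : MatV N n A) = 1 := by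
  rw [shift, ext1_one, mul_one, (chain_mul_chainRev hF (by omega)).1]

theorem ext1_add {n : ℕ} (X Y : MatV N n A) : ext1 (X + Y) = ext1 X + ext1 Y := by
  simp only [ext1_eq_place, place_add]

theorem ext1_smul {n : ℕ} (c : ℂ) (X : MatV N n A) : ext1 (c • X) = c • ext1 X := by
  simp only [ext1_eq_place, place_smul]

theorem shift_add (F : MatV N 2 ℂ) {n : ℕ} (X Y : MatV N n A) :
    shift F n (X + Y) = shift F n X + shift F n Y := by
  rw [shift, ext1_add, mul_add, add_mul]; rfl

theorem shift_smul (F : MatV N 2 ℂ) {n : ℕ} (c : ℂ) (X : MatV N n A) :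
    shift F n (c • X) = c • shift F n X := by
  rw [shift, ext1_smul, mul_smul_comm, smul_mul_assoc]; rfl

theorem shift_sub (F : MatV N 2 ℂ) {n : ℕ} (X Y : MatV N n A) :
    shift F n (X - Y) = shift F n X - shift F n Y := by
  rw [shift, show ext1 (X - Y) = ext1 X - ext1 Y by simp only [ext1_eq_place, place_sub], mul_sub,
    sub_mul]
  rfl

theorem chain_commute_scal (F : MatV N 2 ℂ) {n : ℕ} (c : A) : ∀ j : ℕ,
    Commute (chain A n F j) (scal N n c)
  | 0 => Commute.one_left _
  | j + 1 => (chain_commute_scal F c j).mul_left (gen_commute_scal F c)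

theorem shift_scal {F : MatV N 2 ℂ} (hF : IsUnit F.det) {n : ℕ} (c : A) :
    shift F n (scal N n c) = scal N (n + 1) c := by
  rw [shift, ext1_scal, (chain_commute_scal F c n).eq, mul_assoc,
    (chain_mul_chainRev hF (by omega)).1, mul_one]

theorem ptr_shift {R Ψ F : MatV N 2 ℂ} (h : SkewPair R Ψ) (hF : IsUnit F.det)
    (hc : lift2 (n := 3) 1 R * lift2 0 F * lift2 1 F = lift2 0 F * lift2 1 F * lift2 0 R)
    {n : ℕ} (Z : MatV N (n + 1) A) :
    ptr (Dof Ψ) (shift F (n + 1) Z) = shift F n (ptr (Dof Ψ) Z) := by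
  rw [shift, chain, chainRev, ← ext1_chain F (by omega), ← ext1_chainRev F⁻¹ (by omega)]
  simp only [mul_assoc]
  rw [ptr_ext1_mul, ← mul_assoc, ← mul_assoc, ptr_mul_ext1,
    ptr_conj h (Matrix.nonsing_inv_mul F hF) (Matrix.mul_nonsing_inv F hF) hc, shift, ← mul_assoc]

theorem gen_mul_chain {X F : MatV N 2 ℂ}
    (hc : lift2 (n := 3) 1 X * lift2 0 F * lift2 1 F = lift2 0 F * lift2 1 F * lift2 0 X)
    {n p : ℕ} : ∀ {j : ℕ}, p + 2 ≤ j → j < n →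
      gen A n X (p + 1) * chain A n F j = chain A n F j * gen A n X p
  | 0, h, _ => by omega
  | j + 1, h, hn => by
    rcases Nat.lt_or_ge j (p + 2) with hj | hj
    · obtain rfl : j = p + 1 := by omega
      have low : ∀ i, i ≤ p → Commute (gen A n X (p + 1)) (chain A n F i) := by
        intro i
        induction i with
        | zero => exact fun _ => Commute.one_right _
        | succ i ih =>
          intro hi
          exact (ih (by omega)).mul_right (gen_far (by omega) (by omega) (by omega) X F)
      have e1 := gen_transfer (A := A) (show p + 2 < n by omega) X F F F F X 1 0 1 0 1 0 (by simp)
        (by simp) (by simp) (by simp) (by simp) (by simp) hc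
      simp only [add_zero] at e1
      rw [chain, chain, ← mul_assoc, ← mul_assoc, (low p le_rfl).eq, mul_assoc (chain A n F p),
        mul_assoc (chain A n F p), e1]
      simp only [mul_assoc]
    · rw [chain, ← mul_assoc, gen_mul_chain hc hj (by omega), mul_assoc, mul_assoc,
        gen_far (by omega) (by omega) (by omega) X F]

theorem shift_gen {X F : MatV N 2 ℂ} (hF : IsUnit F.det)
    (hc : lift2 (n := 3) 1 X * lift2 0 F * lift2 1 F = lift2 0 F * lift2 1 F * lift2 0 X)
    {n p : ℕ} (h : p + 1 < n) : shift F n (gen A n X p) = gen A (n + 1) X (p + 1) := by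
  rw [shift, ext1_gen h, ← gen_mul_chain hc (by omega) (by omega), mul_assoc,
    (chain_mul_chainRev hF (by omega)).1, mul_one]

theorem shift_gen_bmwK {q μ : ℂ} {R F : MatV N 2 ℂ} (hF : IsUnit F.det)
    (hc : lift2 (n := 3) 1 R * lift2 0 F * lift2 1 F = lift2 0 F * lift2 1 F * lift2 0 R)
    {n p : ℕ} (h : p + 1 < n) :
    shift F n (gen A n (bmwK q μ R) p) = gen A (n + 1) (bmwK q μ R) (p + 1) := by
  rw [gen_bmwK h, gen_bmwK (by omega), shift_smul, shift_mul hF, shift_sub, shift_add,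
    shift_smul, shift_smul, shift_one hF, shift_gen hF hc h]

theorem shift_Mcopy {F : MatV N 2 ℂ} (hF : IsUnit F.det) (hb : IsBraid F)
    (M : Matrix (Fin N) (Fin N) A) {n j : ℕ} (h : j < n) :
    shift F n (Mcopy F M j : MatV N n A) = Mcopy F M (j + 1) := by
  have e1 : ∀ m, j ≤ m → m < n → chain A (n + 1) F (m + 1) * Mcopy F M j *
      chainRev A (n + 1) F⁻¹ (m + 1) =
        chain A (n + 1) F j * Mcopy F M (j + 1) * chainRev A (n + 1) F⁻¹ j := by
    intro m hm
    induction m, hm using Nat.le_induction with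
    | base => intro _; rw [chain, chainRev, Mcopy_succ]; simp only [mul_assoc]
    | succ m hm ih =>
      intro hn
      rw [← ih (by omega), chain, chainRev, mul_assoc (chain A (n + 1) F (m + 1)),
        gen_Mcopy_low F F M (by omega) (show j < m + 1 by omega)]
      simp only [mul_assoc]
      rw [← mul_assoc (gen A (n + 1) F (m + 1)), (gen_inv (by omega) hF).1, one_mul]
  have e2 : ∀ i, i ≤ j → Commute (chain A (n + 1) F i) (Mcopy F M (j + 1)) := by
    intro i
    induction i with
    | zero => exact fun _ => Commute.one_left _
    | succ i ih =>
      intro hi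
      exact (ih (by omega)).mul_left (gen_Mcopy_high hF hb M (by omega) (by omega))
  obtain ⟨m, rfl⟩ : ∃ m, n = m + 1 := ⟨n - 1, by omega⟩
  rw [shift, ext1_Mcopy F M h, e1 m (by omega) (by omega), (e2 j le_rfl).eq, mul_assoc,
    (chain_mul_chainRev hF (by omega)).1, mul_one]

theorem Mprod_eq_mul_shift {F : MatV N 2 ℂ} (hF : IsUnit F.det) (hb : IsBraid F)
    (M : Matrix (Fin N) (Fin N) A) {n : ℕ} : ∀ {j : ℕ}, j ≤ n →
      (Mprod F M (j + 1) : MatV N (n + 1) A) = lift1 0 M * shift F n (Mprod F M j)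
  | 0, _ => by rw [Mprod, Mprod, Mprod, shift_one hF, one_mul, mul_one, Mcopy]
  | j + 1, h => by
    rw [Mprod, Mprod_eq_mul_shift hF hb M (show j ≤ n by omega), Mprod, shift_mul hF,
      shift_Mcopy hF hb M (by omega), mul_assoc]

end Shift

section PartialTraces

variable {N : ℕ} [NeZero N] {A : Type*} [Ring A] [Algebra ℂ A]

/-- A quantum matrix `M` for a compatible pair `{R, F}` with `R` of BMW type. -/
structure BMWQuantumMatrix (q μ : ℂ) (R F Ψ : MatV N 2 ℂ) (M : Matrix (Fin N) (Fin N) A) :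
    Prop where
  q_ne : q ≠ 0
  lam_ne : q - q⁻¹ ≠ 0
  mu_ne : μ ≠ 0
  mu_ne_left : q - μ ≠ 0
  mu_ne_right : q⁻¹ + μ ≠ 0
  braid : IsBraid R
  det : IsUnit R.det
  braid' : IsBraid F
  det' : IsUnit F.det
  compatible : Compatible R F
  skew : SkewPair R Ψ
  bmw : IsBMW q μ R
  rel : QMArel R F M

/-- The subalgebra generated by the copies of `R` at the positions `≥ o`. -/
def genAlg (A : Type*) [Ring A] [Algebra ℂ A] (R : MatV N 2 ℂ) (n o : ℕ) :
    Subalgebra ℂ (MatV N n A) :=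
  Algebra.adjoin ℂ {X | ∃ p, o ≤ p ∧ p + 1 < n ∧ X = gen A n R p}

theorem gen_mem_genAlg (R : MatV N 2 ℂ) {n o p : ℕ} (h : o ≤ p) (hp : p + 1 < n) :
    gen A n R p ∈ genAlg A R n o := Algebra.subset_adjoin ⟨p, h, hp, rfl⟩

theorem gen_bmwK_mem_genAlg (q μ : ℂ) (R : MatV N 2 ℂ) {n o p : ℕ} (h : o ≤ p) (hp : p + 1 < n) :
    gen A n (bmwK q μ R) p ∈ genAlg A R n o := by
  have h0 := gen_mem_genAlg (A := A) R h hp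
  rw [gen_bmwK hp]
  exact Subalgebra.smul_mem _ (Subalgebra.mul_mem _
    (Subalgebra.sub_mem _ (Subalgebra.smul_mem _ (Subalgebra.one_mem _) _) h0)
    (Subalgebra.add_mem _ (Subalgebra.smul_mem _ (Subalgebra.one_mem _) _) h0)) _

theorem genAlg_mono (R : MatV N 2 ℂ) {n o o' : ℕ} (h : o ≤ o') :
    genAlg A R n o' ≤ genAlg A R n o :=
  Algebra.adjoin_mono fun _ ⟨p, hp, hn, e⟩ => ⟨p, h.trans hp, hn, e⟩

theorem trTail_add {n : ℕ} (D : Matrix (Fin N) (Fin N) ℂ) (X Y : MatV N (n + 1) A) :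
    trTail (cmap D) n (X + Y) = trTail (cmap D) n X + trTail (cmap D) n Y := by
  induction n with
  | zero => rfl
  | succ n ih => rw [trTail, trTail, trTail, ← ih]; exact congrArg _ (ptr_add D X Y)

theorem trTail_smul {n : ℕ} (D : Matrix (Fin N) (Fin N) ℂ) (c : ℂ) (X : MatV N (n + 1) A) :
    trTail (cmap D) n (c • X) = c • trTail (cmap D) n X := by
  induction n with
  | zero => rfl
  | succ n ih => rw [trTail, trTail, ← ih]; exact congrArg _ (ptr_smul D c X)

theorem trTail_mul_scal {n : ℕ} (D : Matrix (Fin N) (Fin N) ℂ) (X : MatV N (n + 1) A) (c : A) :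
    trTail (cmap D) n (X * scal N (n + 1) c) = trTail (cmap D) n X * scal N 1 c := by
  induction n with
  | zero => rfl
  | succ n ih =>
    rw [trTail, trTail, ← ih, ← ext1_scal]; exact congrArg _ (ptr_mul_ext1 D _ X)

theorem trTail_lift1_mul {n : ℕ} (D : Matrix (Fin N) (Fin N) ℂ) (M : Matrix (Fin N) (Fin N) A)
    (X : MatV N (n + 1) A) :
    trTail (cmap D) n (lift1 0 M * X) = lift1 0 M * trTail (cmap D) n X := by
  induction n with
  | zero => rfl
  | succ n ih =>
    rw [trTail, trTail, ← ih, ← ext1_lift1 (by omega)]; exact congrArg _ (ptr_ext1_mul D _ X)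

/-- The linear functional `X ↦ Tr_{R(2, …, n+1)}(M_{(1)} ⋯ M_{(n+1)} X)`. -/
def theta (F Ψ : MatV N 2 ℂ) (M : Matrix (Fin N) (Fin N) A) (n : ℕ) :
    MatV N (n + 1) A →ₗ[ℂ] MatV N 1 A where
  toFun X := trTail (cmap (Dof Ψ)) n (Mprod F M (n + 1) * X)
  map_add' X Y := by rw [mul_add, trTail_add]
  map_smul' c X := by rw [mul_smul_comm, trTail_smul]; rfl

theorem theta_apply (F Ψ : MatV N 2 ℂ) (M : Matrix (Fin N) (Fin N) A) (n : ℕ)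
    (X : MatV N (n + 1) A) :
    theta F Ψ M n X = trTail (cmap (Dof Ψ)) n (Mprod F M (n + 1) * X) := rfl

/-- The map `Z ↦ Tr_{R(2)}(F₁ Z₁ F₁⁻¹ Y₁)`. -/
def phiB (F Ψ Y : MatV N 2 ℂ) : MatV N 1 A →ₗ[ℂ] MatV N 1 A where
  toFun Z := ptr (Dof Ψ) (shift F 1 Z * gen A 2 Y 0)
  map_add' X Z := by rw [shift_add, add_mul, ptr_add]
  map_smul' c X := by rw [shift_smul, smul_mul_assoc, ptr_smul]; rfl

theorem phiB_apply (F Ψ Y : MatV N 2 ℂ) (Z : MatV N 1 A) :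
    phiB F Ψ Y Z = ptr (Dof Ψ) (shift F 1 Z * gen A 2 Y 0) := rfl

theorem phiB_mul_scal {F : MatV N 2 ℂ} (hF : IsUnit F.det) (Ψ Y : MatV N 2 ℂ) (Z : MatV N 1 A)
    (c : A) : phiB F Ψ Y (Z * scal N 1 c) = phiB F Ψ Y Z * scal N 1 c := by
  rw [phiB_apply, phiB_apply, shift_mul hF, shift_scal hF, mul_assoc,
    ← (gen_commute_scal Y c).eq, ← mul_assoc, ← ext1_scal, ptr_mul_ext1]

variable {q μ : ℂ} {R F Ψ : MatV N 2 ℂ} {M : Matrix (Fin N) (Fin N) A}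

namespace BMWQuantumMatrix

theorem bmwRel (h : BMWQuantumMatrix q μ R F Ψ M) (n : ℕ) :
    BMWRel q μ n (gen A n R) (gen A n R⁻¹) (gen A n (bmwK q μ R)) :=
  gen_bmwRel h.q_ne h.lam_ne h.mu_ne h.braid h.det h.bmw n

theorem commute_dd (h : BMWQuantumMatrix q μ R F Ψ M) : Commute (dd (Dof Ψ)) R := by
  have h1 : R * R⁻¹ = 1 := Matrix.mul_nonsing_inv R h.det
  have h2 : R⁻¹ * R = 1 := Matrix.nonsing_inv_mul R h.det
  have h0 := dd_commute h.skew h.braid h1 h2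
  calc dd (Dof Ψ) * R = R * (R⁻¹ * dd (Dof Ψ)) * R := by rw [← mul_assoc, h1, one_mul]
    _ = R * dd (Dof Ψ) * (R⁻¹ * R) := by rw [← h0.eq]; simp only [mul_assoc]
    _ = _ := by rw [h2, mul_one]

theorem commute_dd_bmwK (h : BMWQuantumMatrix q μ R F Ψ M) :
    Commute (dd (Dof Ψ)) (bmwK q μ R) :=
  ((((Commute.one_right _).smul_right q).sub_right h.commute_dd).mul_right
    (((Commute.one_right _).smul_right q⁻¹).add_right h.commute_dd)).smul_right _

theorem theta_cyclic (h : BMWQuantumMatrix q μ R F Ψ M) {n : ℕ} {Y : MatV N (n + 1) A}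
    (hY : Y ∈ genAlg A R (n + 1) 1) (X : MatV N (n + 1) A) :
    theta F Ψ M n (Y * X) = theta F Ψ M n (X * Y) := by
  induction hY using Algebra.adjoin_induction generalizing X with
  | mem Y hY =>
    obtain ⟨p, h1, hp, rfl⟩ := hY
    rw [theta_apply, theta_apply, ← mul_assoc,
      ← (gen_Mprod h.det' h.braid' h.compatible h.rel (by omega) le_rfl).eq, mul_assoc,
      trTail_cyclic h.commute_dd h1 (by omega), mul_assoc]
  | algebraMap c => rw [Algebra.commutes]
  | add Y Z _ _ hY hZ => rw [add_mul, mul_add, map_add, map_add, hY, hZ]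
  | mul Y Z _ _ hY hZ => rw [mul_assoc, hY, mul_assoc, hZ, mul_assoc]

theorem shift_r (h : BMWQuantumMatrix q μ R F Ψ M) {n p : ℕ} (hp : p + 1 < n) :
    shift F n (gen A n R p) = gen A (n + 1) R (p + 1) := shift_gen h.det' h.compatible.2 hp

theorem shift_k (h : BMWQuantumMatrix q μ R F Ψ M) {n p : ℕ} (hp : p + 1 < n) :
    shift F n (gen A n (bmwK q μ R) p) = gen A (n + 1) (bmwK q μ R) (p + 1) :=
  shift_gen_bmwK h.det' h.compatible.2 hp

theorem ptr_shift (h : BMWQuantumMatrix q μ R F Ψ M) {n : ℕ} (Z : MatV N (n + 1) A) :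
    ptr (Dof Ψ) (shift F (n + 1) Z) = shift F n (ptr (Dof Ψ) Z) :=
  QMA.ptr_shift h.skew h.det' h.compatible.2 Z

theorem trTail_shift (h : BMWQuantumMatrix q μ R F Ψ M) :
    ∀ (n : ℕ) (Y : MatV N n A), trTail (cmap (Dof Ψ)) n (shift F n Y) =
      scal N 1 (trAll (cmap (Dof Ψ)) n Y)
  | 0, Y => by
    rw [trTail, shift_zero_strands, trAll, ← ext1_scal]
    congr 1
    ext a b
    rw [scal, Subsingleton.elim a (fun i => i.elim0), Subsingleton.elim b (fun i => i.elim0),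
      Matrix.diagonal_apply_eq]
  | n + 1, Y => by
    rw [trTail, trAll, ← trTail_shift h n]
    exact congrArg _ (h.ptr_shift Y)

theorem theta_shift (h : BMWQuantumMatrix q μ R F Ψ M) {n : ℕ} (X : MatV N (n + 1) A) :
    theta F Ψ M (n + 1) (shift F (n + 1) X) =
      lift1 0 M * scal N 1 (trAll (cmap (Dof Ψ)) (n + 1) (Mprod F M (n + 1) * X)) := by
  rw [theta_apply, Mprod_eq_mul_shift h.det' h.braid' M le_rfl, mul_assoc, ← shift_mul h.det',
    trTail_lift1_mul, h.trTail_shift]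

theorem trTail_shift_mul_gen (h : BMWQuantumMatrix q μ R F Ψ M) (Y : MatV N 2 ℂ) :
    ∀ {n : ℕ} (W : MatV N (n + 1) A),
      trTail (cmap (Dof Ψ)) (n + 1) (shift F (n + 1) W * gen A (n + 2) Y 0) =
        phiB F Ψ Y (trTail (cmap (Dof Ψ)) n W)
  | 0, W => rfl
  | n + 1, W => by
    have e : ptr (Dof Ψ) (shift F (n + 2) W * gen A (n + 3) Y 0) =
        shift F (n + 1) (ptr (Dof Ψ) W) * gen A (n + 2) Y 0 := by
      rw [← ext1_gen (by omega), ptr_mul_ext1, h.ptr_shift]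
    exact (congrArg (trTail (cmap (Dof Ψ)) (n + 1)) e).trans (h.trTail_shift_mul_gen Y (ptr _ W))

theorem theta_shift_mul_gen (h : BMWQuantumMatrix q μ R F Ψ M) (Y : MatV N 2 ℂ) {n : ℕ}
    (X : MatV N (n + 1) A) :
    theta F Ψ M (n + 1) (shift F (n + 1) X * gen A (n + 2) Y 0) =
      lift1 0 M * phiB F Ψ Y (theta F Ψ M n X) := by
  rw [theta_apply, Mprod_eq_mul_shift h.det' h.braid' M le_rfl, mul_assoc,
    ← mul_assoc (shift _ _ _),
    ← shift_mul h.det', trTail_lift1_mul, h.trTail_shift_mul_gen, theta_apply]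

theorem phiB_one (h : BMWQuantumMatrix q μ R F Ψ M) : phiB F Ψ R (1 : MatV N 1 A) = 1 := by
  rw [phiB_apply, shift_one h.det', one_mul, ptr_last_gen h.skew]

theorem contract_last (h : BMWQuantumMatrix q μ R F Ψ M) : ∀ n : ℕ,
    ptr (Dof Ψ) (ptr (Dof Ψ) (Mcopy F M n * Mcopy F M (n + 1) *
      gen A (n + 2) (bmwK q μ R) n : MatV N (n + 2) A)) =
      ((q - μ) * (q⁻¹ + μ) / ((q - q⁻¹) * μ)) • scal N n (gElt q μ R F Ψ M)
  | 0 => by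
    have h1 := h.mu_ne
    have h2 := h.lam_ne
    have h3 := h.mu_ne_left
    have h4 := h.mu_ne_right
    ext a b
    rw [scal, Matrix.smul_apply, Subsingleton.elim a (fun i => i.elim0),
      Subsingleton.elim b (fun i => i.elim0), Matrix.diagonal_apply_eq, gElt, smul_smul,
      div_mul_div_comm, mul_comm μ, mul_comm ((q - μ) * _), div_self, one_smul]
    · rw [Mprod, Mprod, Mprod, one_mul]; rfl
    · exact mul_ne_zero (mul_ne_zero h2 h1) (mul_ne_zero h3 h4)
  | n + 1 => by
    rw [← shift_Mcopy h.det' h.braid' M (by omega), ← shift_Mcopy h.det' h.braid' M (by omega),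
      ← h.shift_k (by omega), ← shift_mul h.det', ← shift_mul h.det', h.ptr_shift, h.ptr_shift,
      h.contract_last n, shift_smul, shift_scal h.det']

theorem commute_Mcopy (h : BMWQuantumMatrix q μ R F Ψ M) {n : ℕ} {X : MatV N (n + 1) A}
    (hX : X ∈ genAlg A R (n + 1) 0) :
    Commute (ext1 (ext1 X)) (Mcopy F M (n + 1) * Mcopy F M (n + 2) : MatV N (n + 3) A) := by
  induction hX using Algebra.adjoin_induction with
  | mem X hX =>
    obtain ⟨p, -, hp, rfl⟩ := hX
    rw [ext1_gen hp, ext1_gen (by omega)]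
    exact (gen_Mcopy_high h.det' h.compatible.1 M (by omega) (by omega)).mul_right
      (gen_Mcopy_high h.det' h.compatible.1 M (by omega) (by omega))
  | algebraMap c =>
    rw [Algebra.algebraMap_eq_smul_one, ext1_smul, ext1_smul, ext1_one, ext1_one]
    exact (Commute.one_left _).smul_left c
  | add X Y _ _ hX hY => rw [ext1_add, ext1_add]; exact hX.add_left hY
  | mul X Y _ _ hX hY => rw [ext1_mul, ext1_mul]; exact hX.mul_left hY

theorem theta_contract (h : BMWQuantumMatrix q μ R F Ψ M) {n : ℕ} {X : MatV N (n + 1) A}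
    (hX : X ∈ genAlg A R (n + 1) 0) :
    theta F Ψ M (n + 2) (ext1 (ext1 X) * gen A (n + 3) (bmwK q μ R) (n + 1)) =
      ((q - μ) * (q⁻¹ + μ) / ((q - q⁻¹) * μ)) •
        (theta F Ψ M n X * scal N 1 (gElt q μ R F Ψ M)) := by
  have e : (Mprod F M (n + 3) * (ext1 (ext1 X) * gen A (n + 3) (bmwK q μ R) (n + 1)) :
      MatV N (n + 3) A) = ext1 (ext1 (Mprod F M (n + 1) * X)) *
        (Mcopy F M (n + 1) * Mcopy F M (n + 2) * gen A (n + 3) (bmwK q μ R) (n + 1)) := by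
    rw [Mprod, Mprod, ext1_mul, ext1_mul, ext1_Mprod F M le_rfl, ext1_Mprod F M (by omega),
      mul_assoc (Mprod F M (n + 1)), mul_assoc (Mprod F M (n + 1)), ← mul_assoc (_ * _) (ext1 _),
      ← (h.commute_Mcopy hX).eq]
    simp only [mul_assoc]
  rw [theta_apply, e, theta_apply, ← trTail_mul_scal, ← trTail_smul]
  refine congrArg (trTail (cmap (Dof Ψ)) n) ?_
  calc ptr (Dof Ψ) (ptr (Dof Ψ) _) = _ := by rw [ptr_ext1_mul, ptr_ext1_mul, h.contract_last]
    _ = _ := mul_smul_comm _ _ _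

theorem theta_k_zero (h : BMWQuantumMatrix q μ R F Ψ M) :
    theta F Ψ M 1 (gen A 2 (bmwK q μ R) 0) = μ⁻¹ • scal N 1 (gElt q μ R F Ψ M) := by
  have hbR : lift2 (n := 3) 1 R * lift2 0 R * lift2 1 R = lift2 0 R * lift2 1 R * lift2 0 R :=
    h.braid.symm
  have hδ : (q - μ) * (q⁻¹ + μ) / ((q - q⁻¹) * μ) ≠ 0 :=
    div_ne_zero (mul_ne_zero h.mu_ne_left h.mu_ne_right) (mul_ne_zero h.lam_ne h.mu_ne)
  set δ := (q - μ) * (q⁻¹ + μ) / ((q - q⁻¹) * μ) with hδ'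
  set k₀ : MatV N 2 A := gen A 2 (bmwK q μ R) 0
  set k₁ : MatV N 3 A := gen A 3 (bmwK q μ R) 1 with hk₁
  set W : MatV N 2 A := Mprod F M 2 * k₀ with hW
  have kk : k₀ * k₀ = δ • k₀ := (h.bmwRel 2).kk 0 (by omega)
  have comm : Commute k₀ (Mprod F M 2) := by
    have h0 := gen_Mprod (n := 2) (p := 0) h.det' h.braid' h.compatible h.rel (by omega) le_rfl
    rw [show k₀ = _ from gen_bmwK (by omega)]
    exact ((((Commute.one_left _).smul_left q).sub_left h0).mul_left
      (((Commute.one_left _).smul_left q⁻¹).add_left h0)).smul_left _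
  have hs : shift R 2 k₀ = k₁ := shift_gen_bmwK h.det hbR (by omega)
  have h1 : theta F Ψ M 1 k₀ = ptr (Dof Ψ) W := rfl
  have h2 : ∀ Z : MatV N 1 A, Z = ptr (Dof Ψ) (shift R 1 Z * gen A 2 R 0) := fun Z => by
    rw [shift, chain, chain, chainRev, chainRev, one_mul, mul_one, mul_assoc,
      (gen_inv (by omega) h.det).2, mul_one, ptr_mul_ext1, ptr_last_gen h.skew, one_mul]
  have h3 : W * k₀ = δ • W := by rw [hW, mul_assoc, kk, mul_smul_comm]
  have h4 : W = δ⁻¹ • (k₀ * W) := by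
    rw [hW, ← mul_assoc, comm.eq, mul_assoc, kk, mul_smul_comm, smul_smul, inv_mul_cancel₀ hδ,
      one_smul]
  have h5 : ptr (Dof Ψ) (ptr (Dof Ψ) (shift R 2 W)) = δ • scal N 1 (gElt q μ R F Ψ M) := by
    have : ptr (Dof Ψ) (ptr (Dof Ψ) W) = δ • scal N 0 (gElt q μ R F Ψ M) := by
      rw [← h.contract_last 0, hW, Mprod, Mprod, Mprod, one_mul]
    rw [QMA.ptr_shift h.skew h.det hbR, QMA.ptr_shift h.skew h.det hbR, this, shift_smul,
      shift_scal h.det]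
  have h6 : ptr (Dof Ψ) W = ptr (Dof Ψ) (ptr (Dof Ψ) (shift R 2 W * gen A 3 R 0)) := by
    rw [← ext1_gen (by omega), ptr_mul_ext1, QMA.ptr_shift h.skew h.det hbR]
    exact h2 _
  have h7 : shift R 2 W = δ⁻¹ • (k₁ * shift R 2 W) := by
    conv_lhs => rw [h4, shift_smul, shift_mul h.det, hs]
  have h8 : shift R 2 W * k₁ = δ • shift R 2 W := by
    rw [← hs, ← shift_mul h.det, h3, shift_smul]
  have h9 : k₁ * gen A 3 R 0 * k₁ = μ⁻¹ • k₁ :=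
    ((h.bmwRel 3).three (p := 0) (by omega)).symm.krk h.mu_ne
  have h10 : shift R 2 W = δ⁻¹ • (shift R 2 W * k₁) := by
    rw [h8, smul_smul, inv_mul_cancel₀ hδ, one_smul]
  rw [h1, h6, h7, smul_mul_assoc, ptr_smul, ptr_smul, mul_assoc,
    ptr_ptr_cyclic h.commute_dd_bmwK (shift R 2 W * gen A 3 R 0)]
  rw [h10, smul_mul_assoc, smul_mul_assoc, mul_assoc, mul_assoc, ← mul_assoc k₁, h9, mul_smul_comm,
    h8, ptr_smul, ptr_smul, ptr_smul, ptr_smul, ptr_smul, ptr_smul, h5]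
  simp only [smul_smul]
  congr 1
  field_simp

end BMWQuantumMatrix

end PartialTraces

section GeneratorAntisymmetrizers

theorem map_antisymm {B B' : Type*} [Ring B] [Algebra ℂ B] [Ring B'] [Algebra ℂ B'] (f : B → B')
    (h1 : f 1 = 1) (hm : ∀ x y, f (x * y) = f x * f y) (hs : ∀ (c : ℂ) x, f (c • x) = c • f x)
    (c : ℕ → ℂ) {σ : ℕ → ℕ → B} {σ' : ℕ → ℕ → B'} {o o' i : ℕ}
    (hσ : ∀ t m, t + 1 < i → f (σ (o + t) m) = σ' (o' + t) m) :
    f (antisymm c σ o i) = antisymm c σ' o' i := by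
  induction i using Nat.strong_induction_on with
  | _ i ih =>
    match i with
    | 0 => exact h1
    | 1 => exact h1
    | i + 2 =>
      rw [antisymm, antisymm, hs, hm, hm, ih (i + 1) (by omega) fun t m ht => hσ t m (by omega),
        hσ i (i + 1) (by omega)]

theorem map_baxter {B B' : Type*} [Ring B] [Algebra ℂ B] [Ring B'] [Algebra ℂ B'] (f : B → B')
    (h1 : f 1 = 1) (ha : ∀ x y, f (x + y) = f x + f y) (hs : ∀ (c : ℂ) x, f (c • x) = c • f x)
    (q μ : ℂ) (r k : B) (x : ℂ) : f (baxter q μ r k x) = baxter q μ (f r) (f k) x := by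
  rw [baxter, baxter, ha, ha, hs, hs, h1]

variable {N : ℕ} [NeZero N] {A : Type*} [Ring A] [Algebra ℂ A]

/-- The element `1 + (q^{-2m}-1)/λ R_j + μ(q^{-2m}-1)/(μ+q^{1-2m}) K_j`. -/
def sg (A : Type*) [Ring A] [Algebra ℂ A] (q μ : ℂ) (R : MatV N 2 ℂ) (n j m : ℕ) : MatV N n A :=
  baxter q μ (gen A n R j) (gen A n (bmwK q μ R) j) (q ^ (-(2 * (m : ℤ))))

/-- The antisymmetrizer on the tensor factors `o, …, o + i - 1` of `V^{⊗ n}`. -/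
def anti (A : Type*) [Ring A] [Algebra ℂ A] (q μ : ℂ) (R : MatV N 2 ℂ) (n o i : ℕ) : MatV N n A :=
  antisymm (fun m => q ^ m / nq q (m + 1)) (sg A q μ R n) o i

variable {q μ : ℂ} {R F Ψ : MatV N 2 ℂ} {M : Matrix (Fin N) (Fin N) A}

theorem anti_succ (n o i : ℕ) : anti A q μ R n o (i + 2) = (q ^ (i + 1) / nq q (i + 2)) •
    (anti A q μ R n o (i + 1) * sg A q μ R n (o + i) (i + 1) * anti A q μ R n o (i + 1)) := rfl

theorem ext1_sg {n j m : ℕ} (h : j + 1 < n) : ext1 (sg A q μ R n j m) = sg A q μ R (n + 1) j m := by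
  rw [sg, map_baxter ext1 ext1_one ext1_add ext1_smul, ext1_gen h, ext1_gen h, sg]

theorem ext1_anti {n o i : ℕ} (h : o + i ≤ n) :
    ext1 (anti A q μ R n o i) = anti A q μ R (n + 1) o i :=
  map_antisymm _ ext1_one ext1_mul ext1_smul _ fun _ _ _ => ext1_sg (by omega)

theorem sg_mem {n o j m : ℕ} (h : o ≤ j) (hj : j + 1 < n) :
    sg A q μ R n j m ∈ genAlg A R n o :=
  Subalgebra.add_mem _ (Subalgebra.add_mem _ (Subalgebra.one_mem _)
    (Subalgebra.smul_mem _ (gen_mem_genAlg R h hj) _))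
    (Subalgebra.smul_mem _ (gen_bmwK_mem_genAlg q μ R h hj) _)

theorem anti_mem {n o i : ℕ} (h : o + i ≤ n) : anti A q μ R n o i ∈ genAlg A R n o := by
  induction i using Nat.strong_induction_on with
  | _ i ih =>
    match i with
    | 0 => exact Subalgebra.one_mem _
    | 1 => exact Subalgebra.one_mem _
    | i + 2 =>
      have := ih (i + 1) (by omega) (by omega)
      exact Subalgebra.smul_mem _ (Subalgebra.mul_mem _
        (Subalgebra.mul_mem _ this (sg_mem (by omega) (by omega))) this) _

theorem gen_commute_sg {n p j m : ℕ} (hp : p + 1 < n) (hj : j + 1 < n) (h : p + 1 < j ∨ j + 1 < p)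
    (X : MatV N 2 ℂ) : Commute (gen A n X p) (sg A q μ R n j m) :=
  have hf : ∀ Y : MatV N 2 ℂ, Commute (gen A n X p) (gen A n Y j) := fun Y => gen_far hp hj h X Y
  ((Commute.one_right _).add_right ((hf _).smul_right _)).add_right ((hf _).smul_right _)

theorem gen_commute_anti {n p o i : ℕ} (hp : p + 1 < n) (ho : o + i ≤ n)
    (h : p + 1 < o ∨ o + i ≤ p) (X : MatV N 2 ℂ) : Commute (gen A n X p) (anti A q μ R n o i) :=
  BaxterFamily.commute_antisymm fun _ _ _ _ => gen_commute_sg hp (by omega) (by omega) X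

theorem cmap_baxter {n : ℕ} (r κ : MatV N n ℂ) (x : ℂ) :
    (cmap (baxter q μ r κ x) : MatV N n A) = baxter q μ (cmap r) (cmap κ) x :=
  map_baxter _ cmap_one cmap_add cmap_smul _ _ _ _ _

theorem cmap_asym (hq : q ≠ 0) : ∀ i : ℕ, (cmap (asym q μ R i) : MatV N i A) = anti A q μ R i 0 i
  | 0 => cmap_one
  | 1 => cmap_one
  | i + 2 => by
    rw [asym, anti_succ, cmap_smul, cmap_mul, cmap_mul, cmap_ext1, cmap_asym hq (i + 1),
      ext1_anti (by omega), zero_add, sg, gen, gen, ← cmap_baxter, baxter]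
    congr 7
    rw [sub_eq_add_neg (1 : ℤ), zpow_add₀ hq, zpow_one]
    push_cast
    rfl

theorem anti_cut (hq : q ≠ 0) {k : ℕ} (h : HeightCut q μ R (k + 1)) :
    anti A q μ R (k + 2) 0 (k + 1) * sg A q μ R (k + 2) k (k + 1) *
      anti A q μ R (k + 2) 0 (k + 1) = 0 := by
  rw [← ext1_anti (by omega), ← cmap_asym hq, ← cmap_ext1, sg, gen, gen, ← cmap_baxter,
    ← cmap_mul, ← cmap_mul, baxter, ← cmap_zero]
  refine congrArg cmap (Eq.trans ?_ h)
  rw [sub_eq_add_neg (1 : ℤ), zpow_add₀ hq, zpow_one]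
  push_cast
  rfl

namespace BMWQuantumMatrix

theorem shift_sg (h : BMWQuantumMatrix q μ R F Ψ M) {n j m : ℕ} (hj : j + 1 < n) :
    shift F n (sg A q μ R n j m) = sg A q μ R (n + 1) (j + 1) m := by
  refine (map_baxter (shift F n : MatV N n A → MatV N (n + 1) A) (shift_one h.det') (shift_add F)
    (shift_smul F) q μ _ _ _).trans ?_
  rw [h.shift_r hj, h.shift_k hj, sg]

theorem shift_anti (h : BMWQuantumMatrix q μ R F Ψ M) {n o i : ℕ} (hn : o + i ≤ n) :
    shift F n (anti A q μ R n o i) = anti A q μ R (n + 1) (o + 1) i :=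
  map_antisymm _ (shift_one h.det') (shift_mul h.det') (shift_smul F) _ fun t m _ => by
    rw [h.shift_sg (by omega), show o + t + 1 = o + 1 + t by ring]

variable {k : ℕ}

theorem baxterFamily (h : BMWQuantumMatrix q μ R F Ψ M)
    (hμk : ∀ m : ℕ, 1 ≤ m → m ≤ k → μ + q * q ^ (-(2 * (m : ℤ))) ≠ 0) (n : ℕ) :
    BaxterFamily n k (fun m => 1 - q⁻¹ * ((q ^ (-(2 * (m : ℤ))) - 1) / (q - q⁻¹)))
      (sg A q μ R n) where
  ybe j a b hj ha hb hab := by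
    have e : q ^ (-(2 * ((a + b : ℕ) : ℤ))) = q ^ (-(2 * (a : ℤ))) * q ^ (-(2 * (b : ℤ))) := by
      rw [← zpow_add₀ h.q_ne]; push_cast; ring_nf
    have h0 := hμk (a + b) (by omega) hab
    rw [e] at h0
    simp only [sg, e]
    exact ((h.bmwRel n).three hj).yang_baxter h.q_ne h.lam_ne h.mu_ne (hμk a ha (by omega))
      (hμk b hb (by omega)) h0
  far j j' a b hj hj' :=
    (((Commute.one_left _).add_left
      ((gen_commute_sg (by omega) hj' (by omega) _).smul_left _)).add_left
      ((gen_commute_sg (by omega) hj' (by omega) _).smul_left _))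
  fusion j m hj _ _ := by
    have hb := h.bmwRel n
    simp only [sg, Nat.cast_one, mul_one]
    exact (baxter_fusion h.q_ne h.lam_ne h.mu_ne (by rw [add_comm]; exact h.mu_ne_right)
      (hb.rs j hj) (hb.skein j hj) (hb.rk j hj) (hb.kr j hj) (hb.kk j hj) _).1

theorem absorbs_and_symm (h : BMWQuantumMatrix q μ R F Ψ M)
    (hμk : ∀ m : ℕ, 1 ≤ m → m ≤ k → μ + q * q ^ (-(2 * (m : ℤ))) ≠ 0)
    (hqk : ∀ m : ℕ, 1 ≤ m → m ≤ k → nq q m ≠ 0) (n : ℕ) {i : ℕ} (hi : i ≤ k) :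
    BaxterFamily.Absorbs (fun m => q ^ m / nq q (m + 1)) (sg A q μ R n) n i ∧
      (∀ o, 1 ≤ i → o + i + 1 ≤ n →
      anti A q μ R n o i * sg A q μ R n (o + i - 1) i * anti A q μ R n o i =
        anti A q μ R n (o + 1) i * sg A q μ R n o i * anti A q μ R n (o + 1) i) := by
  refine (h.baxterFamily hμk n).absorbs_and_symm (fun m _ hm => ?_) hi
  have h1 := hqk (m + 1) (by omega) (by omega)
  have h2 := h.q_ne
  have h3 := h.lam_ne
  have h4 : q ^ m ≠ 0 := pow_ne_zero _ h2
  have e : 1 - q⁻¹ * ((q ^ (-(2 * (m : ℤ))) - 1) / (q - q⁻¹)) = (q ^ m)⁻¹ * nq q (m + 1) := by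
    have h5 : q ^ 2 - 1 ≠ 0 := by
      intro h0; apply h3; field_simp; simpa using h0
    rw [nq, show -(2 * (m : ℤ)) = -(m : ℤ) + -(m : ℤ) by ring, zpow_add₀ h2, _root_.zpow_neg,
      _root_.zpow_neg, zpow_natCast, zpow_natCast]
    field_simp
    ring
  show q ^ m / nq q (m + 1) * (1 - _) = 1
  rw [e]
  field_simp

theorem anti_mul_self (h : BMWQuantumMatrix q μ R F Ψ M)
    (hμk : ∀ m : ℕ, 1 ≤ m → m ≤ k → μ + q * q ^ (-(2 * (m : ℤ))) ≠ 0)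
    (hqk : ∀ m : ℕ, 1 ≤ m → m ≤ k → nq q m ≠ 0) {n o i : ℕ} (hi : i ≤ k) (hn : o + i ≤ n) :
    anti A q μ R n o i * anti A q μ R n o i = anti A q μ R n o i :=
  (h.absorbs_and_symm hμk hqk n hi).1.left o i hn le_rfl

end BMWQuantumMatrix

end GeneratorAntisymmetrizers

section PullThrough

variable {B : Type*} [Ring B] [Algebra ℂ B]

/-- The product `κ_j ⋯ κ_1`. -/
def descend (κ : ℕ → B) : ℕ → B
  | 0 => 1
  | j + 1 => κ (j + 1) * descend κ j

/-- The product `κ_1 ⋯ κ_j`. -/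
def ascend (κ : ℕ → B) : ℕ → B
  | 0 => 1
  | j + 1 => ascend κ j * κ (j + 1)

namespace BMWRel

variable {q μ : ℂ} {n : ℕ} {r s κ : ℕ → B}

theorem ascend_mul_descend (h : BMWRel q μ n r s κ) : ∀ {j : ℕ}, j + 2 < n →
    ascend κ j * κ (j + 1) * descend κ j = κ 1
  | 0, _ => by rw [ascend, descend, one_mul, mul_one]
  | j + 1, hj => by
    have := h.kkk (j + 1) (by omega)
    rw [← h.ascend_mul_descend (j := j) (by omega), ascend, descend]
    calc _ = ascend κ j * (κ (j + 1) * κ (j + 1 + 1) * κ (j + 1)) * descend κ j := by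
          simp only [mul_assoc]
      _ = _ := by rw [this]

theorem ascend_mul_descend_succ (h : BMWRel q μ n r s κ) {j : ℕ} (hj : j + 2 < n) :
    ascend κ (j + 1) * descend κ (j + 1) =
      ((q - μ) * (q⁻¹ + μ) / ((q - q⁻¹) * μ)) • κ 1 := by
  rw [← h.ascend_mul_descend hj, ascend, descend, mul_assoc, ← mul_assoc (κ (j + 1)),
    h.kk _ (by omega), smul_mul_assoc, mul_smul_comm]
  simp only [mul_assoc]

theorem descend_mul_ascend (h : BMWRel q μ n r s κ) : ∀ {j : ℕ}, j + 1 < n →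
    descend κ j * κ 0 * ascend κ j = κ j
  | 0, _ => by rw [ascend, descend, one_mul, mul_one]
  | j + 1, hj => by
    rw [← h.kkk' j hj, ← h.descend_mul_ascend (j := j) (by omega), ascend, descend]
    simp only [mul_assoc]

theorem r_mul_descend (h : BMWRel q μ n r s κ) {p j : ℕ} (hj : p + 2 + j + 1 < n) :
    r p * (descend κ (p + 2 + j) * κ 0) = descend κ (p + 2 + j) * κ 0 * r (p + 2) := by
  induction j with
  | zero =>
    have h1 := (h.three (p := p) (by omega)).rkk
    have h2 := (h.three (p := p + 1) (by omega)).symm.kkr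
    have hp : Commute (r (p + 2)) (descend κ p * κ 0) := by
      have hk : ∀ i ≤ p, Commute (r (p + 2)) (κ i) := fun i hi =>
        (h.far_kr i (p + 2) (by omega) (by omega)).symm
      have : ∀ i ≤ p, Commute (r (p + 2)) (descend κ i) := by
        intro i hi
        induction i with
        | zero => exact Commute.one_right _
        | succ i ih => exact (hk _ hi).mul_right (ih (by omega))
      exact (this p le_rfl).mul_right (hk 0 (by omega))
    obtain ⟨y, hy⟩ : ∃ y, descend κ p * κ 0 = κ p * y := by
      cases p with
      | zero => exact ⟨1, by rw [descend, one_mul, mul_one]⟩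
      | succ p => exact ⟨descend κ p * κ 0, by rw [descend, mul_assoc]⟩
    have e : descend κ (p + 2 + 0) * κ 0 = κ (p + 2) * κ (p + 1) * (descend κ p * κ 0) := by
      rw [add_zero, descend, descend]; simp only [mul_assoc]
    rw [e]
    calc r p * (κ (p + 2) * κ (p + 1) * (descend κ p * κ 0))
        = κ (p + 2) * (r p * κ (p + 1) * κ p) * y := by
          rw [hy, ← mul_assoc, ← mul_assoc, ← mul_assoc,
            h.far_rk p (p + 2) (by omega) (by omega)]
          simp only [mul_assoc]
      _ = κ (p + 2) * κ (p + 1) * r (p + 2) * (descend κ p * κ 0) := by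
          rw [h1, h2, hy]; simp only [mul_assoc]
      _ = _ := by rw [mul_assoc _ (r _), hp.eq]; simp only [mul_assoc]
  | succ j ih =>
    rw [← add_assoc, descend, mul_assoc, mul_assoc, ← ih (by omega), ← mul_assoc,
      h.far_rk p _ (by omega) (by omega), mul_assoc]

end BMWRel

theorem BMWRel.s_mul_baxter_mul_k {q μ : ℂ} {n : ℕ} {r s κ : ℕ → B} (h : BMWRel q μ n r s κ)
    (hμ : μ ≠ 0) (hq2 : q - q⁻¹ ≠ 0) {p : ℕ} (hp : p + 2 < n) (x : ℂ) :
    s p * baxter q μ (r (p + 1)) (κ (p + 1)) x * κ p =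
      (((1 + (x - 1)) * μ⁻¹) • (1 : B) + ((x - 1) / (q - q⁻¹)) • κ (p + 1) +
        (μ * (x - 1) / (μ + q * x) - (x - 1)) • r (p + 1)) * κ p := by
  have h3 := h.three hp
  have h1 : s p * r (p + 1) * κ p =
      κ (p + 1) * κ p - (q - q⁻¹) • (r (p + 1) * κ p) + (q - q⁻¹) • μ⁻¹ • κ p := by
    rw [← h3.krk hμ, ← h3.rrk₁, h3.skein₁, add_mul, sub_mul, add_mul, sub_mul]
    simp only [smul_mul_assoc, one_mul]
  have h2 : s p * κ (p + 1) * κ p = r (p + 1) * κ p := by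
    rw [← h3.symm.rkk, mul_assoc (r _), mul_assoc (r _), h3.kkk₁]
  rw [baxter, mul_add, mul_add, mul_one, mul_smul_comm, mul_smul_comm, add_mul, add_mul,
    smul_mul_assoc, smul_mul_assoc, h1, h2, h3.sk₁ hμ, add_mul, add_mul, smul_mul_assoc,
    smul_mul_assoc, smul_mul_assoc, one_mul]
  have hl := div_mul_cancel₀ (x - 1) hq2
  generalize (x - 1) / (q - q⁻¹) = f at hl ⊢
  rw [← hl]
  match_scalars <;> ring

end PullThrough

section Contraction

variable {N : ℕ} [NeZero N] {A : Type*} [Ring A] [Algebra ℂ A]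
variable {q μ : ℂ} {R F Ψ : MatV N 2 ℂ} {M : Matrix (Fin N) (Fin N) A}

theorem descend_mem (q μ : ℂ) (R : MatV N 2 ℂ) {n : ℕ} : ∀ {j : ℕ}, j + 1 < n →
    descend (gen A n (bmwK q μ R)) j ∈ genAlg A R n 1
  | 0, _ => Subalgebra.one_mem _
  | _ + 1, hj => Subalgebra.mul_mem _ (gen_bmwK_mem_genAlg q μ R (by omega) (by omega))
      (descend_mem q μ R (by omega))

namespace BMWQuantumMatrix

theorem commute_shift_shift (h : BMWQuantumMatrix q μ R F Ψ M) {n : ℕ} {X : MatV N (n + 1) A}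
    (hX : X ∈ genAlg A R (n + 1) 0) (Y : MatV N 2 ℂ) :
    Commute (gen A (n + 3) Y 0) (shift F (n + 2) (shift F (n + 1) X)) := by
  induction hX using Algebra.adjoin_induction with
  | mem X hX =>
    obtain ⟨p, -, hp, rfl⟩ := hX
    rw [h.shift_r hp, h.shift_r (by omega)]
    exact gen_far (by omega) (by omega) (by omega) _ _
  | algebraMap c =>
    rw [Algebra.algebraMap_eq_smul_one, shift_smul, shift_smul, shift_one h.det', shift_one h.det']
    exact (Commute.one_right _).smul_right c
  | add X Y _ _ hX hY => rw [shift_add, shift_add]; exact hX.add_right hY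
  | mul X Y _ _ hX hY => rw [shift_mul h.det', shift_mul h.det']; exact hX.mul_right hY

theorem ext1_ext1_mul_descend (h : BMWQuantumMatrix q μ R F Ψ M) {n : ℕ} {X : MatV N (n + 1) A}
    (hX : X ∈ genAlg A R (n + 1) 0) :
    ext1 (ext1 X) * (descend (gen A (n + 3) (bmwK q μ R)) (n + 1) * gen A (n + 3) (bmwK q μ R) 0) =
      descend (gen A (n + 3) (bmwK q μ R)) (n + 1) * gen A (n + 3) (bmwK q μ R) 0 *
        shift F (n + 2) (shift F (n + 1) X) := by
  induction hX using Algebra.adjoin_induction with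
  | mem X hX =>
    obtain ⟨p, -, hp, rfl⟩ := hX
    rw [h.shift_r hp, h.shift_r (by omega), ext1_gen hp, ext1_gen (by omega)]
    obtain ⟨j, rfl⟩ : ∃ j, n = p + 1 + j := ⟨n - (p + 1), by omega⟩
    have := (h.bmwRel (p + 1 + j + 3)).r_mul_descend (p := p) (j := j) (by omega)
    rwa [show p + 2 + j = p + 1 + j + 1 by ring] at this
  | algebraMap c =>
    rw [Algebra.algebraMap_eq_smul_one, shift_smul, shift_smul, shift_one h.det', shift_one h.det',
      ext1_smul, ext1_smul, ext1_one, ext1_one, smul_mul_assoc, mul_smul_comm, one_mul, mul_one]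
  | add X Y _ _ hX hY =>
    rw [shift_add, shift_add, ext1_add, ext1_add, add_mul, mul_add, hX, hY]
  | mul X Y _ _ hX hY =>
    rw [shift_mul h.det', shift_mul h.det', ext1_mul, ext1_mul, mul_assoc, hY, ← mul_assoc, hX,
      mul_assoc]

theorem theta_shift_shift_mul (h : BMWQuantumMatrix q μ R F Ψ M) {n : ℕ} {X : MatV N (n + 1) A}
    (hX : X ∈ genAlg A R (n + 1) 0) :
    theta F Ψ M (n + 2) (shift F (n + 2) (shift F (n + 1) X) * gen A (n + 3) (bmwK q μ R) 0 *
      gen A (n + 3) (bmwK q μ R) 1) = theta F Ψ M n X * scal N 1 (gElt q μ R F Ψ M) := by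
  have hδ : (q - μ) * (q⁻¹ + μ) / ((q - q⁻¹) * μ) ≠ 0 :=
    div_ne_zero (mul_ne_zero h.mu_ne_left h.mu_ne_right) (mul_ne_zero h.lam_ne h.mu_ne)
  have e1 := h.theta_contract hX
  have e2 := h.ext1_ext1_mul_descend hX
  have e3 := h.commute_shift_shift hX (bmwK q μ R)
  have hw := descend_mem (A := A) q μ R (n := n + 3) (j := n + 1) (by omega)
  rw [← (h.bmwRel (n + 3)).descend_mul_ascend (j := n + 1) (by omega), ← mul_assoc, e2, mul_assoc,
    mul_assoc (descend _ _), h.theta_cyclic hw, mul_assoc, mul_assoc,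
    (h.bmwRel (n + 3)).ascend_mul_descend_succ (j := n) (by omega), mul_smul_comm, mul_smul_comm,
    map_smul, ← mul_assoc, e3.eq] at e1
  exact smul_right_injective _ hδ e1

end BMWQuantumMatrix

end Contraction

section WedgeRelations

variable {N : ℕ} [NeZero N] {A : Type*} [Ring A] [Algebra ℂ A]
variable {q μ : ℂ} {R F Ψ : MatV N 2 ℂ} {M : Matrix (Fin N) (Fin N) A}

/-- The wedge power `Tr_{R(2, …, i+1)}(M_{(1)} ⋯ M_{(i+1)} A^{(i+1)})`. -/
def wedge (q μ : ℂ) (R F Ψ : MatV N 2 ℂ) (M : Matrix (Fin N) (Fin N) A) (i : ℕ) : MatV N 1 A :=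
  theta F Ψ M i (anti A q μ R (i + 1) 0 (i + 1))

/-- The map `Z ↦ M · Tr_{R(2)}(F₁ Z₁ F₁⁻¹ Y₁)`. -/
def mulPhi (F Ψ : MatV N 2 ℂ) (M : Matrix (Fin N) (Fin N) A) (Y : MatV N 2 ℂ) :
    MatV N 1 A →ₗ[ℂ] MatV N 1 A where
  toFun Z := lift1 0 M * phiB F Ψ Y Z
  map_add' X Z := by rw [map_add, mul_add]
  map_smul' c X := by rw [map_smul, mul_smul_comm]; rfl

theorem mulPhi_mul_scal (hF : IsUnit F.det) (Y : MatV N 2 ℂ) (Z : MatV N 1 A) (c : A) :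
    mulPhi F Ψ M Y (Z * scal N 1 c) = mulPhi F Ψ M Y Z * scal N 1 c := by
  change lift1 0 M * phiB F Ψ Y _ = lift1 0 M * phiB F Ψ Y _ * _
  rw [phiB_mul_scal hF, mul_assoc]

theorem theta_zero (F Ψ : MatV N 2 ℂ) (M : Matrix (Fin N) (Fin N) A) :
    theta F Ψ M 0 1 = lift1 0 M := by
  rw [theta_apply, mul_one, trTail, Mprod, Mprod, one_mul, Mcopy]

theorem aElt_succ (hq : q ≠ 0) (i : ℕ) : aElt q μ R F Ψ M (i + 1) =
    trAll (cmap (Dof Ψ)) (i + 1) (Mprod F M (i + 1) * anti A q μ R (i + 1) 0 (i + 1)) := by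
  rw [aElt, cmap_asym hq]

namespace BMWQuantumMatrix

theorem theta_shift_mul_sg (h : BMWQuantumMatrix q μ R F Ψ M) (i m : ℕ) :
    theta F Ψ M (i + 1) (anti A q μ R (i + 2) 1 (i + 1) * sg A q μ R (i + 2) 0 m) =
      lift1 0 M * scal N 1 (aElt q μ R F Ψ M (i + 1)) +
      ((q ^ (-(2 * (m : ℤ))) - 1) / (q - q⁻¹)) • mulPhi F Ψ M R (wedge q μ R F Ψ M i) +
      (μ * (q ^ (-(2 * (m : ℤ))) - 1) / (μ + q * q ^ (-(2 * (m : ℤ))))) •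
        mulPhi F Ψ M (bmwK q μ R) (wedge q μ R F Ψ M i) := by
  rw [sg, baxter, mul_add, mul_add, mul_one, mul_smul_comm, mul_smul_comm, map_add, map_add,
    map_smul, map_smul, ← h.shift_anti (by omega), h.theta_shift, h.theta_shift_mul_gen,
    h.theta_shift_mul_gen, aElt_succ h.q_ne]
  rfl

variable {k : ℕ}

theorem theta_anti_mul_sg_mul_anti (h : BMWQuantumMatrix q μ R F Ψ M)
    (hμk : ∀ m : ℕ, 1 ≤ m → m ≤ k → μ + q * q ^ (-(2 * (m : ℤ))) ≠ 0)
    (hqk : ∀ m : ℕ, 1 ≤ m → m ≤ k → nq q m ≠ 0) {i : ℕ} (hi : i + 1 ≤ k) :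
    theta F Ψ M (i + 1) (anti A q μ R (i + 2) 0 (i + 1) * sg A q μ R (i + 2) i (i + 1) *
      anti A q μ R (i + 2) 0 (i + 1)) =
    theta F Ψ M (i + 1) (anti A q μ R (i + 2) 1 (i + 1) * sg A q μ R (i + 2) 0 (i + 1)) := by
  have e := (h.absorbs_and_symm hμk hqk (i + 2) hi).2 0 (by omega) (by omega)
  rw [show 0 + (i + 1) - 1 = i by omega, zero_add] at e
  have hm := anti_mem (A := A) (q := q) (μ := μ) (R := R) (n := i + 2) (o := 1) (i := i + 1)
    (by omega)
  rw [e, ← h.theta_cyclic hm, ← mul_assoc, h.anti_mul_self hμk hqk hi (by omega)]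

theorem wedge_zero : wedge q μ R F Ψ M 0 = lift1 0 M := theta_zero F Ψ M

theorem wedge_succ (h : BMWQuantumMatrix q μ R F Ψ M)
    (hμk : ∀ m : ℕ, 1 ≤ m → m ≤ k → μ + q * q ^ (-(2 * (m : ℤ))) ≠ 0)
    (hqk : ∀ m : ℕ, 1 ≤ m → m ≤ k → nq q m ≠ 0) {i : ℕ} (hi : i + 2 ≤ k) :
    wedge q μ R F Ψ M (i + 1) = (q ^ (i + 1) / nq q (i + 2)) •
      theta F Ψ M (i + 1) (anti A q μ R (i + 2) 1 (i + 1) * sg A q μ R (i + 2) 0 (i + 1)) := by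
  rw [wedge, anti_succ, map_smul, zero_add, h.theta_anti_mul_sg_mul_anti hμk hqk (by omega)]

theorem theta_cut (h : BMWQuantumMatrix q μ R F Ψ M)
    (hμk : ∀ m : ℕ, 1 ≤ m → m ≤ k + 1 → μ + q * q ^ (-(2 * (m : ℤ))) ≠ 0)
    (hqk : ∀ m : ℕ, 1 ≤ m → m ≤ k + 1 → nq q m ≠ 0) (hc : HeightCut q μ R (k + 1)) :
    theta F Ψ M (k + 1) (anti A q μ R (k + 2) 1 (k + 1) * sg A q μ R (k + 2) 0 (k + 1)) = 0 := by
  rw [← h.theta_anti_mul_sg_mul_anti hμk hqk le_rfl, anti_cut h.q_ne hc, map_zero]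

theorem mulPhi_bmwK_wedge_zero (h : BMWQuantumMatrix q μ R F Ψ M) :
    mulPhi F Ψ M (bmwK q μ R) (wedge q μ R F Ψ M 0) = μ⁻¹ • scal N 1 (gElt q μ R F Ψ M) := by
  rw [← h.theta_k_zero, wedge_zero, ← theta_zero F Ψ M]
  refine (h.theta_shift_mul_gen _ 1).symm.trans ?_
  rw [shift_one h.det', one_mul]

theorem theta_mul_k_mul_r_mul_sg (h : BMWQuantumMatrix q μ R F Ψ M) {n : ℕ} (m : ℕ)
    {a : MatV N (n + 3) A} (ha : Commute (gen A (n + 3) (bmwK q μ R) 1) a)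
    (hn : 3 < n + 3) :
    theta F Ψ M (n + 2) (a * (gen A (n + 3) (bmwK q μ R) 1 * gen A (n + 3) R 0) *
        sg A q μ R (n + 3) 2 m) =
      theta F Ψ M (n + 2) (a * (((1 + (q ^ (-(2 * (m : ℤ))) - 1)) * μ⁻¹) • 1 +
        ((q ^ (-(2 * (m : ℤ))) - 1) / (q - q⁻¹)) • gen A (n + 3) (bmwK q μ R) 2 +
        (μ * (q ^ (-(2 * (m : ℤ))) - 1) / (μ + q * q ^ (-(2 * (m : ℤ)))) -
          (q ^ (-(2 * (m : ℤ))) - 1)) • gen A (n + 3) R 2) *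
        gen A (n + 3) (bmwK q μ R) 0 * gen A (n + 3) (bmwK q μ R) 1) := by
  have hδ : (q - μ) * (q⁻¹ + μ) / ((q - q⁻¹) * μ) ≠ 0 :=
    div_ne_zero (mul_ne_zero h.mu_ne_left h.mu_ne_right) (mul_ne_zero h.lam_ne h.mu_ne)
  have hb := h.bmwRel (n + 3)
  have e := hb.s_mul_baxter_mul_k h.mu_ne h.lam_ne (p := 1) (by omega) (q ^ (-(2 * (m : ℤ))))
  have hk := gen_bmwK_mem_genAlg (A := A) q μ R (n := n + 3) (o := 1) (p := 1) le_rfl (by omega)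
  have kk := hb.kk 1 (by omega)
  have kr := (hb.three (p := 0) (by omega)).symm.kr_eq
  rw [sg]
  set w := baxter q μ (gen A (n + 3) R 2) (gen A (n + 3) (bmwK q μ R) 2) (q ^ (-(2 * (m : ℤ))))
  obtain ⟨z, hz⟩ : ∃ z, z = ((1 + (q ^ (-(2 * (m : ℤ))) - 1)) * μ⁻¹) • 1 +
        ((q ^ (-(2 * (m : ℤ))) - 1) / (q - q⁻¹)) • gen A (n + 3) (bmwK q μ R) 2 +
        (μ * (q ^ (-(2 * (m : ℤ))) - 1) / (μ + q * q ^ (-(2 * (m : ℤ)))) -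
          (q ^ (-(2 * (m : ℤ))) - 1)) • gen A (n + 3) R 2 := ⟨_, rfl⟩
  have e' : gen A (n + 3) R⁻¹ 1 * w * gen A (n + 3) (bmwK q μ R) 1 =
      z * gen A (n + 3) (bmwK q μ R) 1 := by rw [hz]; exact e
  have hf : ∀ Y : MatV N 2 ℂ, Commute (gen A (n + 3) (bmwK q μ R) 0) (gen A (n + 3) Y 2) :=
    fun Y => gen_far (by omega) (by omega) (by omega) _ _
  have hzc : Commute (gen A (n + 3) (bmwK q μ R) 0) z := by
    rw [hz]
    exact (((Commute.one_right _).smul_right _).add_right ((hf _).smul_right _)).add_right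
      ((hf _).smul_right _)
  rw [← hz]
  set κ₀ := gen A (n + 3) (bmwK q μ R) 0
  set κ₁ := gen A (n + 3) (bmwK q μ R) 1
  have cyc : ∀ X, theta F Ψ M (n + 2) (a * κ₁ * X * κ₁) =
      ((q - μ) * (q⁻¹ + μ) / ((q - q⁻¹) * μ)) • theta F Ψ M (n + 2) (a * κ₁ * X) := fun X => by
    rw [← h.theta_cyclic hk, ← mul_assoc, ← mul_assoc, ha.eq, mul_assoc a, kk, mul_smul_comm,
      smul_mul_assoc, map_smul]
  have cyc' : ∀ X, theta F Ψ M (n + 2) (a * κ₁ * X * κ₁) =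
      ((q - μ) * (q⁻¹ + μ) / ((q - q⁻¹) * μ)) • theta F Ψ M (n + 2) (a * X * κ₁) := fun X => by
    rw [← map_smul, ← mul_smul_comm, ← kk, ← mul_assoc (a * X), ← h.theta_cyclic hk (a * X * κ₁)]
    simp only [← mul_assoc]
    rw [ha.eq]
  refine smul_right_injective _ hδ ?_
  change _ • theta F Ψ M (n + 2) _ = _ • theta F Ψ M (n + 2) _
  rw [kr, mul_assoc a z, ← hzc.eq, ← cyc', mul_assoc a, mul_assoc (_ * _), mul_assoc κ₁,
    ← mul_assoc a, ← cyc]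
  simp only [mul_assoc] at e' ⊢
  rw [e']

theorem theta_anti_mul_k_mul_k (h : BMWQuantumMatrix q μ R F Ψ M) (i : ℕ) (x y z : ℂ) :
    theta F Ψ M (i + 3) (anti A q μ R (i + 4) 3 (i + 1) *
        (x • 1 + y • gen A (i + 4) (bmwK q μ R) 2 + z • gen A (i + 4) R 2) *
        gen A (i + 4) (bmwK q μ R) 0 * gen A (i + 4) (bmwK q μ R) 1) =
      (x • (lift1 0 M * scal N 1 (aElt q μ R F Ψ M (i + 1))) +
        y • mulPhi F Ψ M (bmwK q μ R) (wedge q μ R F Ψ M i) +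
        z • mulPhi F Ψ M R (wedge q μ R F Ψ M i)) * scal N 1 (gElt q μ R F Ψ M) := by
  obtain ⟨w, hw⟩ : ∃ w : MatV N (i + 2) A,
    w = x • 1 + y • gen A (i + 2) (bmwK q μ R) 0 + z • gen A (i + 2) R 0 := ⟨_, rfl⟩
  have hwm : w ∈ genAlg A R (i + 2) 0 := by
    rw [hw]
    exact add_mem (add_mem (Subalgebra.smul_mem _ (one_mem _) _)
      (Subalgebra.smul_mem _ (gen_bmwK_mem_genAlg q μ R le_rfl (by omega)) _))
      (Subalgebra.smul_mem _ (gen_mem_genAlg R le_rfl (by omega)) _)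
  have hs : x • 1 + y • gen A (i + 4) (bmwK q μ R) 2 + z • gen A (i + 4) R 2 =
      shift F (i + 3) (shift F (i + 2) w) := by
    rw [hw]
    simp only [shift_add, shift_smul, shift_one h.det']
    rw [h.shift_k (n := i + 2) (p := 0) (by omega), h.shift_r (n := i + 2) (p := 0) (by omega),
      h.shift_k (n := i + 3) (p := 1) (by omega), h.shift_r (n := i + 3) (p := 1) (by omega)]
  have ha := anti_mem (A := A) (q := q) (μ := μ) (R := R) (n := i + 2) (o := 1) (i := i + 1)
    (by omega)
  have e : anti A q μ R (i + 4) 3 (i + 1) = shift F (i + 3) (shift F (i + 2)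
      (anti A q μ R (i + 2) 1 (i + 1))) := by
    rw [h.shift_anti (by omega), h.shift_anti (by omega)]
  rw [hs, e, ← shift_mul h.det', ← shift_mul h.det', h.theta_shift_shift_mul
    (Subalgebra.mul_mem _ (genAlg_mono R (by omega) ha) hwm), hw, mul_add, mul_add, mul_smul_comm,
    mul_smul_comm, mul_smul_comm, mul_one, map_add, map_add, map_smul, map_smul, map_smul,
    ← h.shift_anti (by omega), h.theta_shift, h.theta_shift_mul_gen, h.theta_shift_mul_gen,
    aElt_succ h.q_ne]
  rfl

theorem mulPhi_mulPhi_wedge_succ (h : BMWQuantumMatrix q μ R F Ψ M)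
    (hμk : ∀ m : ℕ, 1 ≤ m → m ≤ k → μ + q * q ^ (-(2 * (m : ℤ))) ≠ 0)
    (hqk : ∀ m : ℕ, 1 ≤ m → m ≤ k → nq q m ≠ 0) {i : ℕ} (hi : i + 2 ≤ k) :
    mulPhi F Ψ M R (mulPhi F Ψ M (bmwK q μ R) (wedge q μ R F Ψ M (i + 1))) =
      (q ^ (i + 1) / nq q (i + 2)) •
      ((((1 + (q ^ (-(2 * ((i + 1 : ℕ) : ℤ))) - 1)) * μ⁻¹) •
          (lift1 0 M * scal N 1 (aElt q μ R F Ψ M (i + 1))) +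
        ((q ^ (-(2 * ((i + 1 : ℕ) : ℤ))) - 1) / (q - q⁻¹)) •
          mulPhi F Ψ M (bmwK q μ R) (wedge q μ R F Ψ M i) +
        (μ * (q ^ (-(2 * ((i + 1 : ℕ) : ℤ))) - 1) / (μ + q * q ^ (-(2 * ((i + 1 : ℕ) : ℤ)))) -
          (q ^ (-(2 * ((i + 1 : ℕ) : ℤ))) - 1)) • mulPhi F Ψ M R (wedge q μ R F Ψ M i)) *
        scal N 1 (gElt q μ R F Ψ M)) := by
  have s1 : mulPhi F Ψ M R (mulPhi F Ψ M (bmwK q μ R) (wedge q μ R F Ψ M (i + 1))) =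
      theta F Ψ M (i + 3) (anti A q μ R (i + 4) 2 (i + 2) *
        (gen A (i + 4) (bmwK q μ R) 1 * gen A (i + 4) R 0)) := by
    have e1 : mulPhi F Ψ M (bmwK q μ R) (wedge q μ R F Ψ M (i + 1)) = _ :=
      (h.theta_shift_mul_gen (bmwK q μ R) (anti A q μ R (i + 2) 0 (i + 2))).symm
    rw [e1, h.shift_anti (by omega)]
    refine (h.theta_shift_mul_gen R _).symm.trans ?_
    rw [shift_mul h.det', h.shift_anti (by omega), h.shift_k (by omega), mul_assoc]
  have hs := (h.absorbs_and_symm hμk hqk (i + 4) (i := i + 1) (by omega)).2 2 (by omega) (by omega)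
  rw [show 2 + (i + 1) - 1 = 2 + i by omega] at hs
  have ha : ∀ Y : MatV N 2 ℂ, ∀ p < 2,
      Commute (gen A (i + 4) Y p) (anti A q μ R (i + 4) 3 (i + 1)) :=
    fun Y p hp => gen_commute_anti (by omega) (by omega) (by omega) Y
  have hm := anti_mem (A := A) (q := q) (μ := μ) (R := R) (n := i + 4) (o := 3) (i := i + 1)
    (by omega)
  have hsg := sg_mem (A := A) (q := q) (μ := μ) (R := R) (n := i + 4) (o := 2) (j := 2)
    (m := i + 1) le_rfl (by omega)
  have hc := ((ha (bmwK q μ R) 1 (by omega)).mul_left (ha R 0 (by omega)))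
  have s2 : theta F Ψ M (i + 3) (anti A q μ R (i + 4) 3 (i + 1) * sg A q μ R (i + 4) 2 (i + 1) *
        anti A q μ R (i + 4) 3 (i + 1) * (gen A (i + 4) (bmwK q μ R) 1 * gen A (i + 4) R 0)) =
      theta F Ψ M (i + 3) (anti A q μ R (i + 4) 3 (i + 1) *
        (gen A (i + 4) (bmwK q μ R) 1 * gen A (i + 4) R 0) * sg A q μ R (i + 4) 2 (i + 1)) := by
    rw [mul_assoc _ _ (_ * _),
      h.theta_cyclic (Subalgebra.mul_mem _ (genAlg_mono R (by omega) hm)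
        (genAlg_mono R (by omega) hsg)), ← hc.eq, mul_assoc (_ * _),
      ← mul_assoc (anti A q μ R (i + 4) 3 (i + 1)),
      h.anti_mul_self hμk hqk (by omega) (by omega), ← mul_assoc]
  rw [s1, show i + 2 = i + 1 + 1 by rfl, anti_succ, hs, smul_mul_assoc, map_smul, s2,
    h.theta_mul_k_mul_r_mul_sg (n := i + 1) _ (ha _ 1 (by omega)) (by omega),
    h.theta_anti_mul_k_mul_k]

end BMWQuantumMatrix

end WedgeRelations

section Elimination

variable {q : ℂ}

theorem nq_zero (q : ℂ) : nq q 0 = 0 := by simp [nq]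

theorem nq_one (h : q - q⁻¹ ≠ 0) : nq q 1 = 1 := by
  rw [nq, Nat.cast_one, zpow_one, _root_.zpow_neg, zpow_one, div_self h]

theorem nq_add (hq : q ≠ 0) (m n : ℕ) :
    nq q (m + n) = q ^ m * nq q n + (q⁻¹) ^ n * nq q m := by
  simp only [nq, Nat.cast_add, _root_.zpow_neg, zpow_add₀ hq, zpow_natCast, mul_inv, inv_pow]
  ring

theorem nq_mul_nq_add (hq : q ≠ 0) (hl : q - q⁻¹ ≠ 0) (p r : ℕ) :
    nq q p * nq q (p + r + 1) + nq q r = nq q (p + 1) * nq q (p + r) := by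
  have e : q ^ p * (q⁻¹) ^ p = 1 := by rw [← mul_pow, mul_inv_cancel₀ hq, one_pow]
  have d (m : ℕ) : nq q m * (q - q⁻¹) = q ^ m - (q⁻¹) ^ m := by
    rw [nq, div_mul_cancel₀ _ hl, _root_.zpow_neg, zpow_natCast, inv_pow]
  refine mul_right_cancel₀ (mul_ne_zero hl hl) ?_
  have d1 := d p
  have d2 := d r
  have d3 := d (p + r + 1)
  have d4 := d (p + 1)
  have d5 := d (p + r)
  simp only [pow_add, pow_one] at d3 d4 d5
  calc _ = (nq q p * (q - q⁻¹)) * (nq q (p + r + 1) * (q - q⁻¹)) +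
        (nq q r * (q - q⁻¹)) * (q - q⁻¹) := by ring
    _ = (nq q (p + 1) * (q - q⁻¹)) * (nq q (p + r) * (q - q⁻¹)) := by
      rw [d1, d2, d3, d4, d5]
      linear_combination (-(q⁻¹) ^ r * q⁻¹ - q ^ r * q + (q⁻¹) ^ r * q + q ^ r * q⁻¹) * e
    _ = _ := by ring

/-- The homogeneous polynomial `∑_{p+r=n} f(p,r) x^p g^r`. -/
def homSum {S : Type*} [CommRing S] [Algebra ℂ S] (x g : S) (f : ℕ → ℕ → ℂ) (n : ℕ) : S :=
  ∑ p ∈ Finset.HasAntidiagonal.antidiagonal n, f p.1 p.2 • (x ^ p.1 * g ^ p.2)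

variable {S : Type*} [CommRing S] [Algebra ℂ S] (x g : S)

theorem homSum_add_smul (a b : ℂ) (f f' : ℕ → ℕ → ℂ) (n : ℕ) :
    a • homSum x g f n + b • homSum x g f' n =
      homSum x g (fun p r => a * f p r + b * f' p r) n := by
  simp only [homSum, Finset.smul_sum, ← Finset.sum_add_distrib, smul_smul, add_smul]

theorem smul_homSum (a : ℂ) (f : ℕ → ℕ → ℂ) (n : ℕ) :
    a • homSum x g f n = homSum x g (fun p r => a * f p r) n := by
  simp only [homSum, Finset.smul_sum, smul_smul]

theorem homSum_congr {f f' : ℕ → ℕ → ℂ} {n : ℕ} (h : ∀ p r, p + r = n → f p r = f' p r) :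
    homSum x g f n = homSum x g f' n :=
  Finset.sum_congr rfl fun p hp => by rw [h _ _ (Finset.HasAntidiagonal.mem_antidiagonal.1 hp)]

theorem mul_homSum_left (f f' : ℕ → ℕ → ℂ) (h0 : ∀ r, f' 0 r = 0)
    (h : ∀ p r, f' (p + 1) r = f p r) (n : ℕ) :
    x * homSum x g f n = homSum x g f' (n + 1) := by
  rw [homSum, homSum, Finset.Nat.sum_antidiagonal_succ, h0, zero_smul, zero_add, Finset.mul_sum]
  refine Finset.sum_congr rfl fun p _ => ?_
  rw [h, mul_smul_comm, pow_succ', mul_assoc]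

theorem mul_homSum_right (f f' : ℕ → ℕ → ℂ) (h0 : ∀ p, f' p 0 = 0)
    (h : ∀ p r, f' p (r + 1) = f p r) (n : ℕ) :
    g * homSum x g f n = homSum x g f' (n + 1) := by
  rw [homSum, homSum, Finset.Nat.sum_antidiagonal_succ', h0, zero_smul, zero_add, Finset.mul_sum]
  refine Finset.sum_congr rfl fun p _ => ?_
  rw [h, mul_smul_comm, pow_succ', mul_left_comm]

/-- The multiplier of the wedge powers in the elimination. -/
def elimP (q : ℂ) (n : ℕ) : S :=
  homSum x g (fun p r => nq q (p + 1) * (-1) ^ p * (-q) ^ r) n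

/-- The multiplier of the contracted wedge powers in the elimination. -/
def elimQ (q : ℂ) (n : ℕ) : S :=
  homSum x g (fun p r => nq q (r + 1) * (-q⁻¹) ^ p * (-1) ^ r) n

/-- The polynomial `∑_{p+r=n} q^{2r} x^p g^r`. -/
def elimH (q : ℂ) (n : ℕ) : S := homSum x g (fun _ r => q ^ (2 * r)) n

theorem mul_elimP (n : ℕ) : x * elimP x g q n =
    homSum x g (fun p r => -(nq q p * (-1) ^ p * (-q) ^ r)) (n + 1) :=
  mul_homSum_left x g _ _ (fun r => by simp [nq_zero]) (fun p r => by ring) n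

theorem mul_elimQ (n : ℕ) : g * elimQ x g q n =
    homSum x g (fun p r => -(nq q r * (-q⁻¹) ^ p * (-1) ^ r)) (n + 1) :=
  mul_homSum_right x g _ _ (fun r => by simp [nq_zero]) (fun p r => by ring) n

theorem elimP_add_elimQ (hq : q ≠ 0) (n : ℕ) :
    x * elimP x g q n + q ^ (2 * (n + 1)) • (g * elimQ x g q n) =
      ((-1) ^ n * nq q (n + 1)) • elimH x g q (n + 1) := by
  rw [mul_elimP, mul_elimQ, ← one_smul ℂ (homSum _ _ _ _), homSum_add_smul, elimH, smul_homSum]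
  refine homSum_congr x g fun p r h => ?_
  have e : (-1 : ℂ) ^ n = - ((-1) ^ p * (-1) ^ r) := by
    rw [← pow_add, h, pow_succ]; ring
  have e1 (m : ℕ) : q ^ m * (q⁻¹) ^ m = 1 := by rw [← mul_pow, mul_inv_cancel₀ hq, one_pow]
  rw [e, ← h, nq_add hq, neg_pow q, neg_pow q⁻¹]
  linear_combination (-(-1) ^ p * (-1) ^ r * q ^ (2 * r)) * (q ^ p * nq q r * e1 p) +
    (-1) ^ p * (-1) ^ r * nq q p * q ^ r * e1 r

theorem elimP_succ (hq : q ≠ 0) (hl : q - q⁻¹ ≠ 0) (n : ℕ) :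
    nq q (n + 2) • (x * elimP x g q n) + q ^ (n + 1) • (g * elimQ x g q n) =
      (-nq q (n + 1)) • elimP x g q (n + 1) := by
  rw [mul_elimP, mul_elimQ, homSum_add_smul, elimP, smul_homSum]
  refine homSum_congr x g fun p r h => ?_
  have e := nq_mul_nq_add hq hl p r
  rw [h] at e
  have e1 : q ^ (n + 1) * (q⁻¹) ^ p = q ^ r := by
    rw [← h, pow_add, mul_right_comm, ← mul_pow, mul_inv_cancel₀ hq, one_pow, one_mul]
  rw [neg_pow q, neg_pow q⁻¹]
  linear_combination (-(-1) ^ p * (-1) ^ r * q ^ r) * e - (-1) ^ p * (-1) ^ r * nq q r * e1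

theorem elimQ_succ (hq : q ≠ 0) (hl : q - q⁻¹ ≠ 0) (n : ℕ) :
    (q⁻¹) ^ (n + 1) • (x * elimP x g q n) + nq q (n + 2) • (g * elimQ x g q n) =
      (-nq q (n + 1)) • elimQ x g q (n + 1) := by
  rw [mul_elimP, mul_elimQ, homSum_add_smul, elimQ, smul_homSum]
  refine homSum_congr x g fun p r h => ?_
  have e := nq_mul_nq_add hq hl r p
  rw [add_comm r p, h] at e
  have e1 : (q⁻¹) ^ (n + 1) * q ^ r = (q⁻¹) ^ p := by
    rw [← h, pow_add, mul_assoc, ← mul_pow, inv_mul_cancel₀ hq, one_pow, mul_one]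
  rw [neg_pow q, neg_pow q⁻¹]
  linear_combination (-(-1) ^ p * (-1) ^ r * q⁻¹ ^ p) * e - (-1) ^ p * (-1) ^ r * nq q p * e1

/-- The invariant of the elimination. -/
def elimT (q : ℂ) (n : ℕ) (u w : S) : S :=
  (nq q (n + 1))⁻¹ • (q⁻¹ • (elimQ x g q n * w) - elimP x g q n * u)

theorem elimT_step (hq : q ≠ 0) (hl : q - q⁻¹ ≠ 0) {n : ℕ} (h1 : nq q (n + 1) ≠ 0)
    (h2 : nq q (n + 2) ≠ 0) {c d y : ℂ} (hc : c * nq q (n + 2) = -(q⁻¹) ^ (n + 2))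
    (hd : d * nq q (n + 2) = q ^ (n + 2)) (a u w : S) :
    elimT x g q n (y • (x * a) - x * u - c • (x * w))
        ((-(q * q ^ (2 * (n + 1)) * y) • a + d • u - w) * g) =
      elimT x g q (n + 1) u w + ((-1) ^ (n + 1) * y) • (a * elimH x g q (n + 1)) := by
  rw [← eq_mul_inv_iff_mul_eq₀ h2] at hc hd
  subst hc hd
  have e1 := elimP_add_elimQ x g hq n
  have e2 := elimP_succ x g hq hl n
  have e3 := elimQ_succ x g hq hl n
  have i1 := congrArg (algebraMap ℂ S) (mul_inv_cancel₀ h1)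
  have i2 := congrArg (algebraMap ℂ S) (mul_inv_cancel₀ h2)
  have iq := congrArg (algebraMap ℂ S) (mul_inv_cancel₀ hq)
  simp only [elimT, Algebra.smul_def, _root_.map_mul, _root_.map_neg, _root_.map_pow,
    _root_.map_one] at *
  set b₁ := algebraMap ℂ S (nq q (n + 1))⁻¹
  set b₂ := algebraMap ℂ S (nq q (n + 2))⁻¹
  set p := algebraMap ℂ S q
  set p' := algebraMap ℂ S q⁻¹
  set z := algebraMap ℂ S y
  linear_combination
    u * (b₁ * b₂ * e2 - b₁ * x * elimP x g q n * i2 +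
        b₁ * b₂ * (g * elimQ x g q n) * p ^ (n + 1) * iq -
      b₂ * elimP x g q (n + 1) * i1) +
    w * (-p' * b₁ * b₂ * e3 + p' * b₁ * (g * elimQ x g q n) * i2 +
        b₂ * p' * elimQ x g q (n + 1) * i1) +
    a * (-b₁ * z * e1 - b₁ * z * p ^ (2 * (n + 1)) * (g * elimQ x g q n) * iq -
      (-1) ^ n * z * elimH x g q (n + 1) * i1)

theorem elimT_zero (hl : q - q⁻¹ ≠ 0) (u w : S) : elimT x g q 0 u w = q⁻¹ • w - u := by
  simp [elimT, elimP, elimQ, homSum, nq_one hl]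

theorem elimT_start (hq : q ≠ 0) {n : ℕ} (h1 : nq q (n + 1) ≠ 0) :
    elimT x g q n x (-(q ^ (2 * n + 3)) • g) = (-1 : ℂ) ^ (n + 1) • elimH x g q (n + 1) := by
  have e1 := elimP_add_elimQ x g hq n
  have i1 := congrArg (algebraMap ℂ S) (mul_inv_cancel₀ h1)
  have iq := congrArg (algebraMap ℂ S) (mul_inv_cancel₀ hq)
  simp only [elimT, Algebra.smul_def, _root_.map_mul, _root_.map_neg, _root_.map_pow,
    _root_.map_one] at *
  set b₁ := algebraMap ℂ S (nq q (n + 1))⁻¹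
  set p := algebraMap ℂ S q
  linear_combination -b₁ * e1 - b₁ * p ^ (2 * n + 2) * (g * elimQ x g q n) * iq -
    (-1) ^ n * elimH x g q (n + 1) * i1

/-- Elimination of the wedge powers from the recurrent relations. -/
theorem elimination (hq : q ≠ 0) (hl : q - q⁻¹ ≠ 0) {k : ℕ}
    (hqk : ∀ m : ℕ, 1 ≤ m → m ≤ k + 1 → nq q m ≠ 0) (c d : ℕ → ℂ)
    (hc : ∀ i n, i + n + 1 = k → c i * nq q (n + 2) = -(q⁻¹) ^ (n + 2))
    (hd : ∀ i n, i + n + 1 = k → d i * nq q (n + 2) = q ^ (n + 2))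
    (a u w : ℕ → S) (ha : a 0 = 1) (hu0 : u 0 = x ^ 2) (hw0 : w 0 = -(q ^ (2 * k + 3)) • g)
    (hu : ∀ i, i < k → u (i + 1) =
      q ^ (i + 1) • (x ^ 2 * (a (i + 1) * x ^ (i + 1))) - x ^ 2 * u i - c i • (x ^ 2 * w i))
    (hw : ∀ i n, i + n + 1 = k → w (i + 1) =
      (-(q * q ^ (2 * (n + 1)) * q ^ (i + 1)) • (a (i + 1) * x ^ (i + 1)) + d i • u i - w i) * g) :
    q ^ (k + 1) • (a (k + 1) * x ^ (k + 1)) - u k + q⁻¹ • w k =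
      (-1 : ℂ) ^ (k + 1) • ∑ j ∈ Finset.range (k + 2),
        (-q) ^ j • (a j * x ^ j * elimH (x ^ 2) g q (k + 1 - j)) := by
  have key : ∀ i n, i + n = k → elimT (x ^ 2) g q n (u i) (w i) =
      (-1 : ℂ) ^ (k + 1) • ∑ j ∈ Finset.range (i + 1),
        (-q) ^ j • (a j * x ^ j * elimH (x ^ 2) g q (k + 1 - j)) := by
    intro i
    induction i with
    | zero =>
      intro n hn
      obtain rfl : n = k := by omega
      rw [hu0, hw0, elimT_start _ _ hq (hqk _ (by omega) le_rfl)]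
      simp [ha]
    | succ i ih =>
      intro n hn
      rw [hu i (by omega), hw i n (by omega), elimT_step _ _ hq hl (hqk _ (by omega) (by omega))
        (hqk _ (by omega) (by omega)) (hc i n (by omega)) (hd i n (by omega)), ih _ (by omega),
        Finset.sum_range_succ _ (i + 1), smul_add, smul_smul, show k + 1 - (i + 1) = n + 1 by omega,
        show k + 1 = (n + 1) + (i + 1) by omega, neg_pow q, pow_add _ (n + 1) (i + 1),
        mul_assoc _ _ (_ * _), ← mul_assoc ((-1 : ℂ) ^ (i + 1)), ← mul_pow, neg_one_mul, neg_neg,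
        one_pow, one_mul]
  have h0 := key k 0 rfl
  rw [elimT_zero _ _ hl] at h0
  have e : (-1 : ℂ) ^ (k + 1) * (-q) ^ (k + 1) = q ^ (k + 1) := by
    rw [← mul_pow, neg_one_mul, neg_neg]
  rw [Finset.sum_range_succ, smul_add, ← h0, smul_smul, e, Nat.sub_self, elimH, homSum,
    Finset.Nat.antidiagonal_zero, Finset.sum_singleton, mul_zero, pow_zero, pow_zero, pow_zero,
    mul_one, one_smul, mul_one]
  abel

end Elimination

section CayleyHamilton

variable {N : ℕ} [NeZero N] {A : Type*} [Ring A] [Algebra ℂ A]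
variable {q μ : ℂ} {R F Ψ : MatV N 2 ℂ} {M : Matrix (Fin N) (Fin N) A}

theorem pow_mul_zpow_sub_one (hq : q ≠ 0) (hl : q - q⁻¹ ≠ 0) (m : ℕ) :
    q ^ m * (q ^ (-(2 * (m : ℤ))) - 1) = -((q - q⁻¹) * nq q m) := by
  rw [nq, mul_div_cancel₀ _ hl, mul_sub, ← zpow_natCast, ← zpow_add₀ hq,
    show (m : ℤ) + -(2 * (m : ℤ)) = -m by ring]
  ring

/-- The coefficient of the contracted wedge power in the recurrence for the wedge powers. -/
def coeffC (q μ : ℂ) (m : ℕ) : ℂ := (q - q⁻¹) * μ / (μ + q * q ^ (-(2 * (m : ℤ))))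

/-- The coefficient of the wedge power in the recurrence for the contracted wedge powers. -/
def coeffD (q μ : ℂ) (m : ℕ) : ℂ :=
  (q - q⁻¹) * (q * q ^ (-(2 * (m : ℤ)))) / (μ + q * q ^ (-(2 * (m : ℤ))))

theorem mu_eq_mul (hq : q ≠ 0) {k : ℕ} (hμ : μ = -q ^ (-1 - 2 * ((k + 1 : ℕ) : ℤ))) {m n : ℕ}
    (h : m + n = k + 1) : μ = -(q⁻¹ * q ^ (-(2 * (m : ℤ))) * ((q⁻¹) ^ n * (q⁻¹) ^ n)) := by
  rw [hμ, ← h, ← zpow_natCast, ← _root_.zpow_neg_one, ← _root_.zpow_mul, ← zpow_add₀ hq,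
    ← zpow_add₀ hq,
    ← zpow_add₀ hq]
  congr 2
  push_cast
  ring

theorem mu_add_eq_mul (hq : q ≠ 0) (hl : q - q⁻¹ ≠ 0) {k : ℕ}
    (hμ : μ = -q ^ (-1 - 2 * ((k + 1 : ℕ) : ℤ))) {m n : ℕ} (h : m + n = k + 1) :
    μ + q * q ^ (-(2 * (m : ℤ))) =
      q ^ (-(2 * (m : ℤ))) * (q⁻¹) ^ n * ((q - q⁻¹) * nq q (n + 1)) := by
  have e : (q⁻¹) ^ n * q ^ n = 1 := by rw [← mul_pow, inv_mul_cancel₀ hq, one_pow]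
  rw [nq, mul_div_cancel₀ _ hl, mu_eq_mul hq hμ h,
    _root_.zpow_neg _ ((n + 1 : ℕ) : ℤ), zpow_natCast,
    ← inv_pow, pow_succ, pow_succ]
  linear_combination (-q * q ^ (-(2 * (m : ℤ)))) * e

theorem coeffC_mul (hq : q ≠ 0) (hl : q - q⁻¹ ≠ 0) {k : ℕ}
    (hμ : μ = -q ^ (-1 - 2 * ((k + 1 : ℕ) : ℤ))) {m n : ℕ} (h : m + n = k + 1)
    (hn : nq q (n + 1) ≠ 0) : coeffC q μ m * nq q (n + 1) = -(q⁻¹) ^ (n + 1) := by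
  have hx := zpow_ne_zero (-(2 * (m : ℤ))) hq
  have hz := pow_ne_zero n (inv_ne_zero hq)
  rw [coeffC, mu_add_eq_mul hq hl hμ h, mu_eq_mul hq hμ h, div_mul_eq_mul_div,
    div_eq_iff (mul_ne_zero (mul_ne_zero hx hz) (mul_ne_zero hl hn))]
  ring

theorem coeffD_mul (hq : q ≠ 0) (hl : q - q⁻¹ ≠ 0) {k : ℕ}
    (hμ : μ = -q ^ (-1 - 2 * ((k + 1 : ℕ) : ℤ))) {m n : ℕ} (h : m + n = k + 1)
    (hn : nq q (n + 1) ≠ 0) : coeffD q μ m * nq q (n + 1) = q ^ (n + 1) := by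
  have hx := zpow_ne_zero (-(2 * (m : ℤ))) hq
  have hz := pow_ne_zero n (inv_ne_zero hq)
  have e : (q⁻¹) ^ n * q ^ n = 1 := by rw [← mul_pow, inv_mul_cancel₀ hq, one_pow]
  rw [coeffD, mu_add_eq_mul hq hl hμ h, div_mul_eq_mul_div,
    div_eq_iff (mul_ne_zero (mul_ne_zero hx hz) (mul_ne_zero hl hn))]
  linear_combination (-(q - q⁻¹) * q * q ^ (-(2 * (m : ℤ))) * nq q (n + 1)) * e

namespace BMWQuantumMatrix

variable {k : ℕ}

theorem wedge_zero_eq (h : BMWQuantumMatrix q μ R F Ψ M) :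
    wedge q μ R F Ψ M 0 = mulPhi F Ψ M R 1 := by
  rw [wedge_zero]
  change _ = lift1 0 M * phiB F Ψ R 1
  rw [h.phiB_one, mul_one]

theorem pow_smul_theta (h : BMWQuantumMatrix q μ R F Ψ M) (i : ℕ) :
    q ^ (i + 1) • theta F Ψ M (i + 1)
        (anti A q μ R (i + 2) 1 (i + 1) * sg A q μ R (i + 2) 0 (i + 1)) =
      q ^ (i + 1) • (mulPhi F Ψ M R 1 * scal N 1 (aElt q μ R F Ψ M (i + 1))) -
      mulPhi F Ψ M R (nq q (i + 1) • wedge q μ R F Ψ M i) -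
      coeffC q μ (i + 1) • mulPhi F Ψ M (bmwK q μ R) (nq q (i + 1) • wedge q μ R F Ψ M i) := by
  have e := pow_mul_zpow_sub_one h.q_ne h.lam_ne (i + 1)
  have hl := h.lam_ne
  rw [h.theta_shift_mul_sg, ← wedge_zero (q := q) (μ := μ) (R := R) (F := F) (Ψ := Ψ),
    h.wedge_zero_eq, map_smul, map_smul, smul_add, smul_add, smul_smul, smul_smul, smul_smul,
    ← mul_div_assoc, ← mul_div_assoc, e, mul_left_comm, e, coeffC, ← mul_neg,
    mul_div_cancel_left₀ _ hl, neg_smul, ← sub_eq_add_neg,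
    show μ * ((q - q⁻¹) * -nq q (i + 1)) / (μ + q * q ^ (-(2 * ((i + 1 : ℕ) : ℤ)))) =
      -((q - q⁻¹) * μ / (μ + q * q ^ (-(2 * ((i + 1 : ℕ) : ℤ)))) * nq q (i + 1)) by ring,
    neg_smul, ← sub_eq_add_neg]

theorem wedge_recurrence (h : BMWQuantumMatrix q μ R F Ψ M)
    (hμk : ∀ m : ℕ, 1 ≤ m → m ≤ k → μ + q * q ^ (-(2 * (m : ℤ))) ≠ 0)
    (hqk : ∀ m : ℕ, 1 ≤ m → m ≤ k → nq q m ≠ 0) {i : ℕ} (hi : i + 2 ≤ k) :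
    nq q (i + 2) • wedge q μ R F Ψ M (i + 1) =
      q ^ (i + 1) • (mulPhi F Ψ M R 1 * scal N 1 (aElt q μ R F Ψ M (i + 1))) -
      mulPhi F Ψ M R (nq q (i + 1) • wedge q μ R F Ψ M i) -
      coeffC q μ (i + 1) • mulPhi F Ψ M (bmwK q μ R) (nq q (i + 1) • wedge q μ R F Ψ M i) := by
  rw [← h.pow_smul_theta, h.wedge_succ hμk hqk hi, smul_smul,
    mul_div_cancel₀ _ (hqk _ (by omega) hi)]

theorem contracted_wedge_recurrence (h : BMWQuantumMatrix q μ R F Ψ M)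
    (hμk : ∀ m : ℕ, 1 ≤ m → m ≤ k → μ + q * q ^ (-(2 * (m : ℤ))) ≠ 0)
    (hqk : ∀ m : ℕ, 1 ≤ m → m ≤ k → nq q m ≠ 0) {i : ℕ} (hi : i + 2 ≤ k) :
    mulPhi F Ψ M R (mulPhi F Ψ M (bmwK q μ R) (nq q (i + 2) • wedge q μ R F Ψ M (i + 1))) =
      ((μ⁻¹ * (q ^ (i + 1) * q ^ (-(2 * ((i + 1 : ℕ) : ℤ))))) •
          (mulPhi F Ψ M R 1 * scal N 1 (aElt q μ R F Ψ M (i + 1))) +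
        coeffD q μ (i + 1) • mulPhi F Ψ M R (nq q (i + 1) • wedge q μ R F Ψ M i) -
        mulPhi F Ψ M (bmwK q μ R) (nq q (i + 1) • wedge q μ R F Ψ M i)) *
        scal N 1 (gElt q μ R F Ψ M) := by
  have e := pow_mul_zpow_sub_one h.q_ne h.lam_ne (i + 1)
  have hl := h.lam_ne
  have hm := hμk (i + 1) (by omega) (by omega)
  simp only [map_smul]
  rw [h.mulPhi_mulPhi_wedge_succ hμk hqk hi, smul_smul, mul_div_cancel₀ _ (hqk _ (by omega) hi),
    ← smul_mul_assoc, ← wedge_zero (q := q) (μ := μ) (R := R) (F := F) (Ψ := Ψ), h.wedge_zero_eq]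
  congr 1
  rw [coeffD]
  set x := q ^ (-(2 * ((i + 1 : ℕ) : ℤ)))
  have e1 : q ^ (i + 1) * ((1 + (x - 1)) * μ⁻¹) = μ⁻¹ * (q ^ (i + 1) * x) := by ring
  have e2 : q ^ (i + 1) * ((x - 1) / (q - q⁻¹)) = -nq q (i + 1) := by
    rw [← mul_div_assoc, e, ← mul_neg, mul_div_cancel_left₀ _ hl]
  have e3 : q ^ (i + 1) * (μ * (x - 1) / (μ + q * x) - (x - 1)) =
      (q - q⁻¹) * (q * x) / (μ + q * x) * nq q (i + 1) := by
    rw [mul_sub, e, ← mul_div_assoc, mul_left_comm, e]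
    field_simp
    ring
  rw [smul_add, smul_add, smul_smul, smul_smul, smul_smul, e1, e2, e3, smul_smul, neg_smul]
  abel

theorem wedge_closing (h : BMWQuantumMatrix q μ R F Ψ M)
    (hμ : μ = -q ^ (-1 - 2 * ((k + 1 : ℕ) : ℤ)))
    (hμk : ∀ m : ℕ, 1 ≤ m → m ≤ k + 1 → μ + q * q ^ (-(2 * (m : ℤ))) ≠ 0)
    (hqk : ∀ m : ℕ, 1 ≤ m → m ≤ k + 1 → nq q m ≠ 0) (hc : HeightCut q μ R (k + 1)) :
    q ^ (k + 1) • (mulPhi F Ψ M R 1 * scal N 1 (aElt q μ R F Ψ M (k + 1))) -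
      mulPhi F Ψ M R (nq q (k + 1) • wedge q μ R F Ψ M k) +
      q⁻¹ • mulPhi F Ψ M (bmwK q μ R) (nq q (k + 1) • wedge q μ R F Ψ M k) = 0 := by
  have e := coeffC_mul h.q_ne h.lam_ne hμ (m := k + 1) (n := 0) rfl
    (by rw [nq_one h.lam_ne]; exact one_ne_zero)
  rw [zero_add, nq_one h.lam_ne, mul_one, pow_one] at e
  have e' := h.pow_smul_theta k
  rw [h.theta_cut hμk hqk hc, smul_zero, e, neg_smul, sub_neg_eq_add] at e'
  exact e'.symm

end BMWQuantumMatrix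

end CayleyHamilton

section CayleyHamiltonIdentity

variable {N : ℕ} [NeZero N] {A : Type*} [Ring A] [Algebra ℂ A]
variable {q μ : ℂ} {R F Ψ : MatV N 2 ℂ} {M : Matrix (Fin N) (Fin N) A}
variable {C : Type*} [CommRing C] [Algebra ℂ C]

theorem scal_mul {n : ℕ} (a b : A) : scal N n (a * b) = scal N n a * scal N n b := by
  rw [scal, scal, scal, Matrix.diagonal_mul_diagonal]

theorem scal_one {n : ℕ} : scal N n (1 : A) = 1 := Matrix.diagonal_one

theorem mul_scal_apply {n : ℕ} (X : MatV N n A) (c : A) (a b : Fin n → Fin N) :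
    (X * scal N n c) a b = X a b * c := by rw [scal, Matrix.mul_diagonal]

/-- The right action of a commutative ring of scalars on matrices. -/
def scalAction (N : ℕ) [NeZero N] (ι : C →ₐ[ℂ] A) : C →ₐ[ℂ] Module.End ℂ (MatV N 1 A) where
  toFun c := LinearMap.mulRight ℂ (scal N 1 (ι c))
  map_one' := by ext1 X; simp [scal_one]
  map_mul' c d := by
    ext1 X
    rw [mul_comm c d, _root_.map_mul, scal_mul]
    exact (mul_assoc _ _ _).symm
  map_zero' := by
    ext X a b
    simp [scal]
  map_add' c d := by
    ext X a b
    simp [mul_scal_apply, mul_add]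
  commutes' c := by
    ext X a b
    simp [mul_scal_apply, ← Algebra.commutes, Algebra.smul_def, Module.algebraMap_end_apply]

/-- The action of polynomials in the star-multiplication by `M` on matrices. -/
def polyAction (F Ψ : MatV N 2 ℂ) (hF : IsUnit F.det) (M : Matrix (Fin N) (Fin N) A)
    (R : MatV N 2 ℂ) (ι : C →ₐ[ℂ] A) : Polynomial C →ₐ[ℂ] Module.End ℂ (MatV N 1 A) :=
  { Polynomial.eval₂RingHom' (scalAction N ι : C →+* Module.End ℂ (MatV N 1 A)) (mulPhi F Ψ M R)
      fun c => LinearMap.ext fun X => (mulPhi_mul_scal hF R X (ι c)).symm with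
    commutes' := fun c => (Polynomial.eval₂_C _ _).trans ((scalAction N ι).commutes c) }

theorem polyAction_X (hF : IsUnit F.det) (ι : C →ₐ[ℂ] A) :
    polyAction F Ψ hF M R ι Polynomial.X = mulPhi F Ψ M R :=
  Polynomial.eval₂_X _ _

theorem polyAction_C (hF : IsUnit F.det) (ι : C →ₐ[ℂ] A) (c : C) :
    polyAction F Ψ hF M R ι (Polynomial.C c) = scalAction N ι c :=
  Polynomial.eval₂_C _ _

theorem inv_eq_neg_pow {k : ℕ} (hμ : μ = -q ^ (-1 - 2 * ((k + 1 : ℕ) : ℤ))) :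
    μ⁻¹ = -(q ^ (2 * k + 3)) := by
  rw [hμ, inv_neg, ← _root_.zpow_neg, ← zpow_natCast]
  congr 2
  push_cast
  ring

theorem inv_mul_pow_mul_zpow (hq : q ≠ 0) {k : ℕ} (hμ : μ = -q ^ (-1 - 2 * ((k + 1 : ℕ) : ℤ)))
    {i n : ℕ} (h : i + n + 1 = k) :
    μ⁻¹ * (q ^ (i + 1) * q ^ (-(2 * ((i + 1 : ℕ) : ℤ)))) =
      -(q * q ^ (2 * (n + 1)) * q ^ (i + 1)) := by
  have e : q ^ (2 * (i + 1)) * q ^ (-(2 * ((i + 1 : ℕ) : ℤ))) = 1 := by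
    rw [← zpow_natCast, ← zpow_add₀ hq, ← zpow_zero q]
    congr 1
    push_cast
    ring
  rw [inv_eq_neg_pow hμ, ← h]
  linear_combination (-(q * q ^ (2 * (n + 1)) * q ^ (i + 1))) * e

/-- The images of the wedge powers and contracted wedge powers of the quantum matrix. -/
def elimSeq {S : Type*} [CommRing S] [Algebra ℂ S] (x g : S) (q μ : ℂ) (k : ℕ) (a : ℕ → S) :
    ℕ → S × S
  | 0 => (x ^ 2, -(q ^ (2 * k + 3)) • g)
  | i + 1 =>
      (q ^ (i + 1) • (x ^ 2 * (a (i + 1) * x ^ (i + 1))) - x ^ 2 * (elimSeq x g q μ k a i).1 -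
        coeffC q μ (i + 1) • (x ^ 2 * (elimSeq x g q μ k a i).2),
      ((μ⁻¹ * (q ^ (i + 1) * q ^ (-(2 * ((i + 1 : ℕ) : ℤ))))) • (a (i + 1) * x ^ (i + 1)) +
        coeffD q μ (i + 1) • (elimSeq x g q μ k a i).1 - (elimSeq x g q μ k a i).2) * g)

/-- The symplectic Cayley–Hamilton identity. -/
theorem BMWQuantumMatrix.cayleyHamilton (h : BMWQuantumMatrix q μ R F Ψ M) {k : ℕ}
    (hμ : μ = -q ^ (-1 - 2 * ((k + 1 : ℕ) : ℤ)))
    (hμk : ∀ m : ℕ, 1 ≤ m → m ≤ k + 1 → μ + q * q ^ (-(2 * (m : ℤ))) ≠ 0)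
    (hqk : ∀ m : ℕ, 1 ≤ m → m ≤ k + 1 → nq q m ≠ 0) (hc : HeightCut q μ R (k + 1))
    (ι : C →ₐ[ℂ] A) (γ : C) (β : ℕ → C) (hγ : ι γ = gElt q μ R F Ψ M) (hβ0 : β 0 = 1)
    (hβ : ∀ j, 1 ≤ j → j ≤ k + 1 → ι (β j) = aElt q μ R F Ψ M j) :
    ∑ j ∈ Finset.range (k + 2), ∑ p ∈ Finset.HasAntidiagonal.antidiagonal (k + 1 - j),
      ((-q) ^ j * q ^ (2 * p.2)) •
        ((mulPhi F Ψ M R ^ (j + 2 * p.1)) 1 * scal N 1 (ι (β j * γ ^ p.2))) = 0 := by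
  have hq := h.q_ne
  have hl := h.lam_ne
  set L := mulPhi F Ψ M R with hL
  set ρ := polyAction F Ψ h.det' M R ι with hρ
  have ev_X (n : ℕ) (p : Polynomial C) : ρ (Polynomial.X ^ n * p) 1 = (L ^ n) (ρ p 1) := by
    rw [_root_.map_mul, _root_.map_pow, hρ, polyAction_X]; rfl
  have ev_X1 (n : ℕ) : ρ (Polynomial.X ^ n) 1 = (L ^ n) 1 := by
    rw [_root_.map_pow, hρ, polyAction_X]
  have ev_C (p : Polynomial C) (c : C) :
      ρ (p * Polynomial.C c) 1 = ρ p 1 * scal N 1 (ι c) := by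
    rw [mul_comm, _root_.map_mul, hρ, polyAction_C]; rfl
  have ev_smul (c : ℂ) (p : Polynomial C) : ρ (c • p) 1 = c • ρ p 1 := by
    rw [map_smul]; rfl
  have ev_add (p p' : Polynomial C) : ρ (p + p') 1 = ρ p 1 + ρ p' 1 := by
    rw [map_add]; rfl
  have ev_sub (p p' : Polynomial C) : ρ (p - p') 1 = ρ p 1 - ρ p' 1 := by
    rw [map_sub]; rfl
  have pow_scal (n : ℕ) (Z : MatV N 1 A) (c : A) :
      (L ^ n) (Z * scal N 1 c) = (L ^ n) Z * scal N 1 c := by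
    induction n with
    | zero => rfl
    | succ n ih =>
      rw [pow_succ', Module.End.mul_apply, Module.End.mul_apply, ih, hL,
        mulPhi_mul_scal h.det']
  have pow_succ_apply (n : ℕ) (Z : MatV N 1 A) : (L ^ n) (L Z) = (L ^ (n + 1)) Z := by
    rw [pow_succ]; rfl
  have pow_pow_apply (m n : ℕ) (Z : MatV N 1 A) : (L ^ m) ((L ^ n) Z) = (L ^ (m + n)) Z := by
    rw [pow_add]; rfl
  obtain ⟨z, hz⟩ : ∃ z, z = elimSeq Polynomial.X (Polynomial.C γ) q μ k
    fun j => Polynomial.C (β j) := ⟨_, rfl⟩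
  have hz0 : z 0 = (Polynomial.X ^ 2, -(q ^ (2 * k + 3)) • Polynomial.C γ) := by rw [hz, elimSeq]
  have hzs (i : ℕ) := congrArg (fun f => f (i + 1)) hz
  simp only [elimSeq, ← hz] at hzs
  have key : ∀ i ≤ k,
      ρ (z i).1 1 = (L ^ (i + 1)) (nq q (i + 1) • wedge q μ R F Ψ M i) ∧
      ρ (z i).2 1 =
        (L ^ i) (mulPhi F Ψ M (bmwK q μ R) (nq q (i + 1) • wedge q μ R F Ψ M i)) := by
    intro i
    induction i with
    | zero =>
      intro _
      rw [hz0, zero_add, nq_one hl, one_smul, h.mulPhi_bmwK_wedge_zero, h.wedge_zero_eq,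
        ev_X1, pow_succ_apply, ev_smul, ← one_mul (Polynomial.C γ), ev_C, inv_eq_neg_pow hμ, hγ]
      simp
    | succ i ih =>
      intro hi
      obtain ⟨ih1, ih2⟩ := ih (by omega)
      simp only [hzs]
      have e1 := h.wedge_recurrence hμk hqk (i := i) (by omega)
      have e2 := h.contracted_wedge_recurrence hμk hqk (i := i) (by omega)
      rw [← hL] at e1 e2
      rw [← pow_succ_apply i (mulPhi _ _ _ _ _), e2, e1, ← hβ (i + 1) (by omega) (by omega), ← hγ]
      generalize nq q (i + 1) • wedge q μ R F Ψ M i = y at *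
      constructor
      · rw [ev_sub, ev_sub, ev_smul, ev_smul, ev_X, ev_X, ev_X, mul_comm (Polynomial.C _), ev_C,
          ev_X1, ih1, ih2, pow_scal, pow_pow_apply, pow_pow_apply, pow_pow_apply, map_sub, map_sub,
          map_smul, map_smul, pow_scal, pow_succ_apply, pow_succ_apply, add_comm 2 i,
          show 2 + (i + 1) = i + 1 + 1 + 1 by ring]
      · rw [ev_C, ev_sub, ev_add, ev_smul, ev_smul, mul_comm (Polynomial.C _), ev_C, ev_X1, ih1,
          ih2, pow_scal, map_sub, map_add, map_smul, map_smul, pow_scal, pow_succ_apply,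
          pow_succ_apply]
  have cl := congrArg (L ^ k) (h.wedge_closing hμ hμk hqk hc)
  have el := elimination (S := Polynomial C) Polynomial.X (Polynomial.C γ) hq hl hqk
    (fun i => coeffC q μ (i + 1)) (fun i => coeffD q μ (i + 1))
    (fun i n hn => coeffC_mul hq hl hμ (by omega) (hqk _ (by omega) (by omega)))
    (fun i n hn => coeffD_mul hq hl hμ (by omega) (hqk _ (by omega) (by omega)))
    (fun j => Polynomial.C (β j)) (fun i => (z i).1) (fun i => (z i).2) (by simp [hβ0])
    (by simp only [hz0]) (by simp only [hz0]) (fun i _ => by simp only [hzs])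
    (fun i n hn => by simp only [hzs, inv_mul_pow_mul_zpow hq hμ hn])
  obtain ⟨key1, key2⟩ := key k le_rfl
  rw [← hL] at cl
  generalize nq q (k + 1) • wedge q μ R F Ψ M k = y at *
  have fin := congrArg (fun p => ρ p 1) el
  simp only [ev_add, ev_sub, ev_smul] at fin
  rw [mul_comm (Polynomial.C (β (k + 1))), ev_C, ev_X1, key1, key2, hβ (k + 1) (by omega) le_rfl]
    at fin
  rw [map_add, map_sub, map_smul, map_smul, pow_scal, pow_succ_apply, pow_succ_apply,
    map_zero] at cl
  rw [cl, eq_comm, smul_eq_zero_iff_right (pow_ne_zero _ (neg_ne_zero.2 one_ne_zero))] at fin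
  refine Eq.trans ?_ fin
  simp only [map_sum, LinearMap.sum_apply]
  refine Finset.sum_congr rfl fun j _ => ?_
  rw [ev_smul, elimH, homSum, Finset.mul_sum, map_sum, LinearMap.sum_apply, Finset.smul_sum]
  refine Finset.sum_congr rfl fun p _ => ?_
  rw [mul_smul_comm, ev_smul, smul_smul, ← ev_X1, ← ev_C]
  congr 3
  rw [_root_.map_mul, _root_.map_pow, pow_add, pow_mul]
  ring

end CayleyHamiltonIdentity

section StarPowers

variable {N : ℕ} [NeZero N] {A : Type*} [Ring A] [Algebra ℂ A]

theorem ofN_toN (Z : MatV N 1 A) : ofN (toN Z) = Z := by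
  ext a b
  exact congrArg₂ Z (funext fun i => by rw [Subsingleton.elim i 0])
    (funext fun i => by rw [Subsingleton.elim i 0])

theorem lift1_zero_one_strand (X : Matrix (Fin N) (Fin N) A) :
    (lift1 0 X : MatV N 1 A) = ofN X := by
  ext a b
  simp [lift1, ofN, idx]

theorem ofN_mul (X Y : Matrix (Fin N) (Fin N) A) : ofN (X * Y) = ofN X * ofN Y := by
  ext a b
  simp only [ofN, Matrix.mul_apply]
  exact ((Equiv.funUnique (Fin 1) (Fin N)).sum_comp fun c => X (a 0) c * Y c (b 0)).symm

theorem ofN_one : ofN (1 : Matrix (Fin N) (Fin N) A) = 1 := by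
  rw [← lift1_zero_one_strand, lift1_zero_eq_place]
  ext a b
  simp only [place, ofN, Matrix.one_apply]
  simp [idx, funext_iff]

theorem ofN_phi (F Ψ R : MatV N 2 ℂ) (X : Matrix (Fin N) (Fin N) A) :
    ofN (phi R F Ψ X) = phiB F Ψ R (ofN X) := by
  rw [phi, ofN_toN, phiB_apply, shift, chain, chain, chainRev, chainRev, one_mul, mul_one,
    ← ext1_lift1 (n := 1) one_pos, lift1_zero_one_strand]
  rfl

theorem ofN_starPow (F Ψ R : MatV N 2 ℂ) (M : Matrix (Fin N) (Fin N) A) :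
    ∀ n, ofN (starPow R F Ψ M n) = (mulPhi F Ψ M R ^ n) 1
  | 0 => ofN_one
  | n + 1 => by
    rw [starPow, ofN_mul, ofN_phi, ofN_starPow F Ψ R M n, ← lift1_zero_one_strand, pow_succ']
    rfl

end StarPowers

section Palindromic

variable {S : Type*} [CommRing S]

theorem sum_mul_pow_sub_succ (y : S) (f : ℕ → S) (n : ℕ) :
    ∑ j ∈ Finset.range (n + 1), f j * y ^ (n + 1 - j) =
      y * ∑ j ∈ Finset.range (n + 1), f j * y ^ (n - j) := by
  rw [Finset.mul_sum]
  refine Finset.sum_congr rfl fun j hj => ?_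
  rw [Nat.succ_sub (Finset.mem_range_succ_iff.1 hj), pow_succ', mul_left_comm]

variable {y : S} {u w : ℕ → S}

theorem sum_mul_pow_of_recurrence (h0 : u 0 = w 0) (h1 : u 1 = w 1)
    (h : ∀ j, u (j + 2) = w (j + 2) - y * w j) (k : ℕ) :
    ∑ j ∈ Finset.range (k + 2), u j * y ^ (k + 1 - j) =
      ∑ j ∈ Finset.range (k + 2), w j * y ^ (k + 1 - j) -
        ∑ j ∈ Finset.range k, w j * y ^ (k - j) := by
  induction k with
  | zero => simp [Finset.sum_range_succ, h0, h1]
  | succ k ih =>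
    rw [Finset.sum_range_succ, Finset.sum_range_succ _ (k + 2), sum_mul_pow_sub_succ y u (k + 1),
      ih, sum_mul_pow_sub_succ y w (k + 1), sum_mul_pow_sub_succ y w k,
      Finset.sum_range_succ _ k, h, Nat.sub_self, Nat.sub_self]
    ring

theorem sum_mul_geom_of_recurrence (h0 : u 0 = w 0) (h1 : u 1 = w 1)
    (h : ∀ j, u (j + 2) = w (j + 2) - y * w j) (k : ℕ) :
    ∑ j ∈ Finset.range (k + 1),
        u j * ∑ p ∈ Finset.HasAntidiagonal.antidiagonal (k - j), y ^ p.2 =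
      ∑ j ∈ Finset.range (k + 1), w j + ∑ j ∈ Finset.range k, w j * y ^ (k - j) := by
  induction k with
  | zero => simp [h0]
  | succ k ih =>
    have e : ∀ j ∈ Finset.range (k + 1),
        u j * ∑ p ∈ Finset.HasAntidiagonal.antidiagonal (k + 1 - j), y ^ p.2 =
          u j * y ^ (k + 1 - j) +
            u j * ∑ p ∈ Finset.HasAntidiagonal.antidiagonal (k - j), y ^ p.2 := by
      intro j hj
      rw [Nat.succ_sub (Finset.mem_range_succ_iff.1 hj), Finset.Nat.sum_antidiagonal_succ, mul_add]
    have e' := sum_mul_pow_of_recurrence h0 h1 h k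
    rw [Finset.sum_range_succ, Finset.sum_range_succ _ (k + 1)] at e'
    rw [Finset.sum_range_succ, Finset.sum_congr rfl e, Finset.sum_add_distrib, ih,
      Finset.sum_range_succ w (k + 1)]
    simp only [Nat.sub_self, pow_zero, mul_one, Finset.Nat.antidiagonal_zero,
      Finset.sum_singleton] at e' ⊢
    linear_combination e'

/-- A palindromic sequence is recovered from the differences `b_j = c_j - g c_{j-2}`. -/
theorem sum_eq_of_palindromic {G : Type*} [AddCommGroup G] (T : ℕ → S →+ G) {g : S} {b c : ℕ → S}
    (h0 : b 0 = c 0) (h1 : b 1 = c 1) {k : ℕ} (h : ∀ j, b (j + 2) = c (j + 2) - g * c j)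
    (hc : ∀ i ≤ k, c (k + i) = g ^ i * c (k - i)) :
    ∑ i ∈ Finset.range (2 * k + 1), T i (c i) =
      ∑ j ∈ Finset.range (k + 1), ∑ p ∈ Finset.HasAntidiagonal.antidiagonal (k - j),
        T (j + 2 * p.2) (b j * g ^ p.2) := by
  have e := sum_mul_geom_of_recurrence (u := fun j => Polynomial.monomial j (b j))
    (w := fun j => Polynomial.monomial j (c j)) (y := Polynomial.monomial 2 g) (by simp [h0])
    (by simp [h1]) (fun j => by rw [h, Polynomial.monomial_mul_monomial, add_comm 2, map_sub]) k
  let Λ : Polynomial S →ₗ[ℕ] G := Polynomial.lsum fun i => (T i).toNatLinearMap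
  have hΛ (i : ℕ) (a : S) : Λ (Polynomial.monomial i a) = T i a := by
    simp [Λ, Polynomial.lsum_apply, Polynomial.sum_monomial_index]
  have e' := congrArg Λ e
  simp only [Finset.mul_sum, Polynomial.monomial_pow, Polynomial.monomial_mul_monomial, map_sum,
    map_add, hΛ] at e'
  rw [e', two_mul, add_right_comm, Finset.sum_range_add, ← Finset.sum_range_reflect _ k]
  congr 1
  refine Finset.sum_congr rfl fun j hj => ?_
  have hj := Finset.mem_range.1 hj
  rw [mul_comm (c j), show k + 1 + (k - 1 - j) = k + (k - j) by omega, hc _ (Nat.sub_le k j),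
    Nat.sub_sub_self hj.le, show k + (k - j) = j + 2 * (k - j) by omega]

end Palindromic

section SpectralVariables

variable {S : Type*} [CommRing S]

theorem esymmList_cons_zero (a : S) (l : List S) : esymmList (a :: l) 0 = esymmList l 0 := by
  simp [esymmList, add_mul, mul_assoc]

theorem esymmList_cons_succ (a : S) (l : List S) (i : ℕ) :
    esymmList (a :: l) (i + 1) = a * esymmList l i + esymmList l (i + 1) := by
  simp [esymmList, add_mul, mul_assoc]

theorem esymmList_zero (l : List S) : esymmList l 0 = 1 := by
  induction l with
  | nil => simp [esymmList]
  | cons a l ih => rw [esymmList_cons_zero, ih]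

theorem map_esymmList {S' : Type*} [CommRing S'] (f : S →+* S') (l : List S) (i : ℕ) :
    f (esymmList l i) = esymmList (l.map f) i := by
  rw [esymmList, esymmList, ← Polynomial.coeff_map, Polynomial.map_list_prod, List.map_map,
    List.map_map]
  simp [Function.comp_def]

/-- The coefficients of a polynomial, extended by zero to the integers. -/
def zcoeff (P : Polynomial S) (m : ℤ) : S := if 0 ≤ m then P.coeff m.toNat else 0

theorem zcoeff_natCast (P : Polynomial S) (m : ℕ) : zcoeff P m = P.coeff m := by simp [zcoeff]

theorem zcoeff_mul_linear (P : Polynomial S) (a : S) (m : ℤ) :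
    zcoeff (P * (Polynomial.C a * Polynomial.X + 1)) m = zcoeff P m + a * zcoeff P (m - 1) := by
  rcases lt_trichotomy m 0 with h | rfl | h
  · simp [zcoeff, h.not_ge, show ¬ 1 ≤ m by omega]
  · simp [zcoeff, mul_add]
  · obtain ⟨n, rfl⟩ := Int.le.dest (show 1 ≤ m by omega)
    rw [add_sub_cancel_left, zcoeff_natCast, add_comm, ← Nat.cast_one (R := ℤ), ← Nat.cast_add,
      zcoeff_natCast, zcoeff_natCast, mul_add, mul_one, ← mul_assoc, mul_comm P,
      Polynomial.coeff_add, add_comm 1 n, Polynomial.coeff_mul_X, Polynomial.coeff_C_mul, add_comm]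

theorem zcoeff_prod_palindromic {g : S} (a b : ℕ → S) :
    ∀ n : ℕ, (∀ i < n, a i * b i = g) → ∀ i : ℕ,
      zcoeff (∏ j ∈ Finset.range n, (Polynomial.C (a j) * Polynomial.X + 1) *
          (Polynomial.C (b j) * Polynomial.X + 1)) (n + i) =
        g ^ i * zcoeff (∏ j ∈ Finset.range n, (Polynomial.C (a j) * Polynomial.X + 1) *
          (Polynomial.C (b j) * Polynomial.X + 1)) (n - i)
  | _, _, 0 => by simp
  | 0, _, i + 1 => by
    rw [Finset.prod_range_zero, Nat.cast_zero, zero_add, zcoeff_natCast, Polynomial.coeff_one,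
      zcoeff, if_neg (by omega), if_neg (by omega), mul_zero]
  | n + 1, h, i + 1 => by
    have ih := zcoeff_prod_palindromic a b n fun i hi => h i (hi.trans n.lt_succ_self)
    have h0 := ih i
    have h1 := ih (i + 1)
    have h2 := ih (i + 2)
    rw [Finset.prod_range_succ, ← mul_assoc]
    simp only [zcoeff_mul_linear]
    generalize (∏ j ∈ Finset.range n, (Polynomial.C (a j) * Polynomial.X + 1) *
      (Polynomial.C (b j) * Polynomial.X + 1)) = P at *
    have hg := h n n.lt_succ_self
    push_cast at *
    rw [show (n : ℤ) + 1 + (i + 1) = n + (i + 2) by ring,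
      show (n : ℤ) + (i + 2) - 1 = n + (i + 1) by ring,
      show (n : ℤ) + (i + 1) - 1 = n + i by ring,
      show (n : ℤ) + 1 - (i + 1) = n - i by ring,
      show (n : ℤ) - i - 1 = n - (i + 1) by ring,
      show (n : ℤ) - (i + 1) - 1 = n - (i + 2) by ring, h0, h1, h2, ← hg]
    ring

theorem esymmList_palindromic {g : S} {k : ℕ} (v : ℕ → S)
    (hv : ∀ i < k, v (k + i) * v (k - 1 - i) = g) {i : ℕ} (hi : i ≤ k) :
    esymmList ((List.finRange (2 * k)).map fun j : Fin (2 * k) => v j) (k + i) =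
      g ^ i * esymmList ((List.finRange (2 * k)).map fun j : Fin (2 * k) => v j) (k - i) := by
  have e := zcoeff_prod_palindromic (fun i => v (k + i)) (fun i => v (k - 1 - i)) k hv i
  rw [Finset.prod_mul_distrib, Finset.prod_range_reflect fun j =>
    Polynomial.C (v j) * Polynomial.X + 1, mul_comm (Finset.prod _ _), ← Finset.prod_range_add,
    ← two_mul, ← Fin.prod_univ_eq_prod_range, Fin.prod_univ_def, ← Nat.cast_add, ← Nat.cast_sub hi,
    zcoeff_natCast, zcoeff_natCast] at e
  simpa only [esymmList, List.map_map, Function.comp_def] using e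

theorem esymmList_nuVars_palindromic (k : ℕ) {i : ℕ} (hi : i ≤ k) :
    Ideal.Quotient.mk (Erel k) (esymmList (nuVars k) (k + i)) =
      Ideal.Quotient.mk (Erel k) (MvPolynomial.X (⟨0, by omega⟩ : Fin (2 * k + 1)) ^ 2) ^ i *
        Ideal.Quotient.mk (Erel k) (esymmList (nuVars k) (k - i)) := by
  have e := esymmList_palindromic (k := k)
    (g := Ideal.Quotient.mk (Erel k) (MvPolynomial.X (⟨0, by omega⟩ : Fin (2 * k + 1)) ^ 2))
    (fun j => if h : j < 2 * k then
      Ideal.Quotient.mk (Erel k) (MvPolynomial.X (Fin.succ ⟨j, h⟩)) else 0) (fun i hi => ?_) hi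
  · rw [map_esymmList, map_esymmList, nuVars, List.map_map]
    simpa only [Fin.is_lt, dif_pos, Fin.eta, Function.comp_def] using e
  · rw [dif_pos (show k + i < 2 * k by omega), dif_pos (show k - 1 - i < 2 * k by omega),
      ← _root_.map_mul, Ideal.Quotient.eq]
    refine Ideal.subset_span ⟨⟨i, hi⟩, ?_⟩
    congr 3
    exact Fin.ext (show k - 1 - i + 1 = k - i by omega)

end SpectralVariables

section SpectralForm

variable {N : ℕ} [NeZero N] {A : Type*} [Ring A] [Algebra ℂ A]
variable {q μ : ℂ} {R F Ψ : MatV N 2 ℂ} {M : Matrix (Fin N) (Fin N) A}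
variable {C : Type*} [CommRing C] [Algebra ℂ C]

/-- The spectral form of the Cayley–Hamilton identity, paired by an arbitrary balanced
biadditive map. -/
theorem BMWQuantumMatrix.spectral (h : BMWQuantumMatrix q μ R F Ψ M) {k : ℕ}
    (hμ : μ = -q ^ (-1 - 2 * ((k + 1 : ℕ) : ℤ)))
    (hμk : ∀ m : ℕ, 1 ≤ m → m ≤ k + 1 → μ + q * q ^ (-(2 * (m : ℤ))) ≠ 0)
    (hqk : ∀ m : ℕ, 1 ≤ m → m ≤ k + 1 → nq q m ≠ 0) (hc : HeightCut q μ R (k + 1))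
    (ι : C →ₐ[ℂ] A) (γ : C) (α : ℕ → C) (hγ : ι γ = gElt q μ R F Ψ M)
    (hα : ∀ j, 1 ≤ j → j ≤ k + 1 → ι (α j) = aElt q μ R F Ψ M j)
    (π : C →ₐ[ℂ] Espec (k + 1))
    (hπγ : π γ = Ideal.Quotient.mk (Erel (k + 1)) (MvPolynomial.X ⟨0, by omega⟩ ^ 2))
    (hπα : ∀ j, 1 ≤ j → j ≤ k + 1 → π (α j) = Ideal.Quotient.mk (Erel (k + 1))
      (esymmList (MvPolynomial.X ⟨0, by omega⟩ :: (-MvPolynomial.X ⟨0, by omega⟩) ::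
        nuVars (k + 1)) j))
    {G : Type*} [AddCommGroup G] (B : A →+ Espec (k + 1) →+ G)
    (hB : ∀ a c e, B (a * ι c) e = B a (π c * e)) (a b : Fin N) :
    ∑ i ∈ Finset.range (2 * (k + 1) + 1),
      B (((-q) ^ i • starPow R F Ψ M (2 * (k + 1) - i)) a b)
        (Ideal.Quotient.mk (Erel (k + 1)) (esymmList (nuVars (k + 1)) i)) = 0 := by
  set x : MvPolynomial (Fin (2 * (k + 1) + 1)) ℂ := MvPolynomial.X ⟨0, by omega⟩
  set β : ℕ → C := fun j => if j = 0 then 1 else α j with hβ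
  have hβ0 : β 0 = 1 := if_pos rfl
  have hβα (j : ℕ) (hj : 1 ≤ j) : β j = α j := if_neg (by omega)
  have hπβ (j : ℕ) (hj : j ≤ k + 1) : π (β j) =
      Ideal.Quotient.mk (Erel (k + 1)) (esymmList (x :: (-x) :: nuVars (k + 1)) j) := by
    rcases Nat.eq_zero_or_pos j with rfl | hj0
    · rw [hβ0, esymmList_zero, _root_.map_one, _root_.map_one]
    · rw [hβα j hj0, hπα j hj0 hj]
  rw [sum_eq_of_palindromic
    (fun i => B (((-q) ^ i • starPow R F Ψ M (2 * (k + 1) - i)) a b))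
    (b := fun j => Ideal.Quotient.mk (Erel (k + 1))
      (esymmList (x :: (-x) :: nuVars (k + 1)) j))
    (c := fun j => Ideal.Quotient.mk (Erel (k + 1)) (esymmList (nuVars (k + 1)) j))
    (g := Ideal.Quotient.mk (Erel (k + 1)) (x ^ 2)) ?_ ?_ ?_
    fun i hi => esymmList_nuVars_palindromic (k + 1) hi]
  · have e := congrArg (B · 1) (congrFun (congrFun (h.cayleyHamilton hμ hμk hqk hc ι γ β hγ hβ0
      fun j hj hjk => (hβα j hj).symm ▸ hα j hj hjk) fun _ => a) fun _ => b)
    simp only [Matrix.sum_apply, Matrix.zero_apply, _root_.map_zero, _root_.map_sum,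
      AddMonoidHom.zero_apply, AddMonoidHom.finsetSum_apply, Matrix.smul_apply,
      mul_scal_apply, ← smul_mul_assoc, hB, mul_one] at e
    rw [← e]
    refine Finset.sum_congr rfl fun j hj => Finset.sum_congr rfl fun p hp => ?_
    have hj := Finset.mem_range_succ_iff.1 hj
    have hp := Finset.HasAntidiagonal.mem_antidiagonal.1 hp
    rw [_root_.map_mul π, _root_.map_pow π, hπβ j hj, hπγ, ← ofN_starPow, Matrix.smul_apply,
      show 2 * (k + 1) - (j + 2 * p.2) = j + 2 * p.1 by omega, pow_add, pow_mul (-q), neg_sq,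
      ← pow_mul]
    rfl
  · simp only [esymmList_zero]
  · simp only [esymmList_cons_succ, esymmList_zero]
    ring_nf
  · intro j
    simp only [esymmList_cons_succ, ← _root_.map_mul, ← _root_.map_sub]
    ring_nf

end SpectralForm

end SymplecticCayleyHamilton

set_option synthInstance.maxHeartbeats 1000000 in
set_option maxHeartbeats 2000000 in
/-- **Factorized (spectral) form of the symplectic Cayley–Hamilton identity**
(Proposition 4.12 of Ogievetsky–Pyatov).

Let `{R,F}` be a compatible pair with `F` strict skew invertible and `R` skew invertible of
`Sp(2k)` type, let `C` be the (commutative) characteristic subalgebra of `M(R,F)` generated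
by `g` and `a_1, …, a_k` (presented by a commutative `ℂ`-algebra `C` with an injective map
`ι : C → M(R,F)`), and let `π_{Sp(2k)} : C → E_{2k}` be a `ℂ`-algebra homomorphism with
`π(g) = ν_0²`, `π(a_i) = e_i(ν_0, -ν_0, ν_1, …, ν_{2k})`.  Regarding `E_{2k}` as a
`C`-module via `π_{Sp(2k)}` and the quantum matrices as a right `C`-module, one has
`∑_{i=0}^{2k} (-q)^i M^{[2k-i]} ⊗ e_i(ν_1, …, ν_{2k}) = 0`, i.e. the Cayley–Hamilton
polynomial factorizes completely as `∏⋆_{i=1}^{2k} (M - q ν_i I) = 0`. -/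
theorem symplectic_cayley_hamilton_spectral_factorization
    {N : ℕ} [NeZero N] (k : ℕ) (hk : 2 ≤ k) (q μ : ℂ)
    (hq0 : q ≠ 0) (hq1 : q ≠ 1) (hqm1 : q ≠ -1)
    (hμ0 : μ ≠ 0) (hμq : μ ≠ q) (hμq' : μ ≠ -q⁻¹)
    (hiq : ∀ i : ℕ, 2 ≤ i → i ≤ k → nq q i ≠ 0)
    (hμi : ∀ i : ℕ, 1 ≤ i → i ≤ k → μ ≠ -q ^ (1 - 2 * (i : ℤ)))
    (R F ΨR ΨF : MatV N 2 ℂ)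
    (hRbraid : IsBraid R) (hRdet : IsUnit R.det)
    (hFbraid : IsBraid F) (hFdet : IsUnit F.det)
    (hcomp : Compatible R F)
    (hΨR : SkewPair R ΨR) (hΨF : SkewPair F ΨF)
    (hFstrict : IsUnit (Dof ΨF).det)
    (hbmw : IsBMW q μ R)
    (hheight : HasHeight q μ R k)
    (hμval : μ = -q ^ (-1 - 2 * (k : ℤ)))
    (A : Type*) [Ring A] [Algebra ℂ A]
    (M : Matrix (Fin N) (Fin N) A)
    (hM : QMArel R F M)
    (C : Type*) [CommRing C] [Algebra ℂ C]
    (ι : C →ₐ[ℂ] A) (hι : Function.Injective ι)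
    (γ : C) (α : ℕ → C)
    (hγ : ι γ = gElt q μ R F ΨR M)
    (hα : ∀ i : ℕ, 1 ≤ i → i ≤ k → ι (α i) = aElt q μ R F ΨR M i)
    (hgen : Algebra.adjoin ℂ ({γ} ∪ (α '' {i | 1 ≤ i ∧ i ≤ k})) = (⊤ : Subalgebra ℂ C))
    (πs : C →ₐ[ℂ] Espec k)
    (hπγ : πs γ =
      Ideal.Quotient.mk (Erel k) (MvPolynomial.X (⟨0, by omega⟩ : Fin (2 * k + 1)) ^ 2))
    (hπα : ∀ i : ℕ, 1 ≤ i → i ≤ k →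
      πs (α i) =
        Ideal.Quotient.mk (Erel k)
          (esymmList
            (MvPolynomial.X (⟨0, by omega⟩ : Fin (2 * k + 1)) ::
              (-MvPolynomial.X (⟨0, by omega⟩ : Fin (2 * k + 1))) :: nuVars k) i)) :
    letI : Module C A := rModule ι.toRingHom
    letI : Module C (Espec k) := Module.compHom (Espec k) πs.toRingHom
    ∀ a b : Fin N,
      ∑ i ∈ Finset.range (2 * k + 1),
          ((-q) ^ i • starPow R F ΨR M (2 * k - i)) a b ⊗ₜ[C]
            Ideal.Quotient.mk (Erel k) (esymmList (nuVars k) i) =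
        (0 : TensorProduct C A (Espec k)) := by
  let _ : Module C A := rModule ι.toRingHom
  let _ : Module C (Espec k) := Module.compHom (Espec k) πs.toRingHom
  intro a b
  obtain ⟨k, rfl⟩ : ∃ k', k = k' + 1 := ⟨k - 1, by omega⟩
  have hl : q - q⁻¹ ≠ 0 := fun h => by
    have h2 : (q - 1) * (q + 1) = 0 := by
      linear_combination q * h + mul_inv_cancel₀ hq0
    rcases mul_eq_zero.1 h2 with h | h
    · exact hq1 (sub_eq_zero.1 h)
    · exact hqm1 (eq_neg_of_add_eq_zero_left h)
  have h : BMWQuantumMatrix q μ R F ΨR M :=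
    ⟨hq0, hl, hμ0, sub_ne_zero.2 hμq.symm, fun h => hμq' (eq_neg_of_add_eq_zero_right h),
      hRbraid, hRdet, hFbraid, hFdet, hcomp, hΨR, hbmw, hM⟩
  refine h.spectral hμval (fun m h1 hm e => hμi m h1 hm ?_) (fun m h1 hm => ?_) hheight.2.2 ι γ α
    hγ hα πs hπγ hπα
    { toFun := fun x =>
        { toFun := fun e => x ⊗ₜ[C] e
          map_zero' := TensorProduct.tmul_zero _ x
          map_add' := TensorProduct.tmul_add x }
      map_zero' := AddMonoidHom.ext fun e => TensorProduct.zero_tmul _ e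
      map_add' := fun x y => AddMonoidHom.ext fun e => TensorProduct.add_tmul x y e }
    (fun x c e => TensorProduct.smul_tmul (R := C) c x e) a b
  · rw [sub_eq_add_neg, zpow_add₀ hq0, zpow_one]
    exact eq_neg_of_add_eq_zero_left e
  · obtain rfl | h2 := h1.eq_or_lt
    · exact (nq_one hl).symm ▸ one_ne_zero
    · exact hiq m h2 hm

end QMA

end
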